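/- Let (u₀^ε)_ε satisfy assumption (H) with constants c̄, R̄, let u₁^ε be a minimizer of u ↦ ℱ^{τ,γ}_ε(u,u₀^ε), and let 0 < μ < 1/4. Let I be the connected component of I₁ containing I₀ ∖ 𝒞_{ε^μ}(I₀), where 𝒞_{ε^μ}(I₀) := {p ∈ I₀ : d₁^ε(p,∂I₀) ≤ ε^μ}. Suppose not all connected components of I₁ ∪ Z₁ are discrete rectangles. Let H^{0,1} = [p′, q′] be the lowest horizontal slice of I₀ (of length ≥ c̄), let H^{1,i} = [p^i, q^i], i = 1,…,n_h, be the horizontal slices of I, and set S := {p ∈ ∂⁻I : p − εe₂ ∈ ∂⁺I and p′₁ + 2ε^μ ≤ p₁ ≤ q′₁ − 2ε^μ}. Then, for ε small enough, S ⊂ H^{1,1} ∪ H^{1,2}, and there exists a constant c > 0, depending only on ζ, k and c̄, such that |p₂ − p′₂| ≤ cε for every p = (p₁,p₂) ∈ S. In particular every p ∈ I₀ ∖ R_I satisfies d₁^ε(p, ∂I₀) ≤ cε. -/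

import Mathlib

open scoped ENNReal symmDiff Classical
open MeasureTheory

namespace BEG

/-- Lattice points (the lattice `εℤ²` in lattice units). -/
abbrev Pt : Type := ℤ × ℤ

/-- Lattice `ℓ¹` distance (in lattice units). -/
def d1 (p q : Pt) : ℕ := (p.1 - q.1).natAbs + (p.2 - q.2).natAbs

/-- Lattice `ℓ∞` distance (in lattice units). -/
def dinf (p q : Pt) : ℕ := max (p.1 - q.1).natAbs (p.2 - q.2).natAbs

/-- The four nearest neighbours `𝒩(p)`. -/
def nbrs (p : Pt) : Set Pt := {q | d1 p q = 1}

/-- Combinatorial `ℓ¹` distance from a point to a set (in lattice units). -/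
noncomputable def distTo (p : Pt) (S : Set Pt) : ℝ≥0∞ := ⨅ q ∈ S, ((d1 p q : ℕ) : ℝ≥0∞)

/-- Combinatorial distance to the (discrete) boundary of `I`, in lattice units;
the physical distance `d₁^ε(p,∂I)` is `ε * dB p I`. -/
noncomputable def dB (p : Pt) (I : Set Pt) : ℝ≥0∞ :=
  if p ∈ I then distTo p Iᶜ else distTo p I

/-- The exterior boundary `∂⁺I`. -/
def bdryOut (I : Set Pt) : Set Pt := {p | p ∉ I ∧ dB p I = 1}
/-- The interior boundary `∂⁻I`. -/
def bdryIn (I : Set Pt) : Set Pt := {p | p ∈ I ∧ dB p I = 1}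

/-- `𝕆 I = {p ∈ ∂⁺I : #(𝒩(p) ∩ I) = 2}`. -/
def Ocorner (I : Set Pt) : Set Pt := {p ∈ bdryOut I | (nbrs p ∩ I).ncard = 2}
/-- `𝕀 I = {p ∈ ∂⁻I : #(𝒩(p) ∩ I) = 2}`. -/
def Icorner (I : Set Pt) : Set Pt := {p ∈ bdryIn I | (nbrs p ∩ I).ncard = 2}

/-- Spin configurations `𝒜_ε`: maps `εℤ² → {-1,0,1}` with finitely many zeros. -/
structure Config where
  val : Pt → ℤ
  val_mem : ∀ p, val p = -1 ∨ val p = 0 ∨ val p = 1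
  finiteZero : {p | val p = 0}.Finite

/-- `I_u = {u = 1}`. -/
def Iset (u : Config) : Set Pt := {p | u.val p = 1}
/-- `Z_u = {u = 0}`. -/
def Zset (u : Config) : Set Pt := {p | u.val p = 0}

/-- Energy of one nearest-neighbour bond: `ε (1 - ab - k (1 - (ab)²))`. -/
noncomputable def bond (ε k : ℝ) (a b : ℤ) : ℝ≥0∞ :=
  ENNReal.ofReal (ε * (1 - (a : ℝ) * (b : ℝ) - k * (1 - ((a : ℝ) * (b : ℝ)) ^ 2)))

/-- The energy `ℰ_ε(u)`: the sum over unordered nearest-neighbour pairs. -/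
noncomputable def energy (ε k : ℝ) (u : Config) : ℝ≥0∞ :=
  ∑' p : Pt, (bond ε k (u.val p) (u.val (p + (1, 0))) + bond ε k (u.val p) (u.val (p + (0, 1))))

/-- The local energy `ℰ_ε(u, I)`: bonds with at least one endpoint in `I`, each counted once. -/
noncomputable def localEnergy (ε k : ℝ) (u : Config) (I : Set Pt) : ℝ≥0∞ :=
  ∑' p : Pt,
    ((if p ∈ I ∨ p + (1, 0) ∈ I then bond ε k (u.val p) (u.val (p + (1, 0))) else 0) +
     (if p ∈ I ∨ p + (0, 1) ∈ I then bond ε k (u.val p) (u.val (p + (0, 1))) else 0))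

/-- The dissipation `𝒟¹_ε(I_u, I_w) = Σ_{p ∈ I_u △ I_w} ε² d₁^ε(p, ∂I_w)`
(each summand is `ε² ⋅ ε ⋅ dB`). -/
noncomputable def diss1 (ε : ℝ) (Iu Iw : Set Pt) : ℝ≥0∞ :=
  ∑' p : Pt, if p ∈ Iu ∆ Iw then ENNReal.ofReal (ε ^ 3) * dB p Iw else 0

/-- The dissipation `𝒟⁰_ε(Z_u, Z_w) = |#Z_u - #Z_w|`. -/
noncomputable def diss0 (Zu Zw : Set Pt) : ℝ≥0∞ := ((Nat.dist Zu.ncard Zw.ncard : ℕ) : ℝ≥0∞)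

/-- The total functional `ℱ^{τ,γ}_ε(u,w)` with `τ = ζ ε`. -/
noncomputable def totalF (ε k ζ γ : ℝ) (u w : Config) : ℝ≥0∞ :=
  energy ε k u + (ENNReal.ofReal (ζ * ε))⁻¹ *
    (diss1 ε (Iset u) (Iset w) + ENNReal.ofReal (ε ^ γ) * diss0 (Zset u) (Zset w))

/-- `u₁` is a minimizer of `u ↦ ℱ^{τ,γ}_ε(u, u₀)`. -/
def Minimizes (ε k ζ γ : ℝ) (u₁ u₀ : Config) : Prop :=
  ∀ v : Config, totalF ε k ζ γ u₁ u₀ ≤ totalF ε k ζ γ v u₀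

/-- One step of a strongly continuous path inside `S`. -/
def stStep (S : Set Pt) (a b : Pt) : Prop := a ∈ S ∧ b ∈ S ∧ d1 a b = 1
/-- One step of a weakly continuous path inside `S`. -/
def wkStep (S : Set Pt) (a b : Pt) : Prop := a ∈ S ∧ b ∈ S ∧ dinf a b = 1

def StronglyConnected (S : Set Pt) : Prop :=
  ∀ p ∈ S, ∀ q ∈ S, Relation.ReflTransGen (stStep S) p q
def WeaklyConnected (S : Set Pt) : Prop :=
  ∀ p ∈ S, ∀ q ∈ S, Relation.ReflTransGen (wkStep S) p q

/-- The strongly connected component of `p` in `S`. -/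
def stComp (S : Set Pt) (p : Pt) : Set Pt := {q | Relation.ReflTransGen (stStep S) p q}
/-- The weakly connected component of `p` in `S`. -/
def wkComp (S : Set Pt) (p : Pt) : Set Pt := {q | Relation.ReflTransGen (wkStep S) p q}

def HConvex (S : Set Pt) : Prop :=
  ∀ p ∈ S, ∀ q ∈ S, p.2 = q.2 → ∀ r : Pt, r.2 = p.2 → p.1 ≤ r.1 → r.1 ≤ q.1 → r ∈ S
def VConvex (S : Set Pt) : Prop :=
  ∀ p ∈ S, ∀ q ∈ S, p.1 = q.1 → ∀ r : Pt, r.1 = p.1 → p.2 ≤ r.2 → r.2 ≤ q.2 → r ∈ S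

/-- Staircase sets: strongly connected and horizontally and vertically convex. -/
def IsStaircase (S : Set Pt) : Prop := StronglyConnected S ∧ HConvex S ∧ VConvex S

/-- Discrete rectangles. -/
def IsDiscreteRectangle (S : Set Pt) : Prop :=
  ∃ a b c d : ℤ, a ≤ b ∧ c ≤ d ∧ S = {p : Pt | a ≤ p.1 ∧ p.1 ≤ b ∧ c ≤ p.2 ∧ p.2 ≤ d}

/-- `R_S`: the smallest discrete rectangle containing `S`. -/
def Rbox (S : Set Pt) : Set Pt :=
  {p : Pt | (∃ q ∈ S, q.1 ≤ p.1) ∧ (∃ q ∈ S, p.1 ≤ q.1) ∧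
            (∃ q ∈ S, q.2 ≤ p.2) ∧ (∃ q ∈ S, p.2 ≤ q.2)}

/-- The perimeter `Per(A_I)` of the union of the `ε`-cells centred at points of `I`:
`ε` times the number of boundary edges. -/
noncomputable def perim (ε : ℝ) (I : Set Pt) : ℝ≥0∞ :=
  ENNReal.ofReal ε * (({pq : Pt × Pt | pq.1 ∈ I ∧ pq.2 ∉ I ∧ d1 pq.1 pq.2 = 1}).encard : ℝ≥0∞)

/-- `Σ_i Per(B_i)`, the sum of the perimeters of the strongly connected components of `S`. -/
noncomputable def compPerimSum (ε : ℝ) (S : Set Pt) : ℝ≥0∞ :=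
  ENNReal.ofReal ε *
    (({pq : Pt × Pt | pq.1 ∈ S ∧ pq.2 ∉ stComp S pq.1 ∧ d1 pq.1 pq.2 = 1}).encard : ℝ≥0∞)

/-- The closed `ε`-cell of side `ε` centred at the lattice point `p`. -/
def cell (ε : ℝ) (p : Pt) : Set (ℝ × ℝ) :=
  {x | |x.1 - ε * (p.1 : ℝ)| ≤ ε / 2 ∧ |x.2 - ε * (p.2 : ℝ)| ≤ ε / 2}

/-- `A_I ⊆ ℝ²`. -/
def Aset (ε : ℝ) (I : Set Pt) : Set (ℝ × ℝ) := ⋃ p ∈ I, cell ε p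

/-- `𝒞_{ε^μ}(I) = {p ∈ I : d₁^ε(p,∂I) ≤ ε^μ}`. -/
def closeLayer (ε μ : ℝ) (I : Set Pt) : Set Pt :=
  {p ∈ I | ENNReal.ofReal ε * dB p I ≤ ENNReal.ofReal (ε ^ μ)}

/-- Assumption (H): `I` is a staircase set contained in a ball of radius `Rbar`, each of whose
four extreme slices contains at least `cbar/ε` lattice points. -/
def AssumpH (cbar Rbar ε : ℝ) (I : Set Pt) : Prop :=
  IsStaircase I ∧ I.Finite ∧
  (∃ x : ℝ × ℝ, ∀ p ∈ I, (ε * (p.1 : ℝ) - x.1) ^ 2 + (ε * (p.2 : ℝ) - x.2) ^ 2 ≤ Rbar ^ 2) ∧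
  (∃ yLo yHi xLo xHi : ℤ,
    (∀ p ∈ I, yLo ≤ p.2 ∧ p.2 ≤ yHi ∧ xLo ≤ p.1 ∧ p.1 ≤ xHi) ∧
    cbar / ε ≤ ({p ∈ I | p.2 = yLo}.ncard : ℝ) ∧
    cbar / ε ≤ ({p ∈ I | p.2 = yHi}.ncard : ℝ) ∧
    cbar / ε ≤ ({p ∈ I | p.1 = xLo}.ncard : ℝ) ∧
    cbar / ε ≤ ({p ∈ I | p.1 = xHi}.ncard : ℝ))

/-- `p` is a surfactant in the corner for `u` (up to a rotation of the lattice). -/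
def SurfCorner (u : Config) (p : Pt) : Prop :=
  ∃ e : Pt, d1 p (p + e) = 1 ∧
    u.val p = 0 ∧ u.val (p + e) = 0 ∧ u.val (p + (-e.2, e.1)) = 0 ∧
    u.val (p - e) = u.val (p - (-e.2, e.1)) ∧ u.val (p - e) ≠ 0

/-- A horizontal discrete segment. -/
def segH (x₁ x₂ y : ℤ) : Set Pt := {p : Pt | p.2 = y ∧ x₁ ≤ p.1 ∧ p.1 ≤ x₂}

/-- A (possibly degenerate) octagon of the class `𝒲`, described through the positions of
its eight supporting lines: the region is
`{x : yLo ≤ x₂ ≤ yHi, xLo ≤ x₁ ≤ xHi, sLo ≤ x₁+x₂ ≤ sHi, mLo ≤ x₁-x₂ ≤ mHi}`. -/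
structure Oct where
  yLo : ℝ
  yHi : ℝ
  xLo : ℝ
  xHi : ℝ
  sLo : ℝ
  sHi : ℝ
  mLo : ℝ
  mHi : ℝ

namespace Oct

def region (O : Oct) : Set (ℝ × ℝ) :=
  {x | O.yLo ≤ x.2 ∧ x.2 ≤ O.yHi ∧ O.xLo ≤ x.1 ∧ x.1 ≤ O.xHi ∧
       O.sLo ≤ x.1 + x.2 ∧ x.1 + x.2 ≤ O.sHi ∧ O.mLo ≤ x.1 - x.2 ∧ x.1 - x.2 ≤ O.mHi}

/-- Lengths `P_i` of the four axis-parallel sides (bottom, left, top, right). -/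
noncomputable def P (O : Oct) : Fin 4 → ℝ :=
  ![max 0 (min (min O.xHi (O.sHi - O.yLo)) (O.mHi + O.yLo) -
      max (max O.xLo (O.sLo - O.yLo)) (O.mLo + O.yLo)),
    max 0 (min (min O.yHi (O.sHi - O.xLo)) (O.xLo - O.mLo) -
      max (max O.yLo (O.sLo - O.xLo)) (O.xLo - O.mHi)),
    max 0 (min (min O.xHi (O.sHi - O.yHi)) (O.mHi + O.yHi) -
      max (max O.xLo (O.sLo - O.yHi)) (O.mLo + O.yHi)),
    max 0 (min (min O.yHi (O.sHi - O.xHi)) (O.xHi - O.mLo) -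
      max (max O.yLo (O.sLo - O.xHi)) (O.xHi - O.mHi))]

/-- Lengths `D_i` of the four diagonal sides (lower-left, upper-left, upper-right, lower-right). -/
noncomputable def D (O : Oct) : Fin 4 → ℝ :=
  ![Real.sqrt 2 * max 0 (min (min O.xHi (O.sLo - O.yLo)) ((O.mHi + O.sLo) / 2) -
      max (max O.xLo (O.sLo - O.yHi)) ((O.mLo + O.sLo) / 2)),
    Real.sqrt 2 * max 0 (min (min O.xHi (O.mLo + O.yHi)) ((O.sHi + O.mLo) / 2) -
      max (max O.xLo (O.mLo + O.yLo)) ((O.sLo + O.mLo) / 2)),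
    Real.sqrt 2 * max 0 (min (min O.xHi (O.sHi - O.yLo)) ((O.mHi + O.sHi) / 2) -
      max (max O.xLo (O.sHi - O.yHi)) ((O.mLo + O.sHi) / 2)),
    Real.sqrt 2 * max 0 (min (min O.xHi (O.mHi + O.yHi)) ((O.sHi + O.mHi) / 2) -
      max (max O.xLo (O.mHi + O.yLo)) ((O.sLo + O.mHi) / 2))]

/-- The positions of the four diagonal supporting lines. -/
def diagPos (O : Oct) : Fin 4 → ℝ := ![O.sLo, O.mLo, O.sHi, O.mHi]

/-- A nondegenerate octagon: all eight sides have positive length. -/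
def Nondeg (O : Oct) : Prop := (∀ i, 0 < O.P i) ∧ (∀ i, 0 < O.D i)

/-- The region is an (axis-parallel, possibly degenerate) rectangle. -/
def IsRect (O : Oct) : Prop :=
  ∃ x₁ x₂ y₁ y₂ : ℝ, O.region = {z : ℝ × ℝ | x₁ ≤ z.1 ∧ z.1 ≤ x₂ ∧ y₁ ≤ z.2 ∧ z.2 ≤ y₂}

end Oct

/-- A discrete octagon: the trace on the lattice of an octagon of the class `𝒲`
(some sides may have zero length). -/
def IsDiscreteOctagon (I : Set Pt) : Prop :=
  ∃ O : Oct, O.region.Nonempty ∧ I = {p : Pt | ((p.1 : ℝ), (p.2 : ℝ)) ∈ O.region}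

/-- `A_I ⊆ O`. -/
def OctContains (O : Oct) (ε : ℝ) (I : Set Pt) : Prop := Aset ε I ⊆ O.region

/-- `O` is the smallest octagon of the class `𝒲` containing `A_I`. -/
def OctMinimal (O : Oct) (ε : ℝ) (I : Set Pt) : Prop :=
  OctContains O ε I ∧ ∀ O' : Oct, OctContains O' ε I → O.region ⊆ O'.region

/-- Extremal coordinates of a (finite nonempty) set of lattice points. -/
noncomputable def xmin (S : Set Pt) : ℤ := sInf (Prod.fst '' S)
noncomputable def xmax (S : Set Pt) : ℤ := sSup (Prod.fst '' S)
noncomputable def ymin (S : Set Pt) : ℤ := sInf (Prod.snd '' S)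
noncomputable def ymax (S : Set Pt) : ℤ := sSup (Prod.snd '' S)

/-- Displacements (in lattice units) `α_i = a_i/ε` of the four axis-parallel sides
(bottom, left, top, right) between `I` and `I' ⊆ I`. -/
noncomputable def alpha (I I' : Set Pt) : Fin 4 → ℤ :=
  ![ymin I' - ymin I, xmin I' - xmin I, ymax I - ymax I', xmax I - xmax I']

/-- The four extreme slices `𝒫_i` (bottom, left, top, right) of `S`. -/
def extSlice (S : Set Pt) : Fin 4 → Set Pt :=
  ![{p ∈ S | ∀ q ∈ S, p.2 ≤ q.2}, {p ∈ S | ∀ q ∈ S, p.1 ≤ q.1},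
    {p ∈ S | ∀ q ∈ S, q.2 ≤ p.2}, {p ∈ S | ∀ q ∈ S, q.1 ≤ p.1}]

/-- The four diagonal sides `𝒟_i` (lower-left, upper-left, upper-right, lower-right) of a
discrete octagon `S`. -/
def diagSlice (S : Set Pt) : Fin 4 → Set Pt :=
  ![{p ∈ S | ∀ q ∈ S, p.1 + p.2 ≤ q.1 + q.2}, {p ∈ S | ∀ q ∈ S, q.2 - q.1 ≤ p.2 - p.1},
    {p ∈ S | ∀ q ∈ S, q.1 + q.2 ≤ p.1 + p.2}, {p ∈ S | ∀ q ∈ S, q.1 - q.2 ≤ p.1 - p.2}]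

/-- The four corner components `T_i` of `R_S ∖ S` for a discrete octagon `S`. -/
def Tcorner (S : Set Pt) : Fin 4 → Set Pt :=
  ![{p | p ∈ Rbox S ∧ p ∉ S ∧ ∀ q ∈ S, p.1 + p.2 < q.1 + q.2},
    {p | p ∈ Rbox S ∧ p ∉ S ∧ ∀ q ∈ S, q.2 - q.1 < p.2 - p.1},
    {p | p ∈ Rbox S ∧ p ∉ S ∧ ∀ q ∈ S, q.1 + q.2 < p.1 + p.2},
    {p | p ∈ Rbox S ∧ p ∉ S ∧ ∀ q ∈ S, q.1 - q.2 < p.1 - p.2}]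

/-- `I` is an `ε`-quasi-rectangle with inner octagon `Itil` and corner decorations `Δ`. -/
def IsQuasiRectWith (ε : ℝ) (C : ℕ) (I Itil : Set Pt) (Δ : Fin 4 → Set Pt) : Prop :=
  IsStaircase I ∧
  I = Itil ∪ (⋃ i, extSlice I i) ∪ (⋃ i, Δ i) ∧
  IsDiscreteOctagon Itil ∧
  Itil ⊆ I \ (⋃ i, extSlice I i) ∧
  (∀ i : Fin 4,
    (diagSlice Itil i).ncard = max (⌈4 * Real.sqrt (C : ℝ)⌉₊) (⌈ε ^ (-(7 : ℝ) / 8)⌉₊)) ∧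
  (∀ i : Fin 4, Δ i ⊆ Tcorner Itil i) ∧
  StronglyConnected (Itil ∪ ⋃ i, Δ i)

def IsQuasiRect (ε : ℝ) (C : ℕ) (I : Set Pt) : Prop :=
  ∃ Itil Δ, IsQuasiRectWith ε C I Itil Δ

/-- Good minimizers. -/
def GoodMinimizer (ε k ζ γ : ℝ) (C : ℕ) (u₁ u₀ : Config) : Prop :=
  Minimizes ε k ζ γ u₁ u₀ ∧
  (IsQuasiRect ε C (Iset u₀) →
    ∃ Itil Δ, IsQuasiRectWith ε C (Iset u₁) Itil Δ ∧
      ∀ p ∈ Ocorner (Iset u₁) ∩ Rbox Itil,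
        dB p (Iset u₀) ≤ ENNReal.ofReal
          (((min (min (alpha (Iset u₀) (Iset u₁) 0) (alpha (Iset u₀) (Iset u₁) 1))
              (min (alpha (Iset u₀) (Iset u₁) 2) (alpha (Iset u₀) (Iset u₁) 3)) : ℤ) : ℝ)))

/-- Distance of a real number from `ℕ`. -/
noncomputable def distToNat (x : ℝ) : ℝ := ⨅ n : ℕ, |x - (n : ℝ)|

/-- The differential inclusion for the velocity of an axis-parallel side of length `Pl`. -/
def PVel (ζ k v Pl : ℝ) : Prop :=
  ((¬ ∃ n : ℕ, (n : ℝ) = 2 * ζ * (1 - k) / Pl) →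
      v = (1 / ζ) * ((⌊2 * ζ * (1 - k) / Pl⌋ : ℤ) : ℝ)) ∧
  ((∃ n : ℕ, (n : ℝ) = 2 * ζ * (1 - k) / Pl) →
      v ∈ Set.Icc (2 * (1 - k) / Pl - 1 / ζ) (2 * (1 - k) / Pl))

/-- The differential inclusion for the velocity of a diagonal side of length `Dl`. -/
def DVel (ζ k v Dl : ℝ) : Prop :=
  ((¬ ∃ n : ℕ, (n : ℝ) = 2 * Real.sqrt 2 * ζ * (1 - k) / Dl) →
      v = (Real.sqrt 2 / (2 * ζ)) * ((⌊2 * Real.sqrt 2 * ζ * (1 - k) / Dl⌋ : ℤ) : ℝ)) ∧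
  ((∃ n : ℕ, (n : ℝ) = 2 * Real.sqrt 2 * ζ * (1 - k) / Dl) →
      v ∈ Set.Icc (2 * (1 - k) / Dl - Real.sqrt 2 / (2 * ζ)) (2 * (1 - k) / Dl))

/-- The differential inclusion for the velocity of a side of a rectangle of side length `Pl`
(the `γ < 2` regime). -/
def PVelRect (ζ k v Pl : ℝ) : Prop :=
  ((¬ ∃ n : ℕ, (n : ℝ) = 2 * ζ * (1 - k) / Pl) →
      v ∈ Set.Icc ((1 / ζ) * ((⌊2 * ζ * (1 - k) / Pl⌋ : ℤ) : ℝ))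
            ((1 / ζ) * ((⌈2 * ζ * (1 - k) / Pl⌉ : ℤ) : ℝ))) ∧
  ((∃ n : ℕ, (n : ℝ) = 2 * ζ * (1 - k) / Pl) →
      v ∈ Set.Icc (2 * (1 - k) / Pl - 1 / ζ) (2 * (1 - k) / Pl + 1 / ζ))

/-! ### Counting bonds -/

/-- Adjacency indicator of the square lattice. -/
def adj (p q : Pt) : ℤ := if d1 p q = 1 then 1 else 0

/-- Number of neighbours of `p` in `T`. -/
def nb (T : Finset Pt) (p : Pt) : ℤ := ∑ q ∈ T, adj p q

/-- Indicator of a finite set of lattice points. -/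
def ind (T : Finset Pt) (p : Pt) : ℤ := if p ∈ T then 1 else 0

/-- Number of bonds leading from a point of `S` to a point outside `T`. -/
def bd (S T : Finset Pt) : ℤ := ∑ p ∈ S, (4 - nb T p)

lemma d1_comm (p q : Pt) : d1 p q = d1 q p := by unfold d1; omega

lemma adj_comm (p q : Pt) : adj p q = adj q p := by unfold adj; rw [d1_comm]

lemma adj_self (p : Pt) : adj p p = 0 := by simp [adj, d1]

lemma adj_nonneg (p q : Pt) : 0 ≤ adj p q := by unfold adj; split_ifs <;> omega

lemma ind_nonneg (T : Finset Pt) (p : Pt) : 0 ≤ ind T p := by unfold ind; split_ifs <;> omega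

lemma ind_le_one (T : Finset Pt) (p : Pt) : ind T p ≤ 1 := by unfold ind; split_ifs <;> omega

lemma ind_of_mem {T : Finset Pt} {p : Pt} (h : p ∈ T) : ind T p = 1 := by simp [ind, h]

lemma ind_of_notMem {T : Finset Pt} {p : Pt} (h : p ∉ T) : ind T p = 0 := by simp [ind, h]

lemma ind_mono {S T : Finset Pt} (h : S ⊆ T) (p : Pt) : ind S p ≤ ind T p := by
  unfold ind
  by_cases hp : p ∈ S
  · simp [hp, h hp]
  · simp only [hp, if_false]; split_ifs <;> omega

lemma adj_eq (p q : Pt) :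
    adj p q = (if q = (p.1 + 1, p.2) then 1 else 0) + (if q = (p.1 - 1, p.2) then 1 else 0) +
      (if q = (p.1, p.2 + 1) then 1 else 0) + (if q = (p.1, p.2 - 1) then 1 else 0) := by
  obtain ⟨x, y⟩ := p
  obtain ⟨u, v⟩ := q
  simp only [adj, d1, Prod.mk.injEq]
  split_ifs <;> omega

lemma nb_eq (T : Finset Pt) (p : Pt) :
    nb T p = ind T (p.1 + 1, p.2) + ind T (p.1 - 1, p.2) + ind T (p.1, p.2 + 1) +
      ind T (p.1, p.2 - 1) := by
  simp only [nb, adj_eq, Finset.sum_add_distrib, Finset.sum_ite_eq', ind]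

lemma nb_nonneg (T : Finset Pt) (p : Pt) : 0 ≤ nb T p :=
  Finset.sum_nonneg fun q _ => adj_nonneg p q

lemma nb_le_four (T : Finset Pt) (p : Pt) : nb T p ≤ 4 := by
  rw [nb_eq]
  have := ind_le_one T (p.1 + 1, p.2)
  have := ind_le_one T (p.1 - 1, p.2)
  have := ind_le_one T (p.1, p.2 + 1)
  have := ind_le_one T (p.1, p.2 - 1)
  omega

lemma nb_mono {S T : Finset Pt} (h : S ⊆ T) (p : Pt) : nb S p ≤ nb T p :=
  Finset.sum_le_sum_of_subset_of_nonneg h fun q _ _ => adj_nonneg p q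

lemma nb_insert {T : Finset Pt} {w : Pt} (hw : w ∉ T) (p : Pt) :
    nb (insert w T) p = nb T p + adj p w := by
  rw [nb, Finset.sum_insert hw, nb]; ring

lemma nb_union {S T : Finset Pt} (h : Disjoint S T) (p : Pt) :
    nb (S ∪ T) p = nb S p + nb T p := Finset.sum_union h

lemma bd_nonneg (S T : Finset Pt) : 0 ≤ bd S T :=
  Finset.sum_nonneg fun p _ => by have := nb_le_four T p; omega

lemma sum_nb_comm (S T : Finset Pt) : ∑ p ∈ S, nb T p = ∑ q ∈ T, nb S q := by
  unfold nb
  rw [Finset.sum_comm]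
  exact Finset.sum_congr rfl fun q _ => Finset.sum_congr rfl fun p _ => adj_comm p q

lemma bd_eq (S T : Finset Pt) : bd S T = 4 * S.card - ∑ p ∈ S, nb T p := by
  unfold bd
  rw [Finset.sum_sub_distrib, Finset.sum_const]; simp; ring

lemma bd_union_left {S S' : Finset Pt} (h : Disjoint S S') (T : Finset Pt) :
    bd (S ∪ S') T = bd S T + bd S' T := Finset.sum_union h

lemma bd_insert_left {S : Finset Pt} {z : Pt} (h : z ∉ S) (T : Finset Pt) :
    bd (insert z S) T = bd S T + 4 - nb T z := by
  rw [bd, Finset.sum_insert h, bd]; ring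

lemma bd_union_right {T T' : Finset Pt} (h : Disjoint T T') (S : Finset Pt) :
    bd S (T ∪ T') = bd S T - ∑ p ∈ S, nb T' p := by
  unfold bd
  rw [← Finset.sum_sub_distrib]
  exact Finset.sum_congr rfl fun p _ => by rw [nb_union h]; ring

lemma bd_insert_right {T : Finset Pt} {w : Pt} (h : w ∉ T) (S : Finset Pt) :
    bd S (insert w T) = bd S T - nb S w := by
  unfold bd
  rw [nb, ← Finset.sum_sub_distrib]
  exact Finset.sum_congr rfl fun p _ => by rw [nb_insert h, adj_comm w p]; ring

lemma bd_insert_insert {S : Finset Pt} {z : Pt} (h : z ∉ S) :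
    bd (insert z S) (insert z S) = bd S S + 4 - 2 * nb S z := by
  rw [bd_insert_left h, bd_insert_right h, nb_insert h, adj_self]; ring

lemma bd_union_union {S S' : Finset Pt} (h : Disjoint S S') :
    bd (S ∪ S') (S ∪ S') = bd S S + bd S' S' - 2 * ∑ p ∈ S', nb S p := by
  rw [bd_union_left h, bd_union_right h, bd_union_right h, sum_nb_comm S S',
    bd_eq S' S, bd_eq S' S']
  ring

lemma bd_mono_right {T T' : Finset Pt} (h : T ⊆ T') (S : Finset Pt) : bd S T' ≤ bd S T :=
  Finset.sum_le_sum fun p _ => by have := nb_mono h p; omega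

/-! ### Lattice isometries -/

/-- The reflection `(x, y) ↦ (x, -y)`. -/
def flipY : Pt ≃ Pt where
  toFun p := (p.1, -p.2)
  invFun p := (p.1, -p.2)
  left_inv _ := by simp
  right_inv _ := by simp

/-- The reflection `(x, y) ↦ (-x, y)`. -/
def flipX : Pt ≃ Pt where
  toFun p := (-p.1, p.2)
  invFun p := (-p.1, p.2)
  left_inv _ := by simp
  right_inv _ := by simp

/-- The reflection `(x, y) ↦ (y, x)`. -/
def swapXY : Pt ≃ Pt where
  toFun p := (p.2, p.1)
  invFun p := (p.2, p.1)
  left_inv _ := by simp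
  right_inv _ := by simp

/-- Lattice isometries. -/
def IsIso (g : Pt ≃ Pt) : Prop := ∀ p q, d1 (g p) (g q) = d1 p q

lemma isIso_flipY : IsIso flipY := fun p q => by simp only [flipY, d1, Equiv.coe_fn_mk]; omega
lemma isIso_flipX : IsIso flipX := fun p q => by simp only [flipX, d1, Equiv.coe_fn_mk]; omega
lemma isIso_swapXY : IsIso swapXY := fun p q => by simp only [swapXY, d1, Equiv.coe_fn_mk]; omega

lemma IsIso.symm {g : Pt ≃ Pt} (hg : IsIso g) : IsIso g.symm := fun p q => by
  rw [← hg, g.apply_symm_apply, g.apply_symm_apply]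

lemma IsIso.trans {g h : Pt ≃ Pt} (hg : IsIso g) (hh : IsIso h) : IsIso (g.trans h) :=
  fun p q => by rw [Equiv.trans_apply, Equiv.trans_apply, hh, hg]

/-- The image of a finite set under a lattice isometry. -/
def im (g : Pt ≃ Pt) (S : Finset Pt) : Finset Pt := S.map g.toEmbedding

lemma mem_im {g : Pt ≃ Pt} {S : Finset Pt} {p : Pt} : p ∈ im g S ↔ g.symm p ∈ S := by
  simp [im, Finset.mem_map_equiv]

lemma card_im (g : Pt ≃ Pt) (S : Finset Pt) : (im g S).card = S.card := Finset.card_map _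

lemma im_mono {g : Pt ≃ Pt} {S T : Finset Pt} (h : S ⊆ T) : im g S ⊆ im g T :=
  fun _ hp => mem_im.2 (h (mem_im.1 hp))

lemma sum_im {M : Type*} [AddCommMonoid M] (g : Pt ≃ Pt) (S : Finset Pt) (f : Pt → M) :
    ∑ p ∈ im g S, f p = ∑ p ∈ S, f (g p) := Finset.sum_map _ _ _

lemma nb_im {g : Pt ≃ Pt} (hg : IsIso g) (T : Finset Pt) (p : Pt) : nb (im g T) (g p) = nb T p := by
  rw [nb, sum_im]
  exact Finset.sum_congr rfl fun q _ => by rw [adj, hg, adj]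

lemma bd_im {g : Pt ≃ Pt} (hg : IsIso g) (S T : Finset Pt) : bd (im g S) (im g T) = bd S T := by
  rw [bd, sum_im]
  exact Finset.sum_congr rfl fun _ _ => by rw [nb_im hg]

/-! ### The reduced minimization problem -/

/-- The interaction energy of the phases: `I` is the set of spins `1` and `A` the set of
nonnegative spins. -/
def phaseEnergy (a b : ℝ) (I A : Finset Pt) : ℝ :=
  a * ((bd I I + bd A A : ℤ) : ℝ) + b * ((bd I A : ℤ) : ℝ)

/-- `(I, A)` minimizes the interaction energy minus `δ` times the sum of `φ` over `I`, among the
competitors with as many zeros. -/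
structure Opt (a b δ : ℝ) (φ : Pt → ℤ) (I A : Finset Pt) : Prop where
  ha : 0 < a
  hb : 0 < b
  hab : 2 * a + b = 2
  hδ : 0 < δ
  sub : I ⊆ A
  le : ∀ I' A' : Finset Pt, I' ⊆ A' → A'.card + I.card = A.card + I'.card →
    phaseEnergy a b I A - δ * ((∑ p ∈ I, φ p : ℤ) : ℝ) ≤
      phaseEnergy a b I' A' - δ * ((∑ p ∈ I', φ p : ℤ) : ℝ)

lemma Opt.im {a b δ : ℝ} {φ : Pt → ℤ} {I A : Finset Pt} (h : Opt a b δ φ I A) {g : Pt ≃ Pt}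
    (hg : IsIso g) : Opt a b δ (fun p => φ (g.symm p)) (im g I) (im g A) where
  ha := h.ha
  hb := h.hb
  hab := h.hab
  hδ := h.hδ
  sub := im_mono h.sub
  le I' A' hs hc := by
    have := h.le (BEG.im g.symm I') (BEG.im g.symm A') (im_mono hs) (by simpa [card_im] using hc)
    simpa [phaseEnergy, bd_im hg, bd_im hg.symm, sum_im] using this

/-- A competitor with no larger interaction energy and a larger potential contradicts
minimality. -/
lemma Opt.false_of_lt {a b δ : ℝ} {φ : Pt → ℤ} {I A : Finset Pt} (h : Opt a b δ φ I A)
    {I' A' : Finset Pt} (hs : I' ⊆ A') (hc : A'.card + I.card = A.card + I'.card)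
    (h1 : bd I' I' + bd A' A' ≤ bd I I + bd A A) (h2 : bd I' A' ≤ bd I A)
    (h3 : ∑ p ∈ I, φ p < ∑ p ∈ I', φ p) : False := by
  have := h.le I' A' hs hc
  have h1' : ((bd I' I' + bd A' A' : ℤ) : ℝ) ≤ ((bd I I + bd A A : ℤ) : ℝ) := by exact_mod_cast h1
  have h2' : ((bd I' A' : ℤ) : ℝ) ≤ ((bd I A : ℤ) : ℝ) := by exact_mod_cast h2
  have h3' : ((∑ p ∈ I, φ p : ℤ) : ℝ) < ((∑ p ∈ I', φ p : ℤ) : ℝ) := by exact_mod_cast h3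
  have e1 := mul_le_mul_of_nonneg_left h1' h.ha.le
  have e2 := mul_le_mul_of_nonneg_left h2' h.hb.le
  have e3 := mul_lt_mul_of_pos_left h3' h.hδ
  simp only [phaseEnergy] at this
  linarith

/-! ### Elementary competitors -/

section Local

variable {a b δ : ℝ} {φ : Pt → ℤ} {I A : Finset Pt}

lemma Opt.mem_of_two_le_nb (h : Opt a b δ φ I A) {z : Pt} (hφ : 0 < φ z) (hz : z ∉ I)
    (hn : 2 ≤ nb I z) : z ∈ A := by
  by_contra hzA
  have hm := nb_mono h.sub z
  refine h.false_of_lt (I' := insert z I) (A' := insert z A) (Finset.insert_subset_insert _ h.sub)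
    ?_ ?_ ?_ ?_
  · rw [Finset.card_insert_of_notMem hz, Finset.card_insert_of_notMem hzA]; ring
  · rw [bd_insert_insert hz, bd_insert_insert hzA]; omega
  · rw [bd_insert_left hz, bd_insert_right hzA, nb_insert hzA, adj_self]; omega
  · rw [Finset.sum_insert hz]; omega

lemma Opt.false_of_exchange (h : Opt a b δ φ I A) {z w : Pt} (hφ : 0 < φ z) (hz : z ∉ I)
    (hzA : z ∈ A) (hn : 2 ≤ nb I z) (hw : w ∉ A) (hwn : 2 ≤ nb A w)
    (hzw : 4 - nb (insert w A) z ≤ nb I w) : False := by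
  refine h.false_of_lt (I' := insert z I) (A' := insert w A) ?_ ?_ ?_ ?_ ?_
  · intro p hp
    rcases Finset.mem_insert.1 hp with rfl | hp
    · exact Finset.mem_insert_of_mem hzA
    · exact Finset.mem_insert_of_mem (h.sub hp)
  · rw [Finset.card_insert_of_notMem hz, Finset.card_insert_of_notMem hw]; ring
  · rw [bd_insert_insert hz, bd_insert_insert hw]; omega
  · rw [bd_insert_left hz, bd_insert_right hw]; omega
  · rw [Finset.sum_insert hz]; omega

lemma Opt.false_of_isolated (h : Opt a b δ φ I A) {c z : Pt} (hc : c ∈ I) (hφ : φ c < 0)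
    (hcn : nb I c ≤ 2) (hz : z ∈ A) (hzn : nb I z = 0) (hzI : z ∉ I) (hzA : nb A z ≤ 2) :
    False := by
  obtain ⟨I', hI', rfl⟩ : ∃ I', c ∉ I' ∧ insert c I' = I :=
    ⟨I.erase c, Finset.notMem_erase c I, Finset.insert_erase hc⟩
  obtain ⟨A', hA', rfl⟩ : ∃ A', z ∉ A' ∧ insert z A' = A :=
    ⟨A.erase z, Finset.notMem_erase z A, Finset.insert_erase hz⟩
  rw [nb_insert hI', adj_self] at hcn
  rw [nb_insert hA', adj_self] at hzA
  refine h.false_of_lt (I' := I') (A' := A') ?_ ?_ ?_ ?_ ?_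
  · intro p hp
    rcases Finset.mem_insert.1 (h.sub (Finset.mem_insert_of_mem hp)) with rfl | h'
    · exact absurd (Finset.mem_insert_of_mem hp) hzI
    · exact h'
  · rw [Finset.card_insert_of_notMem hI', Finset.card_insert_of_notMem hA']; ring
  · rw [bd_insert_insert hI', bd_insert_insert hA']; omega
  · rw [bd_insert_right hA', hzn, bd_insert_left hI']
    have := nb_le_four A' c
    omega
  · rw [Finset.sum_insert hI']; omega

/-- Moving a flat piece of the boundary of `I` by one row, and the boundary of `A` accordingly. -/
lemma push_aux (hs : I ⊆ A) {α r d : ℤ} {f : ℤ → ℤ} (n : ℕ)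
    (h : ∀ x, α ≤ x → x ≤ α + n → (x, r + 1) ∈ I ∧ (x, r) ∉ I ∧ f x ≤ r ∧ (x, f x) ∉ A ∧
      (∀ y, f x < y → y ≤ r → (x, y) ∈ A) ∧ d ≤ φ (x, r)) :
    ∃ I' A' : Finset Pt, (∀ p, p ∈ I' ↔ p ∈ I ∨ (α ≤ p.1 ∧ p.1 ≤ α + n ∧ p.2 = r)) ∧
      (∀ p, p ∈ A' ↔ p ∈ A ∨ (α ≤ p.1 ∧ p.1 ≤ α + n ∧ p.2 = f p.1)) ∧
      I'.card = I.card + (n + 1) ∧ A'.card = A.card + (n + 1) ∧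
      ∑ p ∈ I, φ p + (n + 1) * d ≤ ∑ p ∈ I', φ p ∧
      bd I' I' ≤ bd I I + 2 - 2 * ind I (α - 1, r) - 2 * ind I (α + n + 1, r) ∧
      bd A' A' ≤ bd A A + 2 - 2 * ind A (α + n + 1, f (α + n)) ∧
      bd I' A' ≤ bd I A + 2 - ind I (α - 1, r) - ind A (α + n + 1, r) := by
  induction n with
  | zero =>
    obtain ⟨h1, h2, h3, h4, h5, h6⟩ := h α le_rfl (by simp)
    have hup : (α, f α + 1) ∈ A := by
      rcases eq_or_lt_of_le h3 with e | e
      · rw [e]; exact hs h1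
      · exact h5 _ (by omega) (by omega)
    refine ⟨insert (α, r) I, insert (α, f α) A, ?_, ?_, ?_, ?_, ?_, ?_, ?_, ?_⟩
    · rintro ⟨x, y⟩
      simp only [Finset.mem_insert, Prod.mk.injEq]
      constructor
      · rintro (⟨rfl, rfl⟩ | h); exacts [Or.inr (by simp), Or.inl h]
      · rintro (h | h); exacts [Or.inr h, Or.inl (by simp at h; omega)]
    · rintro ⟨x, y⟩
      simp only [Finset.mem_insert, Prod.mk.injEq]
      constructor
      · rintro (⟨rfl, rfl⟩ | h); exacts [Or.inr (by simp), Or.inl h]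
      · rintro (h | ⟨e1, e2, e3⟩)
        · exact Or.inr h
        · have : x = α := by simp at e2; omega
          subst this; exact Or.inl ⟨rfl, e3⟩
    · rw [Finset.card_insert_of_notMem h2]
    · rw [Finset.card_insert_of_notMem h4]
    · rw [Finset.sum_insert h2]; push_cast; linarith
    · rw [bd_insert_insert h2, nb_eq]
      have := ind_of_mem h1
      have := ind_nonneg I (α, r - 1)
      simp only [Nat.cast_zero, add_zero]
      omega
    · rw [bd_insert_insert h4, nb_eq]
      have := ind_of_mem hup
      have := ind_nonneg A (α, f α - 1)
      have := ind_nonneg A (α - 1, f α)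
      simp only [Nat.cast_zero, add_zero]
      omega
    · rw [bd_insert_left h2, bd_insert_right h4, nb_insert h4]
      simp only [Nat.cast_zero, add_zero]
      have := ind_mono hs (α - 1, r)
      have := ind_mono hs (α + 1, r)
      have := ind_of_mem (hs h1)
      have e1 := nb_nonneg I (α, f α)
      have e2 := nb_eq A (α, r)
      have e3 := nb_eq I (α, r)
      have e4 := ind_of_mem h1
      have e5 := ind_nonneg I (α, r - 1)
      have e6 := ind_nonneg A (α, r - 1)
      have e7 := adj_nonneg (α, r) (α, f α)
      simp only at e2 e3
      rcases eq_or_lt_of_le h3 with e | e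
      · rw [e] at e1 ⊢
        have := ind_nonneg I (α - 1, r)
        have := ind_nonneg I (α + 1, r)
        rw [adj_self]
        omega
      · rcases eq_or_lt_of_le (show f α ≤ r - 1 by omega) with e' | e'
        · have : adj (α, r) (α, f α) = 1 := by simp [adj, d1, e']
          omega
        · have := ind_of_mem (h5 (r - 1) e' (by omega))
          omega
  | succ n ih =>
    obtain ⟨I', A', mI, mA, cI, cA, hφ, b1, b2, b3⟩ :=
      ih fun x hx hx' => h x hx (by push_cast; omega)
    obtain ⟨h1, h2, h3, h4, h5, h6⟩ := h (α + n + 1) (by omega) (by push_cast; omega)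
    obtain ⟨g1, g2, g3, g4, g5, g6⟩ := h (α + n) (by omega) (by push_cast; omega)
    set x := α + n + 1 with hx
    have hxn : α + (n : ℤ) = x - 1 := by omega
    rw [hxn] at g1 g2 g3 g4 g5 g6 mI mA b2
    have hsI : I ⊆ I' := fun p hp => (mI p).2 (Or.inl hp)
    have hsA : A ⊆ A' := fun p hp => (mA p).2 (Or.inl hp)
    have i1 : (x, r) ∉ I' := by rw [mI]; rintro (h' | h'); exacts [h2 h', by simp at h']
    have i2 : (x, f x) ∉ A' := by rw [mA]; rintro (h' | h'); exacts [h4 h', by simp at h']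
    have i3 : (x - 1, r) ∈ I' := (mI _).2 (Or.inr ⟨by simp; omega, by simp, rfl⟩)
    have i4 : (x - 1, r) ∈ A' := by
      rw [mA]
      rcases eq_or_lt_of_le g3 with e | e
      · exact Or.inr ⟨by simp; omega, by simp, e.symm⟩
      · exact Or.inl (g5 r e le_rfl)
    have hup : (x, f x + 1) ∈ A := by
      rcases eq_or_lt_of_le h3 with e | e
      · rw [e]; exact hs h1
      · exact h5 _ (by omega) (by omega)
    have hcast : α + ((n + 1 : ℕ) : ℤ) = x := by push_cast; omega
    rw [hcast]
    refine ⟨insert (x, r) I', insert (x, f x) A', ?_, ?_, ?_, ?_, ?_, ?_, ?_, ?_⟩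
    · rintro ⟨u, v⟩
      simp only [Finset.mem_insert, Prod.mk.injEq, mI]
      constructor
      · rintro (⟨rfl, rfl⟩ | h | h)
        exacts [Or.inr (by omega), Or.inl h, Or.inr (by omega)]
      · rintro (h | h)
        · exact Or.inr (Or.inl h)
        · by_cases hu : u = x
          · exact Or.inl ⟨hu, h.2.2⟩
          · exact Or.inr (Or.inr (by omega))
    · rintro ⟨u, v⟩
      simp only [Finset.mem_insert, Prod.mk.injEq, mA]
      constructor
      · rintro (⟨rfl, rfl⟩ | h | h)
        exacts [Or.inr (by omega), Or.inl h, Or.inr (by omega)]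
      · rintro (h | h)
        · exact Or.inr (Or.inl h)
        · by_cases hu : u = x
          · subst hu; exact Or.inl ⟨rfl, h.2.2⟩
          · exact Or.inr (Or.inr (by omega))
    · rw [Finset.card_insert_of_notMem i1, cI]; ring
    · rw [Finset.card_insert_of_notMem i2, cA]; ring
    · rw [Finset.sum_insert i1]; push_cast; linarith
    · rw [bd_insert_insert i1, nb_eq]
      have := ind_of_mem (hsI h1)
      have := ind_of_mem i3
      have := ind_of_notMem h2
      have := ind_nonneg I' (x, r - 1)
      have := ind_mono hsI (x + 1, r)
      simp only
      omega
    · rw [bd_insert_insert i2, nb_eq]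
      have := ind_of_mem (hsA hup)
      have := ind_nonneg A' (x, f x - 1)
      have := ind_mono hsA (x + 1, f x)
      have := ind_nonneg A' (x - 1, f x)
      simp only at b2 ⊢
      rcases lt_or_ge (f x) (f (x - 1)) with e | e
      · have := ind_of_mem (h5 _ e g3)
        omega
      · have : ind A' (x - 1, f x) = 1 := by
          apply ind_of_mem
          rw [mA]
          rcases eq_or_lt_of_le e with e' | e'
          · exact Or.inr ⟨by simp; omega, by simp, e'.symm⟩
          · exact Or.inl (g5 _ e' h3)
        have := ind_nonneg A (x, f (x - 1))
        omega
    · rw [bd_insert_left i1, bd_insert_right i2, nb_insert i2]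
      have s1 := ind_mono hsI (x + 1, r)
      have s2 := ind_mono hsA (x + 1, r)
      have s8 := ind_nonneg I (x + 1, r)
      have s3 := ind_of_mem (hsA (hs h1))
      have s4 := ind_of_mem i3
      have s5 := ind_of_mem i4
      have s6 := ind_of_notMem h2
      have s7 := ind_of_mem (hsI h1)
      have e1 := nb_nonneg I' (x, f x)
      have e2 := nb_eq A' (x, r)
      have e3 := nb_eq I' (x, r)
      have e5 := ind_nonneg I' (x, r - 1)
      have e6 := ind_nonneg A' (x, r - 1)
      have e7 := adj_nonneg (x, r) (x, f x)
      simp only at e2 e3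
      rcases eq_or_lt_of_le h3 with e | e
      · rw [e] at e1 ⊢
        rw [adj_self]
        have := ind_nonneg I (x + 1, r)
        have := ind_nonneg A (x, r)
        omega
      · have := ind_of_mem (h5 r e le_rfl)
        rcases eq_or_lt_of_le (show f x ≤ r - 1 by omega) with e' | e'
        · have : adj (x, r) (x, f x) = 1 := by simp [adj, d1, e']
          omega
        · have := ind_of_mem (hsA (h5 (r - 1) e' (by omega)))
          omega

end Local

section Local

variable {a b δ : ℝ} {φ : Pt → ℤ} {I A : Finset Pt}

lemma exists_first_gap (A : Finset Pt) (x r : ℤ) :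
    ∃ y, y ≤ r ∧ (x, y) ∉ A ∧ ∀ y', y < y' → y' ≤ r → (x, y') ∈ A := by
  obtain ⟨m, hm⟩ : ∃ m : ℤ, ∀ p ∈ A, m ≤ p.2 := by
    obtain ⟨m, hm⟩ := (A.image Prod.snd).bddBelow
    exact ⟨m, fun p hp => hm (Finset.mem_coe.2 (Finset.mem_image_of_mem _ hp))⟩
  obtain ⟨y, ⟨h1, h2⟩, h3⟩ := Int.exists_greatest_of_bdd (P := fun y => y ≤ r ∧ (x, y) ∉ A)
    ⟨r, fun z hz => hz.1⟩ ⟨min r (m - 1), by omega, fun h => by have := hm _ h; simp at this⟩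
  refine ⟨y, h1, h2, fun y' h4 h5 => ?_⟩
  by_contra h6
  have := h3 y' ⟨h5, h6⟩
  omega

/-- The pushing estimate. -/
lemma Opt.push (h : Opt a b δ φ I A) {α β r d : ℤ} (hαβ : α ≤ β)
    (hrow : ∀ x, α ≤ x → x ≤ β → (x, r + 1) ∈ I ∧ (x, r) ∉ I ∧ d ≤ φ (x, r)) :
    δ * (((β - α + 1) * d : ℤ) : ℝ) ≤
      4 - 2 * ((ind I (α - 1, r) + ind I (β + 1, r) : ℤ) : ℝ) := by
  obtain ⟨n, rfl⟩ : ∃ n : ℕ, β = α + n := ⟨(β - α).toNat, by omega⟩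
  choose f hf1 hf2 hf3 using fun x => exists_first_gap A x r
  obtain ⟨I', A', mI, mA, cI, cA, hφ, b1, b2, b3⟩ := push_aux (φ := φ) h.sub (α := α) (r := r)
    (d := d) (f := f) n fun x hx hx' =>
      ⟨(hrow x hx hx').1, (hrow x hx hx').2.1, hf1 x, hf2 x, hf3 x, (hrow x hx hx').2.2⟩
  have hsub : I' ⊆ A' := by
    intro p hp
    rw [mA]
    rcases (mI p).1 hp with hp | ⟨h1, h2, h3⟩
    · exact Or.inl (h.sub hp)
    · rcases eq_or_lt_of_le (hf1 p.1) with e | e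
      · exact Or.inr ⟨h1, h2, by omega⟩
      · exact Or.inl (by have := hf3 p.1 r e le_rfl; rwa [← h3] at this)
  have key := h.le I' A' hsub (by omega)
  have q1 := ind_nonneg A (α + n + 1, f (α + n))
  have q2 := ind_mono h.sub (α + n + 1, r)
  set i1 := ind I (α - 1, r)
  set i2 := ind I (α + n + 1, r)
  have c1 : bd I' I' + bd A' A' ≤ bd I I + bd A A + (4 - 2 * i1 - 2 * i2) := by omega
  have c2 : bd I' A' ≤ bd I A + (2 - i1 - i2) := by omega
  have c1' : ((bd I' I' + bd A' A' : ℤ) : ℝ) ≤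
      ((bd I I + bd A A : ℤ) : ℝ) + (4 - 2 * ((i1 + i2 : ℤ) : ℝ)) := by
    have : ((bd I' I' + bd A' A' : ℤ) : ℝ) ≤ ((bd I I + bd A A + (4 - 2 * i1 - 2 * i2) : ℤ) : ℝ) :=
      by exact_mod_cast c1
    push_cast at this ⊢; linarith
  have c2' : ((bd I' A' : ℤ) : ℝ) ≤ ((bd I A : ℤ) : ℝ) + (2 - ((i1 + i2 : ℤ) : ℝ)) := by
    have : ((bd I' A' : ℤ) : ℝ) ≤ ((bd I A + (2 - i1 - i2) : ℤ) : ℝ) := by exact_mod_cast c2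
    push_cast at this ⊢; linarith
  have hφ' : ((∑ p ∈ I, φ p : ℤ) : ℝ) + (((n : ℤ) + 1) * d : ℤ) ≤ ((∑ p ∈ I', φ p : ℤ) : ℝ) := by
    exact_mod_cast hφ
  have e1 := mul_le_mul_of_nonneg_left c1' h.ha.le
  have e2 := mul_le_mul_of_nonneg_left c2' h.hb.le
  have e3 := mul_le_mul_of_nonneg_left hφ' h.hδ.le
  simp only [phaseEnergy] at key
  have e4 : α + (n : ℤ) - α + 1 = n + 1 := by ring
  rw [e4]
  have := h.hab
  have e5 : b = 2 - 2 * a := by linarith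
  rw [e5] at e2 key
  nlinarith

/-- A flat piece of the boundary with both ends capped cannot face the region `φ > 0`. -/
lemma Opt.false_of_capped (h : Opt a b δ φ I A) {α β r : ℤ} (hαβ : α ≤ β)
    (hrow : ∀ x, α ≤ x → x ≤ β → (x, r + 1) ∈ I ∧ (x, r) ∉ I ∧ 1 ≤ φ (x, r))
    (hl : (α - 1, r) ∈ I) (hr : (β + 1, r) ∈ I) : False := by
  have key := h.push hαβ hrow
  rw [ind_of_mem hl, ind_of_mem hr] at key
  have h1 : (1 : ℝ) ≤ (((β - α + 1) * 1 : ℤ) : ℝ) := by exact_mod_cast (by omega)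
  have h2 := mul_pos h.hδ (by linarith : (0 : ℝ) < (((β - α + 1) * 1 : ℤ) : ℝ))
  norm_num at key h2
  linarith

lemma nb_le_two_of_low {T : Finset Pt} {c : Pt} (low : ∀ p ∈ T, c.2 ≤ p.2)
    (right : ∀ p ∈ T, p.2 = c.2 → p.1 ≤ c.1) : nb T c ≤ 1 + ind T (c.1 - 1, c.2) ∧
      ind T (c.1 + 1, c.2) = 0 ∧ ind T (c.1, c.2 - 1) = 0 := by
  have h1 : ind T (c.1 + 1, c.2) = 0 :=
    ind_of_notMem fun h => by have := right _ h rfl; simp at this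
  have h2 : ind T (c.1, c.2 - 1) = 0 :=
    ind_of_notMem fun h => by have := low _ h; simp at this
  have := ind_le_one T (c.1, c.2 + 1)
  rw [nb_eq]
  exact ⟨by omega, h1, h2⟩

lemma exists_lowest_right {T : Finset Pt} (hT : T.Nonempty) :
    ∃ c ∈ T, (∀ p ∈ T, c.2 ≤ p.2) ∧ ∀ p ∈ T, p.2 = c.2 → p.1 ≤ c.1 := by
  obtain ⟨y, hy, hy'⟩ := Finset.exists_min_image T (fun p => p.2) hT
  obtain ⟨c, hc, hc'⟩ := Finset.exists_max_image (T.filter fun p => p.2 = y.2) (fun p => p.1)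
    ⟨y, by simp [hy]⟩
  simp only [Finset.mem_filter] at hc hc'
  exact ⟨c, hc.1, fun p hp => by rw [hc.2]; exact hy' p hp,
    fun p hp h => hc' p ⟨hp, h.trans hc.2⟩⟩

/-- Removing the rightmost cells of the lowest rows of `I` and of `A`. -/
lemma peel_step (hs : I ⊆ A) {c : Pt} (hc : c ∈ I) (low : ∀ p ∈ I, c.2 ≤ p.2)
    (right : ∀ p ∈ I, p.2 = c.2 → p.1 ≤ c.1) :
    ∃ A' : Finset Pt, I.erase c ⊆ A' ∧ A'.card + 1 = A.card ∧
      bd (I.erase c) (I.erase c) + bd A' A' ≤ bd I I + bd A A + 2 * nb I c - 4 ∧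
      bd (I.erase c) A' ≤ bd I A := by
  obtain ⟨z, hz, zlow, zright⟩ := exists_lowest_right ⟨c, hs hc⟩
  have hzI : z ∈ I → z = c := fun h => by
    have h1 := low _ h
    have h2 := zlow _ (hs hc)
    have h3 := right _ h (by omega)
    have h4 := zright _ (hs hc) (by omega)
    exact Prod.ext (by omega) (by omega)
  refine ⟨A.erase z, ?_, Finset.card_erase_add_one hz, ?_⟩
  · intro p hp
    rw [Finset.mem_erase] at hp ⊢
    exact ⟨fun h => hp.1 (h ▸ hzI (h ▸ hp.2)), hs hp.2⟩
  obtain ⟨n1, n2, n3⟩ := nb_le_two_of_low zlow zright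
  obtain ⟨m1, m2, m3⟩ := nb_le_two_of_low low right
  have := ind_le_one A (z.1 - 1, z.2)
  have := ind_le_one I (c.1 - 1, c.2)
  have key : (z = c ∧ nb I z ≤ 2) ∨ (z ≠ c ∧ nb (I.erase c) z + nb A c ≤ 4) := by
    by_cases hzc : z = c
    · exact Or.inl ⟨hzc, by rw [hzc]; omega⟩
    refine Or.inr ⟨hzc, ?_⟩
    have hcz := low
    have zl := zlow _ (hs hc)
    have u0 : ind (I.erase c) (z.1 + 1, z.2) = 0 := ind_of_notMem fun h => by
      rw [Finset.mem_erase] at h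
      have := zright _ (hs h.2) rfl
      simp at this
    have u1 : ind (I.erase c) (z.1 - 1, z.2) = 0 := ind_of_notMem fun h => by
      rw [Finset.mem_erase] at h
      have h1 := low _ h.2
      simp only at h1
      have h2 := right _ h.2 (by simp only; omega)
      simp only at h2
      have h3 := zright _ (hs hc) (by omega)
      by_cases e : z.1 = c.1
      · exact hzc (Prod.ext e (by omega))
      · exact h.1 (Prod.ext (by simp only; omega) (by simp only; omega))
    have u2 : ind (I.erase c) (z.1, z.2 - 1) = 0 := ind_of_notMem fun h => by
      rw [Finset.mem_erase] at h
      have h1 := zlow _ (hs h.2)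
      simp at h1
    have u3 := ind_le_one (I.erase c) (z.1, z.2 + 1)
    have e := nb_eq (I.erase c) z
    by_cases hup : (z.1, z.2 + 1) ∈ I.erase c
    · have : ind A (c.1, c.2 - 1) = 0 := ind_of_notMem fun h => by
        rw [Finset.mem_erase] at hup
        have h1 := low _ hup.2
        have h2 := zlow _ h
        simp only at h1 h2
        have h3 := zright _ h (by simp only; omega)
        have h4 := right _ hup.2 (by simp only; omega)
        simp only at h3 h4
        exact hup.1 (Prod.ext (by simp only; omega) (by simp only; omega))
      have := nb_eq A c
      have := ind_le_one A (c.1 + 1, c.2)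
      have := ind_le_one A (c.1 - 1, c.2)
      have := ind_le_one A (c.1, c.2 + 1)
      omega
    · have := ind_of_notMem hup
      have := nb_le_four A c
      omega
  obtain ⟨I', hI', rfl⟩ : ∃ I', c ∉ I' ∧ insert c I' = I :=
    ⟨I.erase c, Finset.notMem_erase c I, Finset.insert_erase hc⟩
  obtain ⟨A', hA', rfl⟩ : ∃ A', z ∉ A' ∧ insert z A' = A :=
    ⟨A.erase z, Finset.notMem_erase z A, Finset.insert_erase hz⟩
  rw [Finset.erase_insert hI'] at key ⊢
  rw [Finset.erase_insert hA']
  rw [bd_insert_insert hI', bd_insert_insert hA', bd_insert_left hI', bd_insert_right hA']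
  rw [nb_insert hA', adj_self] at n1
  rw [nb_insert hI', adj_self] at m1 ⊢
  refine ⟨by omega, ?_⟩
  rcases key with ⟨rfl, hk⟩ | ⟨-, hk⟩
  · rw [nb_insert hA', adj_self]; omega
  · omega

/-- Removing the right part of the lowest row of `I`. -/
lemma peel_run (hs : I ⊆ A) {x y : ℤ} (low : ∀ p ∈ I, y ≤ p.2)
    (right : ∀ p ∈ I, p.2 = y → p.1 ≤ x) (n : ℕ) (run : ∀ j, x - n ≤ j → j ≤ x → (j, y) ∈ I) :
    ∃ A' : Finset Pt, I.filter (fun p => ¬ (p.2 = y ∧ x - n ≤ p.1)) ⊆ A' ∧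
      A'.card + I.card = A.card + (I.filter (fun p => ¬ (p.2 = y ∧ x - n ≤ p.1))).card ∧
      bd (I.filter fun p => ¬ (p.2 = y ∧ x - n ≤ p.1))
        (I.filter fun p => ¬ (p.2 = y ∧ x - n ≤ p.1)) + bd A' A' ≤
        bd I I + bd A A - 2 * (1 - ind I (x - n - 1, y)) ∧
      bd (I.filter fun p => ¬ (p.2 = y ∧ x - n ≤ p.1)) A' ≤ bd I A := by
  induction n with
  | zero =>
    have hc : (x, y) ∈ I := run x (by simp) le_rfl
    obtain ⟨A', h1, h2, h3, h4⟩ := peel_step hs hc low right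
    have e : I.filter (fun p => ¬ (p.2 = y ∧ x - (0 : ℕ) ≤ p.1)) = I.erase (x, y) := by
      ext p
      simp only [Finset.mem_filter, Finset.mem_erase, Nat.cast_zero, sub_zero]
      constructor
      · rintro ⟨h, h'⟩
        exact ⟨fun e => h' (by simp [e]), h⟩
      · rintro ⟨h, h'⟩
        refine ⟨h', fun e => h (Prod.ext ?_ e.1)⟩
        have := right p h' e.1
        simp only; omega
    rw [e]
    have := Finset.card_erase_add_one hc
    have m := (nb_le_two_of_low (c := (x, y)) low right).1
    simp only [Nat.cast_zero, sub_zero] at m ⊢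
    exact ⟨A', h1, by omega, by omega, h4⟩
  | succ n ih =>
    obtain ⟨A₁, h1, h2, h3, h4⟩ := ih fun j hj => run j (by push_cast; omega)
    set J := I.filter (fun p => ¬ (p.2 = y ∧ x - n ≤ p.1)) with hJ
    have hc0 : (x - n - 1, y) ∈ I := run _ (by push_cast; omega) (by omega)
    have hc : (x - n - 1, y) ∈ J := by
      rw [hJ, Finset.mem_filter]; exact ⟨hc0, by simp⟩
    have lowJ : ∀ p ∈ J, (x - n - 1, y).2 ≤ p.2 := fun p hp => low p (Finset.mem_filter.1 hp).1
    have rightJ : ∀ p ∈ J, p.2 = (x - n - 1, y).2 → p.1 ≤ (x - n - 1, y).1 := fun p hp e => by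
      have := (Finset.mem_filter.1 hp).2
      simp only at e ⊢
      by_contra h
      exact this ⟨e, by omega⟩
    obtain ⟨A', g1, g2, g3, g4⟩ := peel_step h1 hc lowJ rightJ
    have e : I.filter (fun p => ¬ (p.2 = y ∧ x - (n + 1 : ℕ) ≤ p.1)) = J.erase (x - n - 1, y) := by
      ext p
      simp only [Finset.mem_filter, Finset.mem_erase, hJ]
      constructor
      · rintro ⟨h, h'⟩
        refine ⟨fun e => h' ?_, h, fun h'' => h' ⟨h''.1, by push_cast; omega⟩⟩
        rw [e]; exact ⟨rfl, by push_cast; omega⟩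
      · rintro ⟨h, h', h''⟩
        refine ⟨h', fun e => ?_⟩
        by_cases h5 : x - n ≤ p.1
        · exact h'' ⟨e.1, h5⟩
        · refine h (Prod.ext ?_ e.1)
          have := e.2
          push_cast at this
          simp only; omega
    rw [e]
    have := Finset.card_erase_add_one hc
    have m := (nb_le_two_of_low lowJ rightJ).1
    have i0 := ind_of_mem hc0
    have i1 : ind J (x - n - 1 - 1, y) ≤ ind I (x - n - 1 - 1, y) :=
      ind_mono (Finset.filter_subset _ I) _
    have e2 : x - (n + 1 : ℕ) - 1 = x - n - 1 - 1 := by push_cast; ring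
    rw [e2]
    simp only at m
    exact ⟨A', g1, by omega, by omega, by omega⟩

/-- The lowest row of `I` must be long enough to pay for its removal. -/
lemma Opt.peel (h : Opt a b δ φ I A) {t x y : ℤ} (low : ∀ p ∈ I, y ≤ p.2)
    (right : ∀ p ∈ I, p.2 = y → p.1 ≤ x) (htx : t ≤ x) (run : ∀ j, t ≤ j → j ≤ x → (j, y) ∈ I)
    (hend : (t - 1, y) ∉ I) :
    2 * a ≤ δ * ((∑ p ∈ I.filter (fun p => p.2 = y ∧ t ≤ p.1), φ p : ℤ) : ℝ) := by
  obtain ⟨n, rfl⟩ : ∃ n : ℕ, t = x - n := ⟨(x - t).toNat, by omega⟩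
  obtain ⟨A', h1, h2, h3, h4⟩ := peel_run h.sub low right n run
  have key := h.le _ A' h1 h2
  rw [ind_of_notMem hend] at h3
  have hsum := Finset.sum_filter_add_sum_filter_not I (fun p => p.2 = y ∧ x - n ≤ p.1) φ
  set J := I.filter (fun p => ¬ (p.2 = y ∧ x - n ≤ p.1))
  have h3' : ((bd J J + bd A' A' : ℤ) : ℝ) ≤ ((bd I I + bd A A : ℤ) : ℝ) - 2 := by
    have : ((bd J J + bd A' A' : ℤ) : ℝ) ≤ ((bd I I + bd A A - 2 * (1 - 0) : ℤ) : ℝ) := by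
      exact_mod_cast h3
    push_cast at this ⊢; linarith
  have h4' : ((bd J A' : ℤ) : ℝ) ≤ ((bd I A : ℤ) : ℝ) := by exact_mod_cast h4
  have e1 := mul_le_mul_of_nonneg_left h3' h.ha.le
  have e2 := mul_le_mul_of_nonneg_left h4' h.hb.le
  rw [← hsum] at key
  simp only [phaseEnergy] at key
  push_cast at key e1 e2 ⊢
  linarith

/-- The lowest rightmost cell of `I` cannot lie where `φ < 0`. -/
lemma Opt.lowest_nonneg (h : Opt a b δ φ I A) {c : Pt} (hc : c ∈ I) (low : ∀ p ∈ I, c.2 ≤ p.2)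
    (right : ∀ p ∈ I, p.2 = c.2 → p.1 ≤ c.1) : 0 ≤ φ c := by
  by_contra! hφ
  obtain ⟨A', h1, h2, h3, h4⟩ := peel_step h.sub hc low right
  have := nb_le_two_of_low low right
  have := ind_le_one I (c.1 - 1, c.2)
  have := Finset.card_erase_add_one hc
  have := Finset.add_sum_erase I φ hc
  exact h.false_of_lt h1 (by omega) (by omega) h4 (by omega)

end Local

/-! ### Packing the columns of a strip -/

/-- The part of `s` in the window `[yb, yT]` is packed against `yb`. -/
noncomputable def packc (yb yT : ℤ) (s : Finset ℤ) : Finset ℤ :=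
  (s \ Finset.Icc yb yT) ∪ Finset.Ico yb (yb + (s ∩ Finset.Icc yb yT).card)

section Column

variable {yb yT : ℤ} {s t : Finset ℤ}

lemma mem_packc {y : ℤ} : y ∈ packc yb yT s ↔
    (y ∈ s ∧ ¬ (yb ≤ y ∧ y ≤ yT)) ∨ (yb ≤ y ∧ y < yb + (s ∩ Finset.Icc yb yT).card) := by
  simp [packc]

lemma card_win_le (hw : yb ≤ yT) : ((s ∩ Finset.Icc yb yT).card : ℤ) ≤ yT - yb + 1 := by
  have := Finset.card_le_card (Finset.inter_subset_right : s ∩ Finset.Icc yb yT ⊆ _)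
  rw [Int.card_Icc] at this
  omega

lemma card_packc (hw : yb ≤ yT) : (packc yb yT s).card = s.card := by
  have h1 := card_win_le (s := s) hw
  rw [packc, Finset.card_union_of_disjoint, Int.card_Ico]
  · have := Finset.card_sdiff_add_card_inter s (Finset.Icc yb yT)
    omega
  · rw [Finset.disjoint_left]
    intro y hy hy'
    simp at hy hy'
    omega

lemma packc_mono (h : s ⊆ t) : packc yb yT s ⊆ packc yb yT t := by
  have := Finset.card_le_card (Finset.inter_subset_inter_right h : s ∩ Finset.Icc yb yT ⊆ _)
  intro y hy
  rw [mem_packc] at hy ⊢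
  rcases hy with hy | hy
  · exact Or.inl ⟨h hy.1, hy.2⟩
  · exact Or.inr (by omega)

lemma card_packc_sdiff_le (hw : yb ≤ yT) :
    (packc yb yT s \ packc yb yT t).card ≤ (s \ t).card := by
  have h1 := card_win_le (s := s) hw
  have h2 := card_win_le (s := t) hw
  set m := (s ∩ Finset.Icc yb yT).card with hm
  set n := (t ∩ Finset.Icc yb yT).card with hn
  have e : packc yb yT s \ packc yb yT t ⊆
      ((s \ t) \ Finset.Icc yb yT) ∪ Finset.Ico (yb + n) (yb + m) := by
    intro y hy
    simp only [Finset.mem_sdiff, mem_packc, Finset.mem_union, Finset.mem_Icc, Finset.mem_Ico,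
      ← hm, ← hn] at hy ⊢
    by_cases hw : yb ≤ y ∧ y ≤ yT
    · right
      have : ¬ (y ∈ s ∧ ¬ (yb ≤ y ∧ y ≤ yT)) := fun h => h.2 hw
      omega
    · left
      have : ¬ (yb ≤ y ∧ y < yb + (m : ℤ)) := by omega
      tauto
  have h3 := (Finset.card_le_card e).trans (Finset.card_union_le _ _)
  rw [Int.card_Ico] at h3
  have h4 := Finset.card_sdiff_add_card_inter (s \ t) (Finset.Icc yb yT)
  have h5 : m ≤ ((s \ t) ∩ Finset.Icc yb yT).card + n := by
    refine (Finset.card_le_card ?_).trans (Finset.card_union_le _ _)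
    intro y
    simp only [Finset.mem_inter, Finset.mem_union, Finset.mem_sdiff]
    tauto
  omega

/-- Vertical bonds leaving `s` towards the complement of `t`. -/
def vcol (s t : Finset ℤ) : ℤ :=
  (s.filter fun y => y + 1 ∉ t).card + (s.filter fun y => y - 1 ∉ t).card

lemma card_down_eq_up :
    (s.filter fun y => y - 1 ∉ s).card = (s.filter fun y => y + 1 ∉ s).card := by
  have h1 := Finset.card_filter_add_card_filter_not (s := s) fun y => y - 1 ∈ s
  have h2 := Finset.card_filter_add_card_filter_not (s := s) fun y => y + 1 ∈ s
  have h3 : (s.filter fun y => y - 1 ∈ s).card = (s.filter fun y => y + 1 ∈ s).card := by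
    refine Finset.card_bij' (fun y _ => y - 1) (fun y _ => y + 1) ?_ ?_ ?_ ?_ <;> simp <;> tauto
  omega

lemma vcol_self : vcol s s = 2 * (s.filter fun y => y + 1 ∉ s).card := by
  rw [vcol, card_down_eq_up]; ring

lemma packc_eq_of_full (hw : yb ≤ yT) (h : ((s ∩ Finset.Icc yb yT).card : ℤ) = yT - yb + 1) :
    (∀ y, yb ≤ y → y ≤ yT → y ∈ s) ∧ packc yb yT s = s := by
  have h1 : s ∩ Finset.Icc yb yT = Finset.Icc yb yT :=
    Finset.eq_of_subset_of_card_le Finset.inter_subset_right (by rw [Int.card_Icc]; omega)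
  have h2 : ∀ y, yb ≤ y → y ≤ yT → y ∈ s := fun y h2 h3 => by
    have : y ∈ s ∩ Finset.Icc yb yT := by rw [h1]; simp [h2, h3]
    exact (Finset.mem_inter.1 this).1
  refine ⟨h2, ?_⟩
  ext y
  rw [mem_packc, h]
  constructor
  · rintro (h' | h'); exacts [h'.1, h2 y h'.1 (by omega)]
  · intro h'
    by_cases hy : yb ≤ y ∧ y ≤ yT
    · exact Or.inr (by omega)
    · exact Or.inl ⟨h', hy⟩

/-- The first gap of a column. -/
lemma exists_gap_above {y0 : ℤ} (h0 : y0 ∈ s) :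
    ∃ y1, y0 < y1 ∧ y1 ∉ s ∧ ∀ y, y0 ≤ y → y < y1 → y ∈ s := by
  obtain ⟨M, hM⟩ := s.bddAbove
  obtain ⟨y1, ⟨h1, h2⟩, h3⟩ := Int.exists_least_of_bdd (P := fun y => y0 < y ∧ y ∉ s)
    ⟨y0, fun z hz => hz.1.le⟩ ⟨max (y0 + 1) (M + 1), by omega, fun h => by
      have := hM (Finset.mem_coe.2 h); omega⟩
  refine ⟨y1, h1, h2, fun y h4 h5 => ?_⟩
  by_contra h6
  rcases eq_or_lt_of_le h4 with e | e
  · exact h6 (e ▸ h0)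
  · have := h3 y ⟨e, h6⟩; omega

lemma packc_eq_of_gap {y1 : ℤ} (h1 : yb < y1) (h1' : y1 ≤ yT + 1)
    (h2 : ∀ y, yb ≤ y → y < y1 → y ∈ s) (h3 : ∀ y, y1 ≤ y → y ≤ yT → y ∉ s) :
    packc yb yT s = s ∧ ((s ∩ Finset.Icc yb yT).card : ℤ) = y1 - yb := by
  have e : s ∩ Finset.Icc yb yT = Finset.Ico yb y1 := by
    ext y
    simp only [Finset.mem_inter, Finset.mem_Icc, Finset.mem_Ico]
    constructor
    · rintro ⟨h, h', h''⟩
      refine ⟨h', ?_⟩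
      by_contra hh
      exact h3 y (by omega) h'' h
    · rintro ⟨h, h'⟩
      exact ⟨h2 y h h', h, by omega⟩
  have e2 : ((s ∩ Finset.Icc yb yT).card : ℤ) = y1 - yb := by
    rw [e, Int.card_Ico]; omega
  refine ⟨?_, e2⟩
  ext y
  rw [mem_packc, e2]
  constructor
  · rintro (h | h); exacts [h.1, h2 y h.1 (by omega)]
  · intro h
    by_cases hy : yb ≤ y ∧ y ≤ yT
    · right
      by_contra hh
      exact h3 y (by omega) hy.2 h
    · exact Or.inl ⟨h, hy⟩

/-- The structure of a column that is not packed. -/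
lemma exists_of_packc_ne (hw : yb ≤ yT) (h0 : yb ∈ s) (hne : packc yb yT s ≠ s) :
    ∃ y1, yb < y1 ∧ y1 ≤ yT ∧ y1 ∉ s ∧ (∀ y, yb ≤ y → y < y1 → y ∈ s) ∧
      ∃ y2, y1 < y2 ∧ y2 ≤ yT ∧ y2 ∈ s := by
  obtain ⟨y1, h1, h2, h3⟩ := exists_gap_above h0
  by_cases h4 : y1 ≤ yT
  · refine ⟨y1, h1, h4, h2, h3, ?_⟩
    by_contra! hh
    refine hne (packc_eq_of_gap h1 (by omega) h3 fun y hy hy' h => ?_).1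
    rcases eq_or_lt_of_le hy with e | e
    · exact h2 (e ▸ h)
    · exact hh y e hy' h
  · exact absurd (packc_eq_of_gap (y1 := yT + 1) (by omega) le_rfl
      (fun y hy hy' => h3 y hy (by omega)) fun y hy hy' => by omega).1 hne

lemma vcol_packc_self_add_two (hw : yb ≤ yT) (h0 : yb ∈ s) (hT : yT + 1 ∉ s)
    (hne : packc yb yT s ≠ s) : vcol (packc yb yT s) (packc yb yT s) + 2 ≤ vcol s s := by
  obtain ⟨y1, h1, h2, h3, h4, y2, h5, h6, h7⟩ := exists_of_packc_ne hw h0 hne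
  obtain ⟨y3, h8, h9, h10⟩ := exists_gap_above h7
  have hn1 := card_win_le (s := s) hw
  have hn0 : 1 ≤ (s ∩ Finset.Icc yb yT).card :=
    Finset.card_pos.2 ⟨yb, by simp [h0, hw]⟩
  set n := (s ∩ Finset.Icc yb yT).card with hn
  have h8' : y3 ≤ yT + 1 := by
    by_contra hh
    exact hT (h10 _ (by omega) (by omega))
  rw [vcol_self, vcol_self]
  have e1 : ((packc yb yT s).filter fun y => y + 1 ∉ packc yb yT s) ⊆
      insert (yb + n - 1) ((s.filter fun y => y + 1 ∉ s).filter fun y => ¬ (yb ≤ y ∧ y ≤ yT)) := by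
    intro y
    simp only [Finset.mem_filter, mem_packc, Finset.mem_insert, ← hn]
    rintro ⟨h | h, h'⟩
    · right
      refine ⟨⟨h.1, fun hh => h' ?_⟩, h.2⟩
      by_cases hy : yb ≤ y + 1 ∧ y + 1 ≤ yT
      · exact Or.inr (by omega)
      · exact Or.inl ⟨hh, hy⟩
    · left
      by_contra hh
      exact h' (Or.inr (by omega))
  have e2 : insert (y1 - 1) (insert (y3 - 1)
      ((s.filter fun y => y + 1 ∉ s).filter fun y => ¬ (yb ≤ y ∧ y ≤ yT))) ⊆
      s.filter fun y => y + 1 ∉ s := by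
    intro y
    simp only [Finset.mem_filter, Finset.mem_insert]
    rintro (rfl | rfl | h)
    · exact ⟨h4 _ (by omega) (by omega), by simpa using h3⟩
    · exact ⟨h10 _ (by omega) (by omega), by simpa using h9⟩
    · exact h.1
  have c1 := (Finset.card_le_card e1).trans (Finset.card_insert_le _ _)
  have c2 := Finset.card_le_card e2
  rw [Finset.card_insert_of_notMem, Finset.card_insert_of_notMem] at c2
  · omega
  · simp only [Finset.mem_filter]; omega
  · simp only [Finset.mem_filter, Finset.mem_insert]; omega

lemma vcol_packc_self_le (hw : yb ≤ yT) (h0 : yb ∈ s) :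
    vcol (packc yb yT s) (packc yb yT s) ≤ vcol s s := by
  by_cases hne : packc yb yT s = s
  · rw [hne]
  obtain ⟨y1, h1, h2, h3, h4, y2, h5, h6, h7⟩ := exists_of_packc_ne hw h0 hne
  have hn0 : 1 ≤ (s ∩ Finset.Icc yb yT).card :=
    Finset.card_pos.2 ⟨yb, by simp [h0, hw]⟩
  set n := (s ∩ Finset.Icc yb yT).card with hn
  rw [vcol_self, vcol_self]
  have e1 : ((packc yb yT s).filter fun y => y + 1 ∉ packc yb yT s) ⊆
      insert (yb + n - 1) ((s.filter fun y => y + 1 ∉ s).filter fun y => ¬ (yb ≤ y ∧ y ≤ yT)) := by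
    intro y
    simp only [Finset.mem_filter, mem_packc, Finset.mem_insert, ← hn]
    rintro ⟨h | h, h'⟩
    · right
      refine ⟨⟨h.1, fun hh => h' ?_⟩, h.2⟩
      by_cases hy : yb ≤ y + 1 ∧ y + 1 ≤ yT
      · exact Or.inr (by omega)
      · exact Or.inl ⟨hh, hy⟩
    · left
      by_contra hh
      exact h' (Or.inr (by omega))
  have e2 : insert (y1 - 1)
      ((s.filter fun y => y + 1 ∉ s).filter fun y => ¬ (yb ≤ y ∧ y ≤ yT)) ⊆
      s.filter fun y => y + 1 ∉ s := by
    intro y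
    simp only [Finset.mem_filter, Finset.mem_insert]
    rintro (rfl | h)
    · exact ⟨h4 _ (by omega) (by omega), by simpa using h3⟩
    · exact h.1
  have c1 := (Finset.card_le_card e1).trans (Finset.card_insert_le _ _)
  have c2 := Finset.card_le_card e2
  rw [Finset.card_insert_of_notMem] at c2
  · omega
  · simp only [Finset.mem_filter]; omega

lemma vcol_packc_le (hw : yb ≤ yT) (hst : s ⊆ t) (h0 : yb ∈ s) (hT : yT + 1 ∉ s) :
    vcol (packc yb yT s) (packc yb yT t) ≤ vcol s t := by
  have hm1 := card_win_le (s := s) hw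
  have hn1 := card_win_le (s := t) hw
  have hmn := Finset.card_le_card
    (Finset.inter_subset_inter_right hst : s ∩ Finset.Icc yb yT ⊆ t ∩ Finset.Icc yb yT)
  have hm0 : 1 ≤ (s ∩ Finset.Icc yb yT).card :=
    Finset.card_pos.2 ⟨yb, by simp [h0, hw]⟩
  by_cases hfull : ((s ∩ Finset.Icc yb yT).card : ℤ) = yT - yb + 1
  · rw [(packc_eq_of_full hw hfull).2, (packc_eq_of_full hw (by omega)).2]
  have hgap : (s ∩ Finset.Icc yb yT).card = (t ∩ Finset.Icc yb yT).card →
      ∃ y, yb ≤ y ∧ y ≤ yT ∧ y ∈ s ∧ y + 1 ∉ t := by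
    intro h
    have e := Finset.eq_of_subset_of_card_le (Finset.inter_subset_inter_right hst :
      s ∩ Finset.Icc yb yT ⊆ t ∩ Finset.Icc yb yT) h.ge
    obtain ⟨y1, h1, h2, h3⟩ := exists_gap_above h0
    have h4 : y1 ≤ yT := by
      by_contra h4
      have := (packc_eq_of_gap (s := s) (y1 := yT + 1) (yb := yb) (yT := yT) (by omega) le_rfl
        (fun y hy hy' => h3 y hy (by omega)) fun y hy hy' => by omega).2
      omega
    refine ⟨y1 - 1, by omega, by omega, h3 _ (by omega) (by omega), fun h5 => h2 ?_⟩
    have : y1 ∈ t ∩ Finset.Icc yb yT := by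
      rw [sub_add_cancel] at h5
      simp [h5, h4, h1.le]
    rw [← e] at this
    exact (Finset.mem_inter.1 this).1
  set m := (s ∩ Finset.Icc yb yT).card with hm
  set n := (t ∩ Finset.Icc yb yT).card with hn
  have hD : ((packc yb yT s).filter fun y => y - 1 ∉ packc yb yT t) ⊆
      s.filter fun y => y - 1 ∉ t := by
    intro y
    simp only [Finset.mem_filter, mem_packc, ← hm, ← hn]
    rintro ⟨h | h, h'⟩
    · refine ⟨h.1, fun hh => h' (Or.inl ⟨hh, fun hy => ?_⟩)⟩
      have : y = yT + 1 := by omega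
      exact hT (this ▸ h.1)
    · have : y = yb := by
        by_contra hh
        exact h' (Or.inr (by omega))
      subst this
      exact ⟨h0, fun hh => h' (Or.inl ⟨hh, by omega⟩)⟩
  have hU0 : ∀ y ∈ (packc yb yT s).filter fun y => y + 1 ∉ packc yb yT t,
      y ∈ (s.filter fun y => y + 1 ∉ t).filter (fun y => ¬ (yb ≤ y ∧ y ≤ yT)) ∨
        (y = yb + m - 1 ∧ m = n) := by
    intro y
    simp only [Finset.mem_filter, mem_packc, ← hm, ← hn]
    rintro ⟨h | h, h'⟩
    · left
      refine ⟨⟨h.1, fun hh => h' ?_⟩, h.2⟩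
      by_cases hy : yb ≤ y + 1 ∧ y + 1 ≤ yT
      · exact Or.inr (by omega)
      · exact Or.inl ⟨hh, hy⟩
    · right
      by_contra hh
      exact h' (Or.inr (by omega))
  have hU : ((packc yb yT s).filter fun y => y + 1 ∉ packc yb yT t).card ≤
      (s.filter fun y => y + 1 ∉ t).card := by
    by_cases hmn' : m = n
    · obtain ⟨y1, g1, g2, g3, g4⟩ := hgap hmn'
      have e1 : ((packc yb yT s).filter fun y => y + 1 ∉ packc yb yT t) ⊆
          insert (yb + (m : ℤ) - 1)
            ((s.filter fun y => y + 1 ∉ t).filter fun y => ¬ (yb ≤ y ∧ y ≤ yT)) := fun y hy => by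
        rcases hU0 y hy with h | h
        exacts [Finset.mem_insert_of_mem h, Finset.mem_insert.2 (Or.inl h.1)]
      have e2 : insert y1 ((s.filter fun y => y + 1 ∉ t).filter fun y => ¬ (yb ≤ y ∧ y ≤ yT)) ⊆
          s.filter fun y => y + 1 ∉ t := by
        intro y
        simp only [Finset.mem_insert, Finset.mem_filter]
        rintro (rfl | h)
        exacts [⟨g3, g4⟩, h.1]
      have c1 := (Finset.card_le_card e1).trans (Finset.card_insert_le _ _)
      have c2 := Finset.card_le_card e2
      rw [Finset.card_insert_of_notMem] at c2
      · omega
      · simp only [Finset.mem_filter]; omega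
    · refine Finset.card_le_card fun y hy => ?_
      rcases hU0 y hy with h | h
      exacts [(Finset.mem_filter.1 h).1, absurd h.2 hmn']
  have := Finset.card_le_card hD
  unfold vcol
  omega

/-- Packing increases the integral of a function that decreases beyond the first gap. -/
lemma sum_le_sum_packc (hw : yb ≤ yT) (h0 : yb ∈ s) {ψ : ℤ → ℤ}
    (hψ : ∀ y1, yb < y1 → y1 ∉ s → (∀ y, yb ≤ y → y < y1 → y ∈ s) →
      ∀ y y', y1 ≤ y → y ≤ y' → y' ≤ yT → ψ y' ≤ ψ y) :
    ∑ y ∈ s, ψ y ≤ ∑ y ∈ packc yb yT s, ψ y := by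
  by_cases hne : packc yb yT s = s
  · rw [hne]
  obtain ⟨y1, h1, h2, h3, h4, y2, h5, h6, h7⟩ := exists_of_packc_ne hw h0 hne
  have hanti := hψ y1 h1 h3 h4
  have hn1 := card_win_le (s := s) hw
  have hn2 : ((s ∩ Finset.Icc yb yT).card : ℤ) ≠ yT - yb + 1 := fun h =>
    hne (packc_eq_of_full hw h).2
  have hn3 : y1 < yb + ((s ∩ Finset.Icc yb yT).card : ℤ) := by
    have : insert y2 (Finset.Ico yb y1) ⊆ s ∩ Finset.Icc yb yT := by
      intro y
      simp only [Finset.mem_insert, Finset.mem_Ico, Finset.mem_inter, Finset.mem_Icc]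
      rintro (rfl | h)
      · exact ⟨h7, by omega, h6⟩
      · exact ⟨h4 y h.1 h.2, h.1, by omega⟩
    have := Finset.card_le_card this
    rw [Finset.card_insert_of_notMem (by simp; omega), Int.card_Ico] at this
    omega
  set n := (s ∩ Finset.Icc yb yT).card with hn
  have hcard := card_packc (s := s) hw
  have k1 := Finset.card_sdiff_add_card_inter s (packc yb yT s)
  have k2 := Finset.card_sdiff_add_card_inter (packc yb yT s) s
  have k3 : (s \ packc yb yT s).card = (packc yb yT s \ s).card := by
    rw [Finset.inter_comm] at k2; omega
  have s1 := Finset.sum_inter_add_sum_sdiff s (packc yb yT s) ψ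
  have s2 := Finset.sum_inter_add_sum_sdiff (packc yb yT s) s ψ
  have b1 : ∑ y ∈ s \ packc yb yT s, ψ y ≤ (s \ packc yb yT s).card • ψ (yb + n) := by
    refine Finset.sum_le_card_nsmul _ _ _ fun y hy => ?_
    simp only [Finset.mem_sdiff, mem_packc, ← hn] at hy
    have : yb ≤ y ∧ y ≤ yT := by tauto
    exact hanti _ _ (by omega) (by omega) (by omega)
  have b2 : (packc yb yT s \ s).card • ψ (yb + n) ≤ ∑ y ∈ packc yb yT s \ s, ψ y := by
    refine Finset.card_nsmul_le_sum _ _ _ fun y hy => ?_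
    simp only [Finset.mem_sdiff, mem_packc, ← hn] at hy
    have hy' : yb ≤ y ∧ y < yb + n := by tauto
    have : y1 ≤ y := by
      by_contra hh
      exact hy.2 (h4 y hy'.1 (by omega))
    exact hanti _ _ this (by omega) (by omega)
  rw [k3] at b1
  rw [Finset.inter_comm] at s2
  linarith

end Column

/-! ### Packing all columns of a strip -/

/-- The column of `S` over `x`. -/
noncomputable def col (S : Finset Pt) (x : ℤ) : Finset ℤ := (S.filter (·.1 = x)).image Prod.snd

lemma mem_col {S : Finset Pt} {x y : ℤ} : y ∈ col S x ↔ (x, y) ∈ S := by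
  simp only [col, Finset.mem_image, Finset.mem_filter, Prod.exists]
  constructor
  · rintro ⟨a, b, ⟨h, rfl⟩, rfl⟩
    exact h
  · exact fun h => ⟨x, y, ⟨h, rfl⟩, rfl⟩

lemma col_mono {S T : Finset Pt} (h : S ⊆ T) (x : ℤ) : col S x ⊆ col T x := fun _ hy =>
  mem_col.2 (h (mem_col.1 hy))

lemma sum_col {S : Finset Pt} {X : Finset ℤ} (hX : S.image Prod.fst ⊆ X) {M : Type*}
    [AddCommMonoid M] (f : Pt → M) : ∑ p ∈ S, f p = ∑ x ∈ X, ∑ y ∈ col S x, f (x, y) := by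
  rw [← Finset.sum_fiberwise_of_maps_to (g := Prod.fst) (t := X)
    fun p hp => hX (Finset.mem_image_of_mem _ hp)]
  refine Finset.sum_congr rfl fun x _ => ?_
  refine Finset.sum_bij' (fun p _ => p.2) (fun y _ => (x, y)) ?_ ?_ ?_ ?_ ?_
  · rintro ⟨x', y⟩ h
    simp only [Finset.mem_filter] at h
    obtain ⟨h, rfl⟩ := h
    exact mem_col.2 h
  · intro y hy
    simpa using mem_col.1 hy
  · rintro ⟨x', y⟩ h
    simp only [Finset.mem_filter] at h
    obtain ⟨h, rfl⟩ := h
    rfl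
  · intros
    rfl
  · rintro ⟨x', y⟩ h
    simp only [Finset.mem_filter] at h
    obtain ⟨h, rfl⟩ := h
    rfl

lemma bd_eq_sum_col {S : Finset Pt} (T : Finset Pt) {X : Finset ℤ} (hX : S.image Prod.fst ⊆ X) :
    bd S T = ∑ x ∈ X, (vcol (col S x) (col T x) + ((col S x \ col T (x + 1)).card : ℤ) +
      ((col S x \ col T (x - 1)).card : ℤ)) := by
  rw [bd, sum_col hX]
  refine Finset.sum_congr rfl fun x _ => ?_
  have key : ∀ y, 4 - nb T (x, y) = (if y + 1 ∉ col T x then 1 else 0) +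
      (if y - 1 ∉ col T x then 1 else 0) + (if y ∉ col T (x + 1) then 1 else 0) +
      (if y ∉ col T (x - 1) then (1 : ℤ) else 0) := by
    intro y
    rw [nb_eq]
    simp only [ind, mem_col]
    split_ifs <;> omega
  simp only [key, Finset.sum_add_distrib, vcol, Finset.sdiff_eq_filter]
  simp only [← Finset.sum_filter, Finset.sum_const, nsmul_eq_mul, mul_one]

/-- Pack all columns in the window `[α, β] × [yb, yT]`. -/
noncomputable def gravc (α β yb yT : ℤ) (S : Finset Pt) (x : ℤ) : Finset ℤ :=
  if α ≤ x ∧ x ≤ β then packc yb yT (col S x) else col S x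

noncomputable def grav (α β yb yT : ℤ) (S : Finset Pt) : Finset Pt :=
  (S.image Prod.fst).biUnion fun x => (gravc α β yb yT S x).image fun y => (x, y)

section Grav

variable {α β yb yT : ℤ} {S T : Finset Pt}

lemma gravc_nonempty {x y : ℤ} (hw : yb ≤ yT) (h : y ∈ gravc α β yb yT S x) :
    x ∈ S.image Prod.fst := by
  have h1 : 0 < (gravc α β yb yT S x).card := Finset.card_pos.2 ⟨y, h⟩
  have h2 : (gravc α β yb yT S x).card = (col S x).card := by
    unfold gravc
    split_ifs
    exacts [card_packc hw, rfl]
  rw [h2] at h1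
  obtain ⟨z, hz⟩ := Finset.card_pos.1 h1
  exact Finset.mem_image.2 ⟨(x, z), mem_col.1 hz, rfl⟩

lemma mem_grav (hw : yb ≤ yT) {p : Pt} :
    p ∈ grav α β yb yT S ↔ p.2 ∈ gravc α β yb yT S p.1 := by
  obtain ⟨x, y⟩ := p
  simp only [grav, Finset.mem_biUnion, Finset.mem_image (s := gravc _ _ _ _ _ _)]
  constructor
  · rintro ⟨x', -, y', h, e⟩
    simp only [Prod.mk.injEq] at e
    obtain ⟨rfl, rfl⟩ := e
    exact h
  · exact fun h => ⟨x, gravc_nonempty hw h, y, h, rfl⟩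

lemma col_grav (hw : yb ≤ yT) (x : ℤ) : col (grav α β yb yT S) x = gravc α β yb yT S x := by
  ext y
  rw [mem_col, mem_grav hw]

lemma image_grav_subset (hw : yb ≤ yT) : (grav α β yb yT S).image Prod.fst ⊆ S.image Prod.fst := by
  intro x hx
  obtain ⟨p, hp, rfl⟩ := Finset.mem_image.1 hx
  exact gravc_nonempty hw ((mem_grav hw).1 hp)

lemma card_grav (hw : yb ≤ yT) : (grav α β yb yT S).card = S.card := by
  rw [Finset.card_eq_sum_ones, Finset.card_eq_sum_ones, sum_col (image_grav_subset hw),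
    sum_col (S := S) subset_rfl]
  refine Finset.sum_congr rfl fun x _ => ?_
  rw [col_grav hw, ← Finset.card_eq_sum_ones, ← Finset.card_eq_sum_ones, gravc]
  split_ifs
  exacts [card_packc hw, rfl]

lemma grav_mono (hw : yb ≤ yT) (h : S ⊆ T) : grav α β yb yT S ⊆ grav α β yb yT T := by
  intro p hp
  rw [mem_grav hw] at hp ⊢
  unfold gravc at hp ⊢
  split_ifs at hp ⊢
  · exact packc_mono (col_mono h _) hp
  · exact col_mono h _ hp

lemma sum_le_sum_grav (hw : yb ≤ yT) {φ : Pt → ℤ}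
    (h0 : ∀ x, α ≤ x → x ≤ β → (x, yb) ∈ S)
    (hφ : ∀ x, α ≤ x → x ≤ β → ∀ y1, yb < y1 → (x, y1) ∉ S →
      (∀ y, yb ≤ y → y < y1 → (x, y) ∈ S) →
      ∀ y y', y1 ≤ y → y ≤ y' → y' ≤ yT → φ (x, y') ≤ φ (x, y)) :
    ∑ p ∈ S, φ p ≤ ∑ p ∈ grav α β yb yT S, φ p := by
  rw [sum_col (image_grav_subset hw), sum_col (S := S) subset_rfl]
  refine Finset.sum_le_sum fun x _ => ?_
  rw [col_grav hw, gravc]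
  split_ifs with h
  · refine sum_le_sum_packc hw (mem_col.2 (h0 x h.1 h.2)) fun y1 h1 h2 h3 => ?_
    refine hφ x h.1 h.2 y1 h1 (fun hh => h2 (mem_col.2 hh)) fun y h4 h5 => ?_
    exact mem_col.1 (h3 y h4 h5)
  · exact le_rfl

lemma card_packc_sdiff_self_comm (hw : yb ≤ yT) (s : Finset ℤ) :
    (s \ packc yb yT s).card = (packc yb yT s \ s).card := by
  have k1 := Finset.card_sdiff_add_card_inter s (packc yb yT s)
  have k2 := Finset.card_sdiff_add_card_inter (packc yb yT s) s
  have k3 := card_packc (s := s) hw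
  rw [Finset.inter_comm] at k2
  omega

/-- The flank column `s'` next to a packed column costs at most `e`. -/
def Flank (yb yT : ℤ) (s s' : Finset ℤ) (e : ℤ) : Prop :=
  packc yb yT s' = s' ∨ ((packc yb yT s \ s).card : ℤ) ≤ e

lemma Flank.out (hw : yb ≤ yT) {s t' : Finset ℤ} {e : ℤ} (he : 0 ≤ e)
    (h : Flank yb yT s t' e) :
    ((packc yb yT s \ t').card : ℤ) ≤ (s \ t').card + e := by
  rcases h with h | h
  · have := card_packc_sdiff_le (s := s) (t := t') hw
    rw [h] at this
    omega
  · have : packc yb yT s \ t' ⊆ (packc yb yT s \ s) ∪ (s \ t') := by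
      intro y
      simp only [Finset.mem_sdiff, Finset.mem_union]
      tauto
    have := (Finset.card_le_card this).trans (Finset.card_union_le _ _)
    omega

lemma Flank.inn (hw : yb ≤ yT) {t s' : Finset ℤ} {e : ℤ} (he : 0 ≤ e)
    (h : Flank yb yT t s' e) :
    ((s' \ packc yb yT t).card : ℤ) ≤ (s' \ t).card + e := by
  rcases h with h | h
  · have := card_packc_sdiff_le (s := s') (t := t) hw
    rw [h] at this
    omega
  · have h1 : s' \ packc yb yT t ⊆ (t \ packc yb yT t) ∪ (s' \ t) := by
      intro y
      simp only [Finset.mem_sdiff, Finset.mem_union]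
      tauto
    have h2 := (Finset.card_le_card h1).trans (Finset.card_union_le _ _)
    rw [card_packc_sdiff_self_comm hw] at h2
    omega

lemma bd_grav_le (hw : yb ≤ yT) {eL eR : ℤ} (heL : 0 ≤ eL) (heR : 0 ≤ eR)
    (hL1 : Flank yb yT (col S α) (col T (α - 1)) eL)
    (hL2 : Flank yb yT (col T α) (col S (α - 1)) eL)
    (hR1 : Flank yb yT (col S β) (col T (β + 1)) eR)
    (hR2 : Flank yb yT (col T β) (col S (β + 1)) eR)
    (g : ℤ → ℤ)
    (hg : ∀ x, α ≤ x → x ≤ β →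
      vcol (packc yb yT (col S x)) (packc yb yT (col T x)) + g x ≤ vcol (col S x) (col T x)) :
    bd (grav α β yb yT S) (grav α β yb yT T) + ∑ x ∈ Finset.Icc α β, g x ≤
      bd S T + 2 * eL + 2 * eR := by
  set X := S.image Prod.fst ∪ (Finset.Icc α β ∪ {α - 1, β + 1, α, β}) with hX
  have hX1 : S.image Prod.fst ⊆ X := Finset.subset_union_left
  rw [bd_eq_sum_col _ ((image_grav_subset hw).trans hX1), bd_eq_sum_col _ hX1]
  have e1 : ∑ x ∈ Finset.Icc α β, g x = ∑ x ∈ X, if α ≤ x ∧ x ≤ β then g x else 0 := by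
    rw [← Finset.sum_filter]
    refine Finset.sum_congr ?_ fun _ _ => rfl
    ext x
    simp only [hX, Finset.mem_filter, Finset.mem_union, Finset.mem_Icc]
    tauto
  have e2 : ∀ z ∈ X, ∀ e : ℤ, e = ∑ x ∈ X, if x = z then e else 0 := fun z hz e => by
    rw [Finset.sum_ite_eq' X z fun _ => e, if_pos hz]
  have m1 : α - 1 ∈ X := by simp [hX]
  have m2 : α ∈ X := by simp [hX]
  have m3 : β ∈ X := by simp [hX]
  have m4 : β + 1 ∈ X := by simp [hX]
  have e3 : 2 * eL + 2 * eR = ∑ x ∈ X,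
      (((if x = α - 1 then eL else 0) + (if x = α then eL else 0)) +
      ((if x = β then eR else 0) + (if x = β + 1 then eR else 0))) := by
    simp only [Finset.sum_add_distrib]
    rw [← e2 _ m1, ← e2 _ m2, ← e2 _ m3, ← e2 _ m4]
    ring
  rw [add_assoc (Finset.sum _ _), e3, e1, ← Finset.sum_add_distrib, ← Finset.sum_add_distrib]
  refine Finset.sum_le_sum fun x _ => ?_
  simp only [col_grav hw]
  have hv : vcol (gravc α β yb yT S x) (gravc α β yb yT T x) + (if α ≤ x ∧ x ≤ β then g x else 0) ≤
      vcol (col S x) (col T x) := by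
    unfold gravc
    split_ifs with h
    · exact hg x h.1 h.2
    · simp
  have hr : ((gravc α β yb yT S x \ gravc α β yb yT T (x + 1)).card : ℤ) ≤
      (col S x \ col T (x + 1)).card +
        ((if x = α - 1 then eL else 0) + (if x = β then eR else 0)) := by
    have n1 : (0 : ℤ) ≤ if x = α - 1 then eL else 0 := by split_ifs <;> omega
    have n2 : (0 : ℤ) ≤ if x = β then eR else 0 := by split_ifs <;> omega
    unfold gravc
    by_cases h : α ≤ x ∧ x ≤ β <;> by_cases h' : α ≤ x + 1 ∧ x + 1 ≤ β
    · rw [if_pos h, if_pos h']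
      have := card_packc_sdiff_le (s := col S x) (t := col T (x + 1)) hw
      omega
    · rw [if_pos h, if_neg h']
      obtain rfl : x = β := by omega
      have := hR1.out hw heR 
      simp only [if_true] at n2 ⊢
      omega
    · rw [if_neg h, if_pos h']
      obtain rfl : x = α - 1 := by omega
      rw [sub_add_cancel]
      have := hL2.inn hw heL
      simp only [if_true] at n1 ⊢
      omega
    · rw [if_neg h, if_neg h']
      omega
  have hl : ((gravc α β yb yT S x \ gravc α β yb yT T (x - 1)).card : ℤ) ≤
      (col S x \ col T (x - 1)).card +
        ((if x = α then eL else 0) + (if x = β + 1 then eR else 0)) := by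
    have n1 : (0 : ℤ) ≤ if x = α then eL else 0 := by split_ifs <;> omega
    have n2 : (0 : ℤ) ≤ if x = β + 1 then eR else 0 := by split_ifs <;> omega
    unfold gravc
    by_cases h : α ≤ x ∧ x ≤ β <;> by_cases h' : α ≤ x - 1 ∧ x - 1 ≤ β
    · rw [if_pos h, if_pos h']
      have := card_packc_sdiff_le (s := col S x) (t := col T (x - 1)) hw
      omega
    · rw [if_pos h, if_neg h']
      obtain rfl : x = α := by omega
      have := hL1.out hw heL 
      simp only [if_true] at n1 ⊢
      omega
    · rw [if_neg h, if_pos h']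
      obtain rfl : x = β + 1 := by omega
      rw [add_sub_cancel_right]
      have := hR2.inn hw heR
      simp only [if_true] at n2 ⊢
      omega
    · rw [if_neg h, if_neg h']
      omega
  linarith

end Grav

/-- Gravity: in a minimal configuration, packing the columns of a strip does not pay. -/
lemma Opt.grav_le {a b δ : ℝ} {φ : Pt → ℤ} {I A : Finset Pt} (h : Opt a b δ φ I A)
    {α β yb yT : ℤ} (hw : yb ≤ yT) {eL eR : ℤ} (heL : 0 ≤ eL) (heR : 0 ≤ eR)
    (h0 : ∀ x, α ≤ x → x ≤ β → (x, yb) ∈ I)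
    (hT : ∀ x, α ≤ x → x ≤ β → (x, yT + 1) ∉ I)
    (hφ : ∀ x, α ≤ x → x ≤ β → ∀ y1, yb < y1 → (x, y1) ∉ I →
      (∀ y, yb ≤ y → y < y1 → (x, y) ∈ I) →
      ∀ y y', y1 ≤ y → y ≤ y' → y' ≤ yT → φ (x, y') ≤ φ (x, y))
    (hL : ∀ S T : Finset Pt, (S = I ∨ S = A) → (T = I ∨ T = A) →
      Flank yb yT (col S α) (col T (α - 1)) eL)
    (hR : ∀ S T : Finset Pt, (S = I ∨ S = A) → (T = I ∨ T = A) →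
      Flank yb yT (col S β) (col T (β + 1)) eR) :
    2 * a * (((Finset.Icc α β).filter fun x => packc yb yT (col I x) ≠ col I x ∨
      ((x, yT + 1) ∉ A ∧ packc yb yT (col A x) ≠ col A x)).card : ℝ) ≤ 4 * ((eL + eR : ℤ) : ℝ) := by
  have hII := bd_grav_le (S := I) (T := I) hw heL heR (hL I I (.inl rfl) (.inl rfl))
    (hL I I (.inl rfl) (.inl rfl)) (hR I I (.inl rfl) (.inl rfl)) (hR I I (.inl rfl) (.inl rfl))
    (fun x => if packc yb yT (col I x) ≠ col I x then 2 else 0) (fun x h1 h2 => by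
      split_ifs with h3
      · exact vcol_packc_self_add_two hw (mem_col.2 (h0 x h1 h2)) (mt mem_col.1 (hT x h1 h2)) h3
      · simpa using vcol_packc_self_le hw (mem_col.2 (h0 x h1 h2)))
  have hAA := bd_grav_le (S := A) (T := A) hw heL heR (hL A A (.inr rfl) (.inr rfl))
    (hL A A (.inr rfl) (.inr rfl)) (hR A A (.inr rfl) (.inr rfl)) (hR A A (.inr rfl) (.inr rfl))
    (fun x => if (x, yT + 1) ∉ A ∧ packc yb yT (col A x) ≠ col A x then 2 else 0)
    (fun x h1 h2 => by
      have h4 := mem_col.2 (h.sub (h0 x h1 h2))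
      split_ifs with h3
      · exact vcol_packc_self_add_two hw h4 (mt mem_col.1 h3.1) h3.2
      · simpa using vcol_packc_self_le hw h4)
  have hIA := bd_grav_le (S := I) (T := A) hw heL heR (hL I A (.inl rfl) (.inr rfl))
    (hL A I (.inr rfl) (.inl rfl)) (hR I A (.inl rfl) (.inr rfl)) (hR A I (.inr rfl) (.inl rfl))
    (fun _ => 0) (fun x h1 h2 => by
      simpa using vcol_packc_le hw (col_mono h.sub x) (mem_col.2 (h0 x h1 h2))
        (mt mem_col.1 (hT x h1 h2)))
  have hφ' := sum_le_sum_grav hw h0 hφ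
  have hle := h.le (grav α β yb yT I) (grav α β yb yT A) (grav_mono hw h.sub)
    (by rw [card_grav hw, card_grav hw])
  rw [← Finset.sum_filter, Finset.sum_const] at hII hAA
  have hc : ((Finset.Icc α β).filter fun x => packc yb yT (col I x) ≠ col I x ∨
      ((x, yT + 1) ∉ A ∧ packc yb yT (col A x) ≠ col A x)).card ≤ _ :=
    (Finset.card_le_card (by rw [Finset.filter_or])).trans (Finset.card_union_le _ _)
  simp only [nsmul_eq_mul, Finset.sum_const_zero, add_zero] at hII hAA hIA
  set n1 := ((Finset.Icc α β).filter fun x => packc yb yT (col I x) ≠ col I x).card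
  set n2 := ((Finset.Icc α β).filter fun x =>
    (x, yT + 1) ∉ A ∧ packc yb yT (col A x) ≠ col A x).card
  have hc' : (((Finset.Icc α β).filter fun x => packc yb yT (col I x) ≠ col I x ∨
      ((x, yT + 1) ∉ A ∧ packc yb yT (col A x) ≠ col A x)).card : ℝ) ≤ n1 + n2 := by
    exact_mod_cast hc
  have r1 : (bd (grav α β yb yT I) (grav α β yb yT I) : ℝ) + n1 * 2 ≤
    bd I I + 2 * eL + 2 * eR := by exact_mod_cast hII
  have r2 : (bd (grav α β yb yT A) (grav α β yb yT A) : ℝ) + n2 * 2 ≤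
    bd A A + 2 * eL + 2 * eR := by exact_mod_cast hAA
  have r3 : (bd (grav α β yb yT I) (grav α β yb yT A) : ℝ) ≤
    bd I A + 2 * eL + 2 * eR := by exact_mod_cast hIA
  have r4 : ((∑ p ∈ I, φ p : ℤ) : ℝ) ≤ ((∑ p ∈ grav α β yb yT I, φ p : ℤ) : ℝ) := by
    exact_mod_cast hφ'
  have hb : b = 2 - 2 * a := by linarith [h.hab]
  have q1 := mul_le_mul_of_nonneg_left r1 h.ha.le
  have q2 := mul_le_mul_of_nonneg_left r2 h.ha.le
  have q3 := mul_le_mul_of_nonneg_left r3 h.hb.le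
  have q4 := mul_le_mul_of_nonneg_left r4 h.hδ.le
  have q5 := mul_le_mul_of_nonneg_left hc' h.ha.le
  have q6 : a * (2 * eL + 2 * eR : ℝ) + a * (2 * eL + 2 * eR) + b * (2 * eL + 2 * eR) =
    4 * (eL + eR) := by rw [hb]; ring
  simp only [phaseEnergy, Int.cast_add] at hle ⊢
  linarith

/-! ### Signed distance and exponential decay of the defects -/

lemma d1_triangle (p q r : Pt) : d1 p r ≤ d1 p q + d1 q r := by unfold d1; omega

/-- `φ` is the signed lattice distance to the boundary of `I₀`, positive inside. -/
structure Sgn (I₀ : Finset Pt) (φ : Pt → ℤ) : Prop where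
  in_exists : ∀ p ∈ I₀, ∃ w ∉ I₀, (d1 p w : ℤ) = φ p
  in_le : ∀ p ∈ I₀, ∀ w ∉ I₀, φ p ≤ d1 p w
  out_exists : ∀ p ∉ I₀, ∃ o ∈ I₀, (d1 p o : ℤ) = -φ p
  out_le : ∀ p ∉ I₀, ∀ o ∈ I₀, -φ p ≤ d1 p o

section Sgn

variable {I₀ : Finset Pt} {φ : Pt → ℤ}

lemma d1_pos {p q : Pt} (h : p ≠ q) : 0 < d1 p q := by
  by_contra! h1
  refine h (Prod.ext ?_ ?_) <;> unfold d1 at h1 <;> omega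

lemma Sgn.pos (h : Sgn I₀ φ) {p : Pt} (hp : p ∈ I₀) : 1 ≤ φ p := by
  obtain ⟨w, hw, e⟩ := h.in_exists p hp
  have := d1_pos (fun e : p = w => hw (e ▸ hp))
  omega

lemma Sgn.neg (h : Sgn I₀ φ) {p : Pt} (hp : p ∉ I₀) : φ p ≤ -1 := by
  obtain ⟨w, hw, e⟩ := h.out_exists p hp
  have := d1_pos (fun e : p = w => hp (e ▸ hw))
  omega

lemma Sgn.mem_of_lt (h : Sgn I₀ φ) {p q : Pt} (hp : p ∈ I₀) (hq : (d1 p q : ℤ) < φ p) :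
    q ∈ I₀ := by
  by_contra hh
  have := h.in_le p hp q hh
  omega

lemma Sgn.notMem_of_lt (h : Sgn I₀ φ) {p q : Pt} (hp : p ∉ I₀) (hq : (d1 p q : ℤ) < -φ p) :
    q ∉ I₀ := fun hh => by
  have := h.out_le p hp q hh
  omega

lemma Sgn.sub_le (h : Sgn I₀ φ) {p q : Pt} (hp : p ∈ I₀) (hq : q ∈ I₀) :
    φ p - d1 p q ≤ φ q := by
  obtain ⟨w, hw, e⟩ := h.in_exists q hq
  have := h.in_le p hp w hw
  have := d1_triangle p q w
  omega

lemma Sgn.le_add (h : Sgn I₀ φ) {p q : Pt} (hp : p ∉ I₀) (hq : q ∉ I₀) :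
    φ q ≤ φ p + d1 p q := by
  obtain ⟨w, hw, e⟩ := h.out_exists q hq
  have := h.out_le p hp w hw
  have := d1_triangle p q w
  omega

/-- Lower bound for the signed distance: a whole ball is contained in `I₀`. -/
lemma Sgn.le_of_ball (h : Sgn I₀ φ) {p : Pt} {n : ℤ} (hn : 1 ≤ n)
    (hb : ∀ q, (d1 p q : ℤ) < n → q ∈ I₀) : n ≤ φ p := by
  have hp : p ∈ I₀ := hb p (by simp [d1]; omega)
  obtain ⟨w, hw, e⟩ := h.in_exists p hp
  by_contra! hh
  exact hw (hb w (by omega))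

lemma Sgn.im (h : Sgn I₀ φ) {g : Pt ≃ Pt} (hg : IsIso g) :
    Sgn (im g I₀) (fun p => φ (g.symm p)) where
  in_exists p hp := by
    obtain ⟨w, hw, e⟩ := h.in_exists _ (mem_im.1 hp)
    refine ⟨g w, by simpa [mem_im] using hw, ?_⟩
    rw [← e, ← hg (g.symm p) w, g.apply_symm_apply]
  in_le p hp w hw := by
    rw [← hg.symm p w]
    exact h.in_le _ (mem_im.1 hp) _ (by simpa [mem_im] using hw)
  out_exists p hp := by
    obtain ⟨w, hw, e⟩ := h.out_exists _ (by simpa [mem_im] using hp)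
    refine ⟨g w, by simpa [mem_im] using hw, ?_⟩
    rw [← e, ← hg (g.symm p) w, g.apply_symm_apply]
  out_le p hp w hw := by
    rw [← hg.symm p w]
    exact h.out_le _ (by simpa [mem_im] using hp) _ (mem_im.1 hw)

end Sgn

lemma nb_eq_four {T : Finset Pt} {p : Pt} (h : ∀ q, d1 p q = 1 → q ∈ T) : nb T p = 4 := by
  rw [nb_eq, ind_of_mem (h _ (by simp [d1])), ind_of_mem (h _ (by simp [d1])),
    ind_of_mem (h _ (by simp [d1])), ind_of_mem (h _ (by simp [d1]))]
  norm_num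

lemma nb_eq_zero {T : Finset Pt} {p : Pt} (h : ∀ q, d1 p q = 1 → q ∉ T) : nb T p = 0 := by
  rw [nb_eq, ind_of_notMem (h _ (by simp [d1])), ind_of_notMem (h _ (by simp [d1])),
    ind_of_notMem (h _ (by simp [d1])), ind_of_notMem (h _ (by simp [d1]))]
  norm_num

lemma sum_le_four_mul_card {X Y : Finset Pt} {f : Pt → ℤ} (hf : ∀ p ∈ X, f p ≤ 4)
    (h0 : ∀ p ∈ X, p ∈ Y → f p ≤ 0) (hY : Y ⊆ X) :
    ∑ p ∈ X, f p ≤ 4 * (X.card - Y.card) := by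
  rw [← Finset.sum_sdiff hY]
  have h1 : ∑ p ∈ X \ Y, f p ≤ (X \ Y).card • (4 : ℤ) :=
    Finset.sum_le_card_nsmul _ _ _ fun p hp => hf p (Finset.mem_sdiff.1 hp).1
  have h2 : ∑ p ∈ Y, f p ≤ 0 := Finset.sum_nonpos fun p hp => h0 p (hY hp) hp
  have h3 := Finset.card_sdiff_add_card_eq_card hY
  simp only [nsmul_eq_mul] at h1
  push_cast [← h3]
  linarith

lemma sum_nb_union_right (S : Finset Pt) {T T' : Finset Pt} (h : Disjoint T T') :
    ∑ p ∈ S, nb (T ∪ T') p = ∑ p ∈ S, nb T p + ∑ p ∈ S, nb T' p := by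
  rw [← Finset.sum_add_distrib]
  exact Finset.sum_congr rfl fun p _ => nb_union h p

section Decay

variable {a b δ : ℝ} {φ : Pt → ℤ} {I A I₀ : Finset Pt}

/-- A translate of `Z` disjoint from `T`. -/
lemma exists_translate (Z T : Finset Pt) : ∃ Y : Finset Pt, Disjoint T Y ∧ Y.card = Z.card ∧
    bd Y Y = bd Z Z := by
  obtain ⟨M, hM⟩ := (T.image Prod.fst).bddAbove
  obtain ⟨m, hm⟩ := (Z.image Prod.fst).bddBelow
  let g : Pt ≃ Pt := Equiv.addRight ((M - m + 1, 0) : Pt)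
  have hg : IsIso g := fun p q => by simp [g, d1]
  refine ⟨im g Z, ?_, card_im g Z, bd_im hg Z Z⟩
  rw [Finset.disjoint_left]
  intro p hp hp'
  have h1 : p.1 ≤ M := hM (Finset.mem_coe.2 (Finset.mem_image_of_mem _ hp))
  have h2 : m ≤ (g.symm p).1 := hm (Finset.mem_coe.2 (Finset.mem_image_of_mem _ (mem_im.1 hp')))
  simp [g] at h2
  omega

/-- Filling a set `X` of cells not in `I`. -/
lemma Opt.fill (h : Opt a b δ φ I A) {X : Finset Pt} (hX : Disjoint I X) :
    δ * ((∑ p ∈ X, φ p : ℤ) : ℝ) ≤ 3 * ((bd X (I ∪ X) : ℤ) : ℝ) := by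
  set M := X \ A
  obtain ⟨Y, hY, hYc, hYb⟩ := exists_translate (A ∩ X) (A ∪ M)
  have hAM : A ∪ M = A ∪ X := by ext; simp [M]
  have hdAM : Disjoint A M := Finset.disjoint_sdiff
  have hXM : X = (A ∩ X) ∪ M := by ext; simp [M]; tauto
  have hdM : Disjoint (A ∩ X) M := hdAM.mono_left Finset.inter_subset_left
  have hle := h.le (I ∪ X) ((A ∪ M) ∪ Y) ?_ ?_
  · have e1 := bd_union_union hX
    have e2 := bd_union_union hY
    have e3 := bd_union_union hdAM
    have n1 : 0 ≤ ∑ p ∈ Y, nb (A ∪ M) p := Finset.sum_nonneg fun p _ => nb_nonneg _ _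
    have e4 : bd (I ∪ X) ((A ∪ M) ∪ Y) ≤ bd I A + bd X (I ∪ X) := by
      rw [bd_union_left hX]
      refine add_le_add (bd_mono_right ?_ _) (bd_mono_right ?_ _)
      · exact Finset.subset_union_left.trans Finset.subset_union_left
      · rw [hAM]
        exact (Finset.union_subset_union_left h.sub).trans Finset.subset_union_left
    have e5 : bd X (I ∪ X) = 4 * X.card - ∑ p ∈ X, nb I p - ∑ p ∈ X, nb X p := by
      rw [bd_eq, sum_nb_union_right _ hX]; ring
    have e6 : bd X X = 4 * X.card - ∑ p ∈ X, nb X p := bd_eq _ _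
    have e7 : bd M M = 4 * M.card - ∑ p ∈ M, nb M p := bd_eq _ _
    have e8 : bd (A ∩ X) (A ∩ X) = 4 * (A ∩ X).card - ∑ p ∈ A ∩ X, nb (A ∩ X) p := bd_eq _ _
    have c1 : (X.card : ℤ) = (A ∩ X).card + M.card := by
      rw [← Nat.cast_add, ← Finset.card_union_of_disjoint hdM, ← hXM]
    have s1 : ∑ p ∈ X, nb X p = ∑ p ∈ A ∩ X, nb (A ∩ X) p + 2 * ∑ p ∈ M, nb (A ∩ X) p +
        ∑ p ∈ M, nb M p := by
      conv_lhs => rw [hXM]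
      rw [Finset.sum_union hdM, sum_nb_union_right _ hdM, sum_nb_union_right _ hdM,
        sum_nb_comm (A ∩ X) M]
      ring
    have s2 : ∑ p ∈ X, nb I p = ∑ p ∈ A ∩ X, nb I p + ∑ p ∈ M, nb I p := by
      conv_lhs => rw [hXM]
      rw [Finset.sum_union hdM]
    have s3 : ∑ p ∈ M, nb (A ∩ X) p + ∑ p ∈ M, nb I p ≤ ∑ p ∈ M, nb A p := by
      rw [← Finset.sum_add_distrib]
      refine Finset.sum_le_sum fun p _ => ?_
      have hd : Disjoint (A ∩ X) I := (hX.mono_right Finset.inter_subset_right).symm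
      rw [← nb_union hd]
      exact nb_mono (Finset.union_subset Finset.inter_subset_left h.sub) p
    have s4 : 0 ≤ ∑ p ∈ M, nb I p := Finset.sum_nonneg fun p _ => nb_nonneg _ _
    have s5 : 0 ≤ ∑ p ∈ A ∩ X, nb I p := Finset.sum_nonneg fun p _ => nb_nonneg _ _
    have s6 : 0 ≤ ∑ p ∈ M, nb (A ∩ X) p := Finset.sum_nonneg fun p _ => nb_nonneg _ _
    have s7 : ∑ p ∈ A ∩ X, nb I p + ∑ p ∈ A ∩ X, nb X p ≤ 4 * (A ∩ X).card := by
      rw [← Finset.sum_add_distrib]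
      have : ∑ p ∈ A ∩ X, (nb I p + nb X p) ≤ (A ∩ X).card • (4 : ℤ) :=
        Finset.sum_le_card_nsmul _ _ _ fun p _ => by
          rw [← nb_union hX]; exact nb_le_four _ _
      simpa [mul_comm] using this
    have s8 : ∑ p ∈ A ∩ X, nb X p = ∑ p ∈ A ∩ X, nb (A ∩ X) p + ∑ p ∈ M, nb (A ∩ X) p := by
      rw [← sum_nb_comm (A ∩ X) M, ← sum_nb_union_right _ hdM, ← hXM]
    have t1 : bd (I ∪ X) (I ∪ X) + bd ((A ∪ M) ∪ Y) ((A ∪ M) ∪ Y) ≤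
        bd I I + bd A A + 3 * bd X (I ∪ X) := by
      have s9 : ∑ p ∈ M, nb I p + ∑ p ∈ M, nb (A ∩ X) p + ∑ p ∈ M, nb M p ≤ 4 * M.card := by
        have : ∑ p ∈ M, (nb I p + nb X p) ≤ M.card • (4 : ℤ) :=
          Finset.sum_le_card_nsmul _ _ _ fun p _ => by
            rw [← nb_union hX]; exact nb_le_four _ _
        rw [Finset.sum_add_distrib] at this
        have e : ∑ p ∈ M, nb X p = ∑ p ∈ M, nb (A ∩ X) p + ∑ p ∈ M, nb M p := by
          conv_lhs => rw [hXM]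
          rw [sum_nb_union_right _ hdM]
        simp only [nsmul_eq_mul] at this
        linarith
      linarith
    have hs : ∑ p ∈ I ∪ X, φ p = ∑ p ∈ I, φ p + ∑ p ∈ X, φ p := Finset.sum_union hX
    have r1 : ((bd (I ∪ X) (I ∪ X) + bd ((A ∪ M) ∪ Y) ((A ∪ M) ∪ Y) : ℤ) : ℝ) ≤
        ((bd I I + bd A A : ℤ) : ℝ) + 3 * ((bd X (I ∪ X) : ℤ) : ℝ) := by exact_mod_cast t1
    have r2 : ((bd (I ∪ X) ((A ∪ M) ∪ Y) : ℤ) : ℝ) ≤ (bd I A : ℤ) + ((bd X (I ∪ X) : ℤ) : ℝ) := by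
      exact_mod_cast e4
    have n0 : (0 : ℝ) ≤ ((bd X (I ∪ X) : ℤ) : ℝ) := by exact_mod_cast bd_nonneg _ _
    rw [hs, Int.cast_add] at hle
    have q1 := mul_le_mul_of_nonneg_left r1 h.ha.le
    have q2 := mul_le_mul_of_nonneg_left r2 h.hb.le
    have q3 : a * (3 * ((bd X (I ∪ X) : ℤ) : ℝ)) + b * ((bd X (I ∪ X) : ℤ) : ℝ) ≤
        3 * ((bd X (I ∪ X) : ℤ) : ℝ) := by
      have : 3 * a + b ≤ 3 := by linarith [h.hab, h.hb]
      nlinarith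
    unfold phaseEnergy at hle
    linarith
  · rw [hAM]
    exact (Finset.union_subset_union_left h.sub).trans Finset.subset_union_left
  · rw [Finset.card_union_of_disjoint hY, Finset.card_union_of_disjoint hdAM,
      Finset.card_union_of_disjoint hX, hYc]
    have : X.card = (A ∩ X).card + M.card := by
      rw [← Finset.card_union_of_disjoint hdM, ← hXM]
    omega

/-- Removing a set `X` of cells from `I`. -/
lemma Opt.remove (h : Opt a b δ φ I A) {X : Finset Pt} (hX : X ⊆ I) :
    -(δ * ((∑ p ∈ X, φ p : ℤ) : ℝ)) ≤ 2 * ((∑ p ∈ X, nb (I \ X) p : ℤ) : ℝ) := by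
  have hdI : Disjoint (I \ X) X := Finset.sdiff_disjoint
  have hdA : Disjoint (A \ X) X := Finset.sdiff_disjoint
  have hI : (I \ X) ∪ X = I := Finset.sdiff_union_of_subset hX
  have hA : (A \ X) ∪ X = A := Finset.sdiff_union_of_subset (hX.trans h.sub)
  have hle := h.le (I \ X) (A \ X) (Finset.sdiff_subset_sdiff h.sub subset_rfl) (by
    have e1 := Finset.card_sdiff_add_card_eq_card hX
    have e2 := Finset.card_sdiff_add_card_eq_card (hX.trans h.sub)
    omega)
  have e1 := bd_union_union hdI
  have e2 := bd_union_union hdA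
  have e3 : bd ((I \ X) ∪ X) ((A \ X) ∪ X) = bd (I \ X) (A \ X) + bd X X -
      ∑ p ∈ X, nb (I \ X) p - ∑ p ∈ X, nb (A \ X) p := by
    rw [bd_union_left hdI, bd_union_right hdA, bd_union_right hdA, sum_nb_comm (I \ X) X,
      bd_eq X (A \ X), bd_eq X X]
    ring
  rw [hI] at e1
  rw [hA] at e2
  rw [hI, hA] at e3
  have s1 : ∑ p ∈ X, nb (A \ X) p ≤ bd X X := by
    rw [bd_eq]
    have : ∑ p ∈ X, (nb (A \ X) p + nb X p) ≤ X.card • (4 : ℤ) :=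
      Finset.sum_le_card_nsmul _ _ _ fun p _ => by rw [← nb_union hdA]; exact nb_le_four _ _
    rw [Finset.sum_add_distrib] at this
    simp only [nsmul_eq_mul] at this
    linarith
  have hs : ∑ p ∈ I \ X, φ p = ∑ p ∈ I, φ p - ∑ p ∈ X, φ p := by
    rw [eq_sub_iff_add_eq, ← Finset.sum_union hdI, hI]
  rw [hs, Int.cast_sub] at hle
  set u := ∑ p ∈ X, nb (I \ X) p
  have r1 : ((bd (I \ X) (I \ X) + bd (A \ X) (A \ X) : ℤ) : ℝ) ≤
      ((bd I I + bd A A : ℤ) : ℝ) + 2 * (u : ℝ) := by exact_mod_cast (by omega)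
  have r2 : ((bd (I \ X) (A \ X) : ℤ) : ℝ) ≤ ((bd I A : ℤ) : ℝ) + (u : ℝ) := by
    exact_mod_cast (by omega)
  have q1 := mul_le_mul_of_nonneg_left r1 h.ha.le
  have q2 := mul_le_mul_of_nonneg_left r2 h.hb.le
  have q3 : a * (2 * (u : ℝ)) + b * u = 2 * u := by
    have := h.hab
    linear_combination (u : ℝ) * this
  unfold phaseEnergy at hle
  linarith

/-- A discrete Gronwall argument. -/
lemma eq_zero_of_decay {δ : ℝ} (hδ : 0 < δ) {N : ℕ → ℕ} {R : ℕ}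
    (h : ∀ t : ℕ, 1 ≤ t → δ * (t * N t) ≤ 12 * ((N t : ℝ) - N (t + 1))) {K : ℝ}
    (hK : (N R : ℝ) ≤ K) (hR : 1 ≤ R) (hsmall : Real.exp (-(δ * R ^ 2 / 12)) * K < 1) :
    N (2 * R) = 0 := by
  have step : ∀ j : ℕ, (N (R + j) : ℝ) ≤ Real.exp (-(δ * R / 12)) ^ j * K := by
    intro j
    induction j with
    | zero => simpa using hK
    | succ j ih =>
      have h1 := h (R + j) (by omega)
      have h2 : (N (R + j + 1) : ℝ) ≤ (1 - δ * R / 12) * N (R + j) := by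
        have : δ * (R * N (R + j)) ≤ δ * ((R + j : ℕ) * N (R + j)) := by
          gcongr
          simp
        nlinarith
      have h3 : 1 - δ * R / 12 ≤ Real.exp (-(δ * R / 12)) := by
        have := Real.add_one_le_exp (-(δ * R / 12))
        linarith
      calc (N (R + j + 1) : ℝ) ≤ (1 - δ * R / 12) * N (R + j) := h2
        _ ≤ Real.exp (-(δ * R / 12)) * N (R + j) := by gcongr
        _ ≤ Real.exp (-(δ * R / 12)) * (Real.exp (-(δ * R / 12)) ^ j * K) := by gcongr
        _ = _ := by ring
  have h1 := step R
  rw [← Real.exp_nat_mul] at h1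
  have h2 : (R : ℝ) * (-(δ * R / 12)) = -(δ * R ^ 2 / 12) := by ring
  rw [h2, ← two_mul] at h1
  have h3 : (N (2 * R) : ℝ) < 1 := h1.trans_lt hsmall
  exact_mod_cast Nat.lt_one_iff.1 (by exact_mod_cast h3)

lemma Opt.decay_inside (h : Opt a b δ φ I A) (hs : Sgn I₀ φ) {R : ℕ} {K : ℝ}
    (hK : (I₀.card : ℝ) ≤ K) (hR : 1 ≤ R) (hsmall : Real.exp (-(δ * R ^ 2 / 12)) * K < 1)
    {p : Pt} (hp : 2 * R ≤ φ p) : p ∈ I := by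
  set X : ℕ → Finset Pt := fun t => (I₀ \ I).filter fun p => (t : ℤ) ≤ φ p with hX
  have hp0 : p ∈ I₀ := by
    by_contra hh
    have := hs.neg hh
    omega
  have := eq_zero_of_decay h.hδ (N := fun t => (X t).card) (R := R) (K := K) ?_ ?_ hR hsmall
  · by_contra hh
    rw [Finset.card_eq_zero] at this
    have hmem : p ∈ X (2 * R) := by simp [hX, hp0, hh, hp]
    rw [this] at hmem
    simp at hmem
  · intro t ht
    have hd : Disjoint I (X t) := by
      rw [Finset.disjoint_left]
      intro q hq hq'
      simp only [hX, Finset.mem_filter, Finset.mem_sdiff] at hq'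
      tauto
    have h1 := h.fill hd
    have h2 : (((X t).card * t : ℤ)) ≤ ∑ p ∈ X t, φ p := by
      have : (X t).card • (t : ℤ) ≤ ∑ p ∈ X t, φ p :=
        Finset.card_nsmul_le_sum _ _ _ fun q hq => by
          simp only [hX, Finset.mem_filter] at hq
          exact hq.2
      simpa using this
    have hsub : X (t + 1) ⊆ X t := by
      intro q hq
      simp only [hX, Finset.mem_filter] at hq ⊢
      exact ⟨hq.1, by omega⟩
    have h3 : bd (X t) (I ∪ X t) ≤ 4 * ((X t).card - (X (t + 1)).card) := by
      refine sum_le_four_mul_card (fun q _ => ?_) (fun q _ hq' => ?_) hsub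
      · have := nb_nonneg (I ∪ X t) q
        omega
      · rw [nb_eq_four fun r hr => ?_]
        · simp
        simp only [hX, Finset.mem_filter, Finset.mem_sdiff, Finset.mem_union] at hq' ⊢
        have hr0 : r ∈ I₀ := hs.mem_of_lt hq'.1.1 (by omega)
        have := hs.sub_le hq'.1.1 hr0
        by_cases hrI : r ∈ I
        · exact Or.inl hrI
        · exact Or.inr ⟨⟨hr0, hrI⟩, by omega⟩
    have h2' : ((X t).card * t : ℝ) ≤ ((∑ p ∈ X t, φ p : ℤ) : ℝ) := by exact_mod_cast h2
    have h3' : ((bd (X t) (I ∪ X t) : ℤ) : ℝ) ≤ 4 * ((X t).card - (X (t + 1)).card) := by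
      exact_mod_cast h3
    have h4 := mul_le_mul_of_nonneg_left h2' h.hδ.le
    nlinarith
  · refine le_trans ?_ hK
    exact_mod_cast Finset.card_le_card ((Finset.filter_subset _ _).trans Finset.sdiff_subset)

lemma Opt.decay_outside (h : Opt a b δ φ I A) (hs : Sgn I₀ φ) {R : ℕ} {K : ℝ}
    (hK : (I.card : ℝ) ≤ K) (hR : 1 ≤ R) (hsmall : Real.exp (-(δ * R ^ 2 / 12)) * K < 1)
    {p : Pt} (hp : p ∈ I) : -(2 * R) < φ p := by
  set X : ℕ → Finset Pt := fun t => (I \ I₀).filter fun p => (t : ℤ) ≤ -φ p with hX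
  have := eq_zero_of_decay h.hδ (N := fun t => (X t).card) (R := R) (K := K) ?_ ?_ hR hsmall
  · by_contra hh
    have hp0 : p ∉ I₀ := fun hp0 => by
      have := hs.pos hp0
      omega
    rw [Finset.card_eq_zero] at this
    have hmem : p ∈ X (2 * R) := by
      simp [hX, hp0, hp]
      omega
    rw [this] at hmem
    simp at hmem
  · intro t ht
    have hd : X t ⊆ I := (Finset.filter_subset _ _).trans Finset.sdiff_subset
    have h1 := h.remove hd
    have h2 : (((X t).card * t : ℤ)) ≤ -∑ p ∈ X t, φ p := by
      have : (X t).card • (t : ℤ) ≤ ∑ p ∈ X t, -φ p :=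
        Finset.card_nsmul_le_sum _ _ _ fun q hq => by
          simp only [hX, Finset.mem_filter] at hq
          exact hq.2
      rw [Finset.sum_neg_distrib] at this
      simpa using this
    have hsub : X (t + 1) ⊆ X t := by
      intro q hq
      simp only [hX, Finset.mem_filter] at hq ⊢
      exact ⟨hq.1, by omega⟩
    have h3 : ∑ p ∈ X t, nb (I \ X t) p ≤ 4 * ((X t).card - (X (t + 1)).card) := by
      refine sum_le_four_mul_card (fun q _ => nb_le_four _ _) (fun q _ hq' => ?_) hsub
      refine (nb_eq_zero fun r hr hrI => ?_).le
      simp only [hX, Finset.mem_filter, Finset.mem_sdiff] at hq' hrI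
      have hr0 : r ∉ I₀ := hs.notMem_of_lt hq'.1.2 (by omega)
      have := hs.le_add hq'.1.2 hr0
      exact hrI.2 ⟨⟨hrI.1, hr0⟩, by omega⟩
    have h2' : ((X t).card * t : ℝ) ≤ -((∑ p ∈ X t, φ p : ℤ) : ℝ) := by exact_mod_cast h2
    have h3' : ((∑ p ∈ X t, nb (I \ X t) p : ℤ) : ℝ) ≤ 4 * ((X t).card - (X (t + 1)).card) := by
      exact_mod_cast h3
    have h4 := mul_le_mul_of_nonneg_left h2' h.hδ.le
    have h5 : (0 : ℝ) ≤ (X t).card - (X (t + 1)).card := by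
      have := Finset.card_le_card hsub
      rw [sub_nonneg]
      exact_mod_cast this
    nlinarith
  · refine le_trans ?_ hK
    exact_mod_cast Finset.card_le_card ((Finset.filter_subset _ _).trans Finset.sdiff_subset)

end Decay

/-! ### Staircase sets -/

/-- Finite staircase sets. -/
structure Stair (I₀ : Finset Pt) : Prop where
  conn : ∀ p ∈ I₀, ∀ q ∈ I₀, Relation.ReflTransGen (fun a b => b ∈ I₀ ∧ d1 a b = 1) p q
  hconv : ∀ x x' s y, (x, y) ∈ I₀ → (x', y) ∈ I₀ → x ≤ s → s ≤ x' → (s, y) ∈ I₀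
  vconv : ∀ x y y' s, (x, y) ∈ I₀ → (x, y') ∈ I₀ → y ≤ s → s ≤ y' → (x, s) ∈ I₀

lemma conn_im {I₀ : Finset Pt} {g : Pt ≃ Pt} (hg : IsIso g)
    (h : ∀ p ∈ I₀, ∀ q ∈ I₀, Relation.ReflTransGen (fun a b => b ∈ I₀ ∧ d1 a b = 1) p q) :
    ∀ p ∈ im g I₀, ∀ q ∈ im g I₀,
      Relation.ReflTransGen (fun a b => b ∈ im g I₀ ∧ d1 a b = 1) p q := by
  intro p hp q hq
  have := (h _ (mem_im.1 hp) _ (mem_im.1 hq)).lift (p := fun a b => b ∈ im g I₀ ∧ d1 a b = 1) g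
    fun a b hab => ⟨by simpa [mem_im] using hab.1, by rw [hg]; exact hab.2⟩
  rwa [Function.onFun, g.apply_symm_apply, g.apply_symm_apply] at this

@[simp] lemma mem_im_flipY {S : Finset Pt} {x y : ℤ} : (x, y) ∈ im flipY S ↔ (x, -y) ∈ S := mem_im
@[simp] lemma mem_im_flipX {S : Finset Pt} {x y : ℤ} : (x, y) ∈ im flipX S ↔ (-x, y) ∈ S := mem_im
@[simp] lemma mem_im_swapXY {S : Finset Pt} {x y : ℤ} : (x, y) ∈ im swapXY S ↔ (y, x) ∈ S := mem_im
@[simp] lemma flipY_symm_apply (x y : ℤ) : flipY.symm (x, y) = (x, -y) := rfl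
@[simp] lemma flipX_symm_apply (x y : ℤ) : flipX.symm (x, y) = (-x, y) := rfl

section Stair

variable {I₀ : Finset Pt}

lemma Stair.flipY (h : Stair I₀) : Stair (im flipY I₀) where
  conn := conn_im isIso_flipY h.conn
  hconv x x' s y h1 h2 h3 h4 := by
    rw [mem_im_flipY] at h1 h2 ⊢
    exact h.hconv _ _ _ _ h1 h2 h3 h4
  vconv x y y' s h1 h2 h3 h4 := by
    rw [mem_im_flipY] at h1 h2 ⊢
    exact h.vconv _ _ _ _ h2 h1 (by omega) (by omega)

lemma Stair.flipX (h : Stair I₀) : Stair (im flipX I₀) where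
  conn := conn_im isIso_flipX h.conn
  hconv x x' s y h1 h2 h3 h4 := by
    rw [mem_im_flipX] at h1 h2 ⊢
    exact h.hconv _ _ _ _ h2 h1 (by omega) (by omega)
  vconv x y y' s h1 h2 h3 h4 := by
    rw [mem_im_flipX] at h1 h2 ⊢
    exact h.vconv _ _ _ _ h1 h2 h3 h4

lemma Stair.swapXY (h : Stair I₀) : Stair (im swapXY I₀) where
  conn := conn_im isIso_swapXY h.conn
  hconv x x' s y h1 h2 h3 h4 := by
    rw [mem_im_swapXY] at h1 h2 ⊢
    exact h.vconv _ _ _ _ h1 h2 h3 h4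
  vconv x y y' s h1 h2 h3 h4 := by
    rw [mem_im_swapXY] at h1 h2 ⊢
    exact h.hconv _ _ _ _ h1 h2 h3 h4

lemma Stair.exists_left (h : Stair I₀) {o o' : Pt} (ho : o ∈ I₀) (ho' : o' ∈ I₀) {s m : ℤ}
    (h1 : o.1 < s) (h2 : m ≤ o.2) (h3 : s ≤ o'.1) (hcol : ∀ y, m ≤ y → (s, y) ∉ I₀) :
    ∃ x < s, (x, m) ∈ I₀ := by
  by_contra! hno
  have key : ∀ r, Relation.ReflTransGen (fun a b => b ∈ I₀ ∧ d1 a b = 1) o r →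
      r ∈ I₀ ∧ r.1 < s ∧ m ≤ r.2 := by
    intro r hr
    induction hr with
    | refl => exact ⟨ho, h1, h2⟩
    | tail _ hstep ih =>
      rename_i u v _
      obtain ⟨hv, hd⟩ := hstep
      obtain ⟨hu, hu1, hu2⟩ := ih
      unfold d1 at hd
      refine ⟨hv, ?_, ?_⟩
      · by_contra hh
        have e : v = (s, u.2) := by ext <;> simp only <;> omega
        exact hcol u.2 hu2 (e ▸ hv)
      · by_contra hh
        have e : u = (u.1, m) := Prod.ext rfl (by simp only; omega)
        exact hno u.1 hu1 (e ▸ hu)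
  have := (key o' (h.conn o ho o' ho')).2.1
  omega

/-- The upper envelope of a staircase set has no valley. -/
lemma Stair.no_valley (h : Stair I₀) {o o' : Pt} (ho : o ∈ I₀) (ho' : o' ∈ I₀) {s m : ℤ}
    (h1 : o.1 ≤ s) (h2 : s ≤ o'.1) (hm : m ≤ o.2) (hm' : m ≤ o'.2) :
    ∃ y, m ≤ y ∧ (s, y) ∈ I₀ := by
  by_contra! hno
  rcases eq_or_lt_of_le h1 with e | e1
  · subst e; exact hno _ hm ho
  rcases eq_or_lt_of_le h2 with e | e2
  · subst e; exact hno _ hm' ho'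
  obtain ⟨x, hx, hxI⟩ := h.exists_left ho ho' e1 hm h2 hno
  obtain ⟨x', hx', hxI'⟩ := h.flipX.exists_left (o := (-o'.1, o'.2)) (o' := (-o.1, o.2))
    (s := -s) (m := m) (by simpa using ho') (by simpa using ho) (by simpa using e2) hm'
    (by simpa using h1) (fun y hy => by simpa using hno y hy)
  rw [mem_im_flipX] at hxI'
  exact hno m le_rfl (h.hconv _ _ _ _ hxI hxI' hx.le (by omega))

lemma Stair.no_hill (h : Stair I₀) {o o' : Pt} (ho : o ∈ I₀) (ho' : o' ∈ I₀) {s m : ℤ}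
    (h1 : o.1 ≤ s) (h2 : s ≤ o'.1) (hm : o.2 ≤ m) (hm' : o'.2 ≤ m) :
    ∃ y, y ≤ m ∧ (s, y) ∈ I₀ := by
  obtain ⟨y, hy, hy'⟩ := h.flipY.no_valley (o := (o.1, -o.2)) (o' := (o'.1, -o'.2)) (s := s)
    (m := -m) (by simpa using ho) (by simpa using ho') h1 h2 (by simpa using hm)
    (by simpa using hm')
  exact ⟨-y, by omega, by simpa using hy'⟩

/-- At a point outside a staircase set, one of the four closed quadrants misses the set. -/
lemma Stair.free_quadrant (h : Stair I₀) {c : Pt} (hc : c ∉ I₀) :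
    (∀ o ∈ I₀, ¬ (c.1 ≤ o.1 ∧ c.2 ≤ o.2)) ∨ (∀ o ∈ I₀, ¬ (o.1 ≤ c.1 ∧ c.2 ≤ o.2)) ∨
    (∀ o ∈ I₀, ¬ (c.1 ≤ o.1 ∧ o.2 ≤ c.2)) ∨ (∀ o ∈ I₀, ¬ (o.1 ≤ c.1 ∧ o.2 ≤ c.2)) := by
  by_contra! hh
  obtain ⟨⟨o1, h1, h1'⟩, ⟨o2, h2, h2'⟩, ⟨o3, h3, h3'⟩, ⟨o4, h4, h4'⟩⟩ := hh
  obtain ⟨y, hy, hyI⟩ := h.no_valley h2 h1 h2'.1 h1'.1 h2'.2 h1'.2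
  obtain ⟨y', hy', hyI'⟩ := h.no_hill h4 h3 h4'.1 h3'.1 h4'.2 h3'.2
  exact hc (h.vconv _ _ _ _ hyI' hyI hy' hy)

end Stair

/-! ### The standing assumptions, invariant under the lattice symmetries -/

/-- The properties of the minimizer `(I, A)` and of the initial datum `I₀` which are used below;
`R` is the decay scale, `ℓ` a lower bound for the lengths of the extreme slices of `I₀`, and `D` an
upper bound for the diameter of `I₀`. -/
structure Setup (a b δ : ℝ) (φ : Pt → ℤ) (I A I₀ : Finset Pt) (R ℓ D : ℤ) : Prop where
  opt : Opt a b δ φ I A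
  sgn : Sgn I₀ φ
  stair : Stair I₀
  spot : ∃ w ∉ A, 2 ≤ nb A w
  din : ∀ p, 2 * R ≤ φ p → p ∈ I
  dout : ∀ p ∈ I, -(2 * R) < φ p
  bot : ∃ y x₁ x₂, (∀ p ∈ I₀, y ≤ p.2) ∧ (∀ j, (j, y) ∈ I₀ ↔ x₁ ≤ j ∧ j ≤ x₂) ∧ ℓ ≤ x₂ - x₁ + 1
  top : ∃ y x₁ x₂, (∀ p ∈ I₀, p.2 ≤ y) ∧ (∀ j, (j, y) ∈ I₀ ↔ x₁ ≤ j ∧ j ≤ x₂) ∧ ℓ ≤ x₂ - x₁ + 1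
  left : ∃ x y₁ y₂, (∀ p ∈ I₀, x ≤ p.1) ∧ (∀ j, (x, j) ∈ I₀ ↔ y₁ ≤ j ∧ j ≤ y₂) ∧ ℓ ≤ y₂ - y₁ + 1
  right : ∃ x y₁ y₂, (∀ p ∈ I₀, p.1 ≤ x) ∧ (∀ j, (x, j) ∈ I₀ ↔ y₁ ≤ j ∧ j ≤ y₂) ∧ ℓ ≤ y₂ - y₁ + 1
  diam : ∀ p ∈ I₀, ∀ q ∈ I₀, |p.1 - q.1| ≤ D ∧ |p.2 - q.2| ≤ D
  R_pos : 1 ≤ R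
  ℓ_large : 100 * R ≤ ℓ

section Setup

variable {a b δ : ℝ} {φ : Pt → ℤ} {I A I₀ : Finset Pt} {R ℓ D : ℤ}

lemma spot_im {g : Pt ≃ Pt} (hg : IsIso g) (h : ∃ w ∉ A, 2 ≤ nb A w) :
    ∃ w ∉ im g A, 2 ≤ nb (im g A) w := by
  obtain ⟨w, hw, hn⟩ := h
  exact ⟨g w, by simpa [mem_im] using hw, by rwa [nb_im hg]⟩

lemma Setup.flipY (h : Setup a b δ φ I A I₀ R ℓ D) :
    Setup a b δ (fun p => φ (flipY.symm p)) (im flipY I) (im flipY A) (im flipY I₀) R ℓ D where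
  opt := h.opt.im isIso_flipY
  sgn := h.sgn.im isIso_flipY
  stair := h.stair.flipY
  spot := spot_im isIso_flipY h.spot
  din p hp := mem_im.2 (h.din _ hp)
  dout p hp := h.dout _ (mem_im.1 hp)
  bot := by
    obtain ⟨y, x₁, x₂, h1, h2, h3⟩ := h.top
    refine ⟨-y, x₁, x₂, ?_, ?_, h3⟩
    · rintro ⟨u, v⟩ hp
      have := h1 _ (mem_im_flipY.1 hp)
      simp only at this ⊢
      omega
    · intro j; rw [mem_im_flipY, neg_neg, h2]
  top := by
    obtain ⟨y, x₁, x₂, h1, h2, h3⟩ := h.bot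
    refine ⟨-y, x₁, x₂, ?_, ?_, h3⟩
    · rintro ⟨u, v⟩ hp
      have := h1 _ (mem_im_flipY.1 hp)
      simp only at this ⊢
      omega
    · intro j; rw [mem_im_flipY, neg_neg, h2]
  left := by
    obtain ⟨x, y₁, y₂, h1, h2, h3⟩ := h.left
    refine ⟨x, -y₂, -y₁, ?_, ?_, by omega⟩
    · rintro ⟨u, v⟩ hp
      have := h1 _ (mem_im_flipY.1 hp)
      exact this
    · intro j; rw [mem_im_flipY, h2]; omega
  right := by
    obtain ⟨x, y₁, y₂, h1, h2, h3⟩ := h.right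
    refine ⟨x, -y₂, -y₁, ?_, ?_, by omega⟩
    · rintro ⟨u, v⟩ hp
      have := h1 _ (mem_im_flipY.1 hp)
      exact this
    · intro j; rw [mem_im_flipY, h2]; omega
  diam := by
    rintro ⟨x, y⟩ hp ⟨x', y'⟩ hq
    have := h.diam _ (mem_im_flipY.1 hp) _ (mem_im_flipY.1 hq)
    simp only at this ⊢
    refine ⟨this.1, ?_⟩
    rw [← abs_neg]
    convert this.2 using 2
    ring
  R_pos := h.R_pos
  ℓ_large := h.ℓ_large

lemma Setup.swapXY (h : Setup a b δ φ I A I₀ R ℓ D) :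
    Setup a b δ (fun p => φ (swapXY.symm p)) (im swapXY I) (im swapXY A) (im swapXY I₀) R ℓ D where
  opt := h.opt.im isIso_swapXY
  sgn := h.sgn.im isIso_swapXY
  stair := h.stair.swapXY
  spot := spot_im isIso_swapXY h.spot
  din p hp := mem_im.2 (h.din _ hp)
  dout p hp := h.dout _ (mem_im.1 hp)
  bot := by
    obtain ⟨y, x₁, x₂, h1, h2, h3⟩ := h.left
    refine ⟨y, x₁, x₂, ?_, fun j => by rw [mem_im_swapXY, h2], h3⟩
    rintro ⟨u, v⟩ hp
    exact h1 _ (mem_im_swapXY.1 hp)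
  top := by
    obtain ⟨y, x₁, x₂, h1, h2, h3⟩ := h.right
    refine ⟨y, x₁, x₂, ?_, fun j => by rw [mem_im_swapXY, h2], h3⟩
    rintro ⟨u, v⟩ hp
    exact h1 _ (mem_im_swapXY.1 hp)
  left := by
    obtain ⟨y, x₁, x₂, h1, h2, h3⟩ := h.bot
    refine ⟨y, x₁, x₂, ?_, fun j => by rw [mem_im_swapXY, h2], h3⟩
    rintro ⟨u, v⟩ hp
    exact h1 _ (mem_im_swapXY.1 hp)
  right := by
    obtain ⟨y, x₁, x₂, h1, h2, h3⟩ := h.top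
    refine ⟨y, x₁, x₂, ?_, fun j => by rw [mem_im_swapXY, h2], h3⟩
    rintro ⟨u, v⟩ hp
    exact h1 _ (mem_im_swapXY.1 hp)
  diam := by
    rintro ⟨x, y⟩ hp ⟨x', y'⟩ hq
    exact (h.diam _ (mem_im_swapXY.1 hp) _ (mem_im_swapXY.1 hq)).symm
  R_pos := h.R_pos
  ℓ_large := h.ℓ_large

lemma Setup.flipX (h : Setup a b δ φ I A I₀ R ℓ D) :
    Setup a b δ (fun p => φ (flipX.symm p)) (im flipX I) (im flipX A) (im flipX I₀) R ℓ D := by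
  have := h.swapXY.flipY.swapXY
  have e : ∀ S, im BEG.swapXY (im BEG.flipY (im BEG.swapXY S)) = im BEG.flipX S := by
    intro S
    ext ⟨x, y⟩
    simp
  simp only [e] at this
  exact this

/-- Columns of `I₀` starting near the bottom reach up to height `ℓ`. -/
lemma Setup.fat (h : Setup a b δ φ I A I₀ R ℓ D) {y₀ x y y' : ℤ} (hy₀ : ∀ p ∈ I₀, y₀ ≤ p.2)
    (hp : (x, y) ∈ I₀) (h1 : y ≤ y') (h2 : y' ≤ y₀ + ℓ - 1) : (x, y') ∈ I₀ := by
  obtain ⟨xl, l₁, l₂, hl1, hl2, hl3⟩ := h.left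
  obtain ⟨xr, r₁, r₂, hr1, hr2, hr3⟩ := h.right
  have hℓ := h.ℓ_large
  have hR := h.R_pos
  have ml : (xl, l₂) ∈ I₀ := (hl2 _).2 (by omega)
  have ml' : (xl, l₁) ∈ I₀ := (hl2 _).2 (by omega)
  have mr : (xr, r₂) ∈ I₀ := (hr2 _).2 (by omega)
  have mr' : (xr, r₁) ∈ I₀ := (hr2 _).2 (by omega)
  have := hy₀ _ ml'
  have := hy₀ _ mr'
  simp only at *
  obtain ⟨z, hz, hz'⟩ := h.stair.no_valley ml mr (s := x) (m := y') (hl1 _ hp) (hr1 _ hp)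
    (by simp only; omega) (by simp only; omega)
  exact h.stair.vconv _ _ _ _ hp hz' h1 hz

lemma Sgn.le_of_rect (h : Sgn I₀ φ) {l r d u : ℤ}
    (hrect : ∀ x y, l ≤ x → x ≤ r → d ≤ y → y ≤ u → (x, y) ∈ I₀) {x y n : ℤ} (hn : 1 ≤ n)
    (h1 : l + n ≤ x + 1) (h2 : x + n ≤ r + 1) (h3 : d + n ≤ y + 1) (h4 : y + n ≤ u + 1) :
    n ≤ φ (x, y) := by
  refine h.le_of_ball hn fun q hq => ?_
  simp only [d1] at hq
  exact hrect q.1 q.2 (by omega) (by omega) (by omega) (by omega)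

lemma Setup.low (h : Setup a b δ φ I A I₀ R ℓ D) {y₀ : ℤ} (hy₀ : ∀ p ∈ I₀, y₀ ≤ p.2) :
    ∀ p ∈ I, y₀ ≤ p.2 := by
  intro p hp
  obtain ⟨c, hc, hlow, hright⟩ := exists_lowest_right ⟨p, hp⟩
  have h1 := h.opt.lowest_nonneg hc hlow hright
  have hcI : c ∈ I₀ := by
    by_contra hh
    have := h.sgn.neg hh
    omega
  exact (hy₀ _ hcI).trans (hlow p hp)

end Setup

/-! ### The profile of `I` below a solid block -/

lemma card_le_nb {S T : Finset Pt} {p : Pt} (hS : S ⊆ T) (h : ∀ q ∈ S, d1 p q = 1) :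
    (S.card : ℤ) ≤ nb T p := by
  have h1 : nb S p = S.card := by
    rw [nb, Finset.sum_congr rfl fun q hq => by rw [adj, if_pos (h q hq)]]
    simp
  exact h1 ▸ nb_mono hS p

lemma one_le_nb {T : Finset Pt} {p q : Pt} (hq : q ∈ T) (h1 : d1 p q = 1) : 1 ≤ nb T p := by
  have := card_le_nb (S := {q}) (T := T) (p := p) (by simpa using hq) (by simpa using h1)
  simpa using this

lemma two_le_nb {T : Finset Pt} {p q r : Pt} (hq : q ∈ T) (hr : r ∈ T) (h1 : d1 p q = 1)
    (h2 : d1 p r = 1) (hne : q ≠ r) : 2 ≤ nb T p := by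
  have := card_le_nb (S := {q, r}) (T := T) (p := p) (by simp [Finset.insert_subset_iff, hq, hr])
    (by simp [h1, h2])
  rwa [Finset.card_pair hne] at this

lemma three_le_nb {T : Finset Pt} {x y : ℤ} (h1 : (x - 1, y) ∈ T) (h2 : (x + 1, y) ∈ T)
    (h3 : (x, y + 1) ∈ T) : 3 ≤ nb T (x, y) := by
  have := nb_eq T (x, y)
  dsimp only at this
  rw [ind_of_mem h1, ind_of_mem h2, ind_of_mem h3] at this
  have := ind_nonneg T (x, y - 1)
  omega

lemma nb_eq_four_of {T : Finset Pt} {x y : ℤ} (h1 : (x - 1, y) ∈ T) (h2 : (x + 1, y) ∈ T)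
    (h3 : (x, y + 1) ∈ T) (h4 : (x, y - 1) ∈ T) : nb T (x, y) = 4 := by
  have := nb_eq T (x, y)
  dsimp only at this
  rw [ind_of_mem h1, ind_of_mem h2, ind_of_mem h3, ind_of_mem h4] at this
  omega

/-- Above the profile `β`, the columns `L, …, U` are filled with points of `I` up to the row `y₀`;
the point just below the profile is not in `I`. -/
structure Frame (φ : Pt → ℤ) (I : Finset Pt) (L U y₁ y₀ : ℤ) (β : ℤ → ℤ) : Prop where
  pos : ∀ x y, L ≤ x → x ≤ U → y₁ ≤ y → y ≤ y₀ → 1 ≤ φ (x, y)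
  lo : ∀ x, L ≤ x → x ≤ U → y₁ ≤ β x
  hi : ∀ x, L ≤ x → x ≤ U → β x ≤ y₀
  mem : ∀ x y, L ≤ x → x ≤ U → β x ≤ y → y ≤ y₀ → (x, y) ∈ I
  gap : ∀ x, L ≤ x → x ≤ U → (x, β x - 1) ∉ I

section Frame

variable {a b δ : ℝ} {φ : Pt → ℤ} {I A : Finset Pt} {L U y₁ y₀ : ℤ} {β : ℤ → ℤ}

lemma Frame.flipX (f : Frame φ I L U y₁ y₀ β) :
    Frame (fun p => φ (flipX.symm p)) (im flipX I) (-U) (-L) y₁ y₀ fun x => β (-x) where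
  pos x y h1 h2 := f.pos (-x) y (by omega) (by omega)
  lo x h1 h2 := f.lo (-x) (by omega) (by omega)
  hi x h1 h2 := f.hi (-x) (by omega) (by omega)
  mem x y h1 h2 h3 h4 := mem_im_flipX.2 (f.mem (-x) y (by omega) (by omega) h3 h4)
  gap x h1 h2 := by rw [mem_im_flipX]; exact f.gap (-x) (by omega) (by omega)

lemma Frame.quasiconvex (f : Frame φ I L U y₁ y₀ β) (h : Opt a b δ φ I A) {s t u : ℤ}
    (hs : L ≤ s) (hst : s ≤ t) (htu : t ≤ u) (hu : u ≤ U) : β t ≤ max (β s) (β u) := by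
  by_contra! hh
  obtain ⟨hh1, hh2⟩ := max_lt_iff.1 hh
  obtain ⟨m, hm, hmax⟩ := Finset.exists_max_image (Finset.Icc s u) β
    ⟨t, Finset.mem_Icc.2 ⟨hst, htu⟩⟩
  rw [Finset.mem_Icc] at hm
  have hmt := hmax t (Finset.mem_Icc.2 ⟨hst, htu⟩)
  obtain ⟨l, ⟨hl1, hl2⟩, hl3⟩ := Int.exists_greatest_of_bdd (P := fun x => x ≤ m ∧ β x < β m)
    ⟨m, fun z hz => hz.1⟩ ⟨s, hm.1, by omega⟩
  obtain ⟨r, ⟨hr1, hr2⟩, hr3⟩ := Int.exists_least_of_bdd (P := fun x => m ≤ x ∧ β x < β m)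
    ⟨m, fun z hz => hz.1⟩ ⟨u, hm.2, by omega⟩
  have hsl : s ≤ l := hl3 s ⟨hm.1, by omega⟩
  have hru : r ≤ u := hr3 u ⟨hm.2, by omega⟩
  have hlm : l ≠ m := fun e => by rw [e] at hl2; omega
  have hrm : r ≠ m := fun e => by rw [e] at hr2; omega
  have hmy := f.hi m (by omega) (by omega)
  have hly := f.lo l (by omega) (by omega)
  refine h.false_of_capped (α := l + 1) (β := r - 1) (r := β m - 1) (by omega) ?_ ?_ ?_
  · intro x hx hx'
    have e : β x = β m := by
      refine le_antisymm (hmax x (Finset.mem_Icc.2 ⟨by omega, by omega⟩)) ?_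
      by_contra! hlt
      rcases le_total x m with hxm | hxm
      · have := hl3 x ⟨hxm, hlt⟩; omega
      · have := hr3 x ⟨hxm, hlt⟩; omega
    refine ⟨?_, ?_, ?_⟩
    · exact f.mem x _ (by omega) (by omega) (by omega) (by omega)
    · rw [← e]; exact f.gap x (by omega) (by omega)
    · exact f.pos x _ (by omega) (by omega) (by omega) (by omega)
  · exact f.mem _ _ (by omega) (by omega) (by rw [add_sub_cancel_right]; omega) (by omega)
  · exact f.mem _ _ (by omega) (by omega) (by rw [sub_add_cancel]; omega) (by omega)

/-- Where the profile steps up and then stays constant, the step has height one and the profile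
does not go below the lower value. -/
lemma Frame.step (f : Frame φ I L U y₁ y₀ β) (h : Opt a b δ φ I A) (spot : ∃ w ∉ A, 2 ≤ nb A w)
    {x : ℤ} (hx : L ≤ x) (hx' : x + 2 ≤ U) (h1 : β x < β (x + 1)) (h2 : β (x + 2) = β (x + 1)) :
    β x = β (x + 1) - 1 ∧ ∀ x', L ≤ x' → x' ≤ x → β x ≤ β x' := by
  obtain ⟨y, hy⟩ : ∃ y, y = β (x + 1) - 1 := ⟨_, rfl⟩
  have hlo := f.lo x (by omega) (by omega)
  have hhi := f.hi (x + 1) (by omega) (by omega)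
  have zI : (x + 1, y) ∉ I := hy ▸ f.gap (x + 1) (by omega) (by omega)
  have zl : (x, y) ∈ I := f.mem _ _ (by omega) (by omega) (by omega) (by omega)
  have zu : (x + 1, y + 1) ∈ I := f.mem _ _ (by omega) (by omega) (by omega) (by omega)
  have ρu : (x + 2, y + 1) ∈ I := f.mem _ _ (by omega) (by omega) (by omega) (by omega)
  have zφ : 0 < φ (x + 1, y) := f.pos _ _ (by omega) (by omega) (by omega) (by omega)
  have zn : 2 ≤ nb I (x + 1, y) :=
    two_le_nb zl zu (by simp only [d1]; omega) (by simp only [d1]; omega) (by simp)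
  have zA : (x + 1, y) ∈ A := h.mem_of_two_le_nb zφ zI zn
  have ρA : (x + 2, y) ∈ A := by
    by_contra hρ
    refine h.false_of_exchange zφ zI zA zn hρ
      (two_le_nb zA (h.sub ρu) (by simp only [d1]; omega) (by simp only [d1]; omega) (by simp)) ?_
    have e1 := three_le_nb (T := insert (x + 2, y) A) (x := x + 1) (y := y)
      (Finset.mem_insert_of_mem (by simpa using h.sub zl))
      (Finset.mem_insert.2 (Or.inl (by simp; ring))) (Finset.mem_insert_of_mem (h.sub zu))
    have e2 := one_le_nb (p := (x + 2, y)) ρu (by simp only [d1]; omega)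
    omega
  have four : ∀ T, A ⊆ T → (x + 1, y - 1) ∈ T → nb T (x + 1, y) = 4 := fun T hT hd =>
    nb_eq_four_of (hT (by simpa using h.sub zl))
      (hT (by rw [show x + 1 + 1 = x + 2 by ring]; exact ρA)) (hT (h.sub zu)) hd
  have dA : (x + 1, y - 1) ∉ A := by
    intro hd
    obtain ⟨w, hw, hwn⟩ := spot
    refine h.false_of_exchange zφ zI zA zn hw hwn ?_
    rw [four _ (Finset.subset_insert _ _) (Finset.mem_insert_of_mem hd)]
    exact (sub_self (4 : ℤ)).le.trans (nb_nonneg _ _)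
  have nod : 2 ≤ nb A (x + 1, y - 1) → False := fun hn =>
    h.false_of_exchange zφ zI zA zn dA hn (by
      rw [four _ (Finset.subset_insert _ _) (Finset.mem_insert_self _ _)]
      exact (sub_self (4 : ℤ)).le.trans (nb_nonneg _ _))
  have hxy : β x = y := by
    by_contra hne
    have : (x, y - 1) ∈ I := f.mem _ _ (by omega) (by omega) (by omega) (by omega)
    exact nod (two_le_nb (h.sub this) zA (by simp only [d1]; omega) (by simp only [d1]; omega)
      (by simp))
  refine ⟨by omega, fun x' hx1 hx2 => ?_⟩
  by_contra! hlt
  obtain ⟨l, ⟨hl1, hl2⟩, hl3⟩ := Int.exists_greatest_of_bdd (P := fun j => j ≤ x ∧ β j < y)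
    ⟨x, fun z hz => hz.1⟩ ⟨x', hx2, by omega⟩
  have hx'l := hl3 x' ⟨hx2, by omega⟩
  have hlx : l ≠ x := fun e => by rw [e] at hl2; omega
  have hly := f.lo l (by omega) (by omega)
  have flat : ∀ j, l < j → j ≤ x → β j = y := fun j hj hj' => by
    have := f.quasiconvex h (s := l) (t := j) (u := x) (by omega) hj.le hj' (by omega)
    by_contra hne
    have := hl3 j ⟨hj', by omega⟩
    omega
  have mI : (l + 1, y - 1) ∉ I := by
    rw [← flat (l + 1) (by omega) (by omega)]
    exact f.gap _ (by omega) (by omega)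
  have ml : (l, y - 1) ∈ I := f.mem _ _ (by omega) (by omega) (by omega) (by omega)
  have up : ∀ j, l < j → j ≤ x → (j, y) ∈ I := fun j hj hj' =>
    f.mem _ _ (by omega) (by omega) (flat j hj hj').le (by omega)
  have mu : (l + 1, y) ∈ I := up _ (by omega) (by omega)
  have mφ : 0 < φ (l + 1, y - 1) := f.pos _ _ (by omega) (by omega) (by omega) (by omega)
  have mn : 2 ≤ nb I (l + 1, y - 1) :=
    two_le_nb ml mu (by simp only [d1]; omega) (by simp only [d1]; omega) (by simp)
  have mA : (l + 1, y - 1) ∈ A := h.mem_of_two_le_nb mφ mI mn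
  obtain ⟨j, ⟨hj1, hj2⟩, hj3⟩ := Int.exists_least_of_bdd
    (P := fun j => l + 1 ≤ j ∧ (j, y - 1) ∉ A) ⟨l + 1, fun z hz => hz.1⟩ ⟨x + 1, by omega, dA⟩
  have hjx : j ≤ x + 1 := hj3 _ ⟨by omega, dA⟩
  have hjl : j ≠ l + 1 := fun e => hj2 (e ▸ mA)
  have run : ∀ i, l + 1 ≤ i → i < j → (i, y - 1) ∈ A := fun i hi hi' => by
    by_contra hh
    have := hj3 i ⟨hi, hh⟩
    omega
  have wl := run (j - 1) (by omega) (by omega)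
  by_cases hjx' : j = x + 1
  · subst hjx'
    exact nod (two_le_nb wl zA (by simp only [d1]; omega) (by simp only [d1]; omega) (by simp))
  · have wu := up j (by omega) (by omega)
    refine h.false_of_exchange mφ mI mA mn hj2
      (two_le_nb wl (h.sub wu) (by simp only [d1]; omega) (by simp only [d1]; omega) (by simp)) ?_
    have e1 := three_le_nb (T := insert (j, y - 1) A) (x := l + 1) (y := y - 1)
      (Finset.mem_insert_of_mem (by simpa using h.sub ml))
      (by
        by_cases e : j = l + 1 + 1
        · rw [e]; exact Finset.mem_insert_self _ _
        · exact Finset.mem_insert_of_mem (run _ (by omega) (by omega)))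
      (Finset.mem_insert_of_mem (by simpa using h.sub mu))
    have e2 := one_le_nb (p := (j, y - 1)) wu (by simp only [d1]; omega)
    omega

/-- Away from the right end of the frame, the profile exceeds values on its left by at most one. -/
lemma Frame.le_of_left (f : Frame φ I L U y₁ y₀ β) (h : Opt a b δ φ I A)
    (spot : ∃ w ∉ A, 2 ≤ nb A w) {s t : ℤ} (hs : L ≤ s) (hst : s < t) (ht : t ≤ U)
    (hU : y₀ - y₁ < U - t) : β t ≤ β s + 1 := by
  by_contra! hlt
  have key : ∀ n : ℕ, t + n ≤ U → β t + n ≤ β (t + n) := by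
    intro n
    induction n with
    | zero => simp
    | succ n ih =>
      intro hn
      push_cast at hn ⊢
      have ih := ih (by omega)
      obtain ⟨v, hv⟩ : ∃ v : ℤ, v = t + n := ⟨_, rfl⟩
      rw [← hv] at ih
      rw [← add_assoc, ← add_assoc, ← hv]
      have hqc := f.quasiconvex h (s := s) (t := v) (u := v + 1) hs (by omega) (by omega) (by omega)
      by_contra! hc
      have heq : β (v + 1) = β v := by omega
      obtain ⟨x, ⟨hx1, hx2⟩, hx3⟩ := Int.exists_greatest_of_bdd
        (P := fun x => x ≤ v ∧ β x < β v) ⟨v, fun z hz => hz.1⟩ ⟨s, by omega, by omega⟩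
      have hsx := hx3 s ⟨by omega, by omega⟩
      have hxv : x ≠ v := fun e => by rw [e] at hx2; omega
      have flat : ∀ i, x < i → i ≤ v → β i = β v := fun i hi hi' => by
        have := f.quasiconvex h (s := x) (t := i) (u := v) (by omega) hi.le hi' (by omega)
        by_contra hne
        have := hx3 i ⟨hi', by omega⟩
        omega
      have e1 := flat (x + 1) (by omega) (by omega)
      have e2 : β (x + 2) = β v := by
        by_cases hxv2 : x + 1 = v
        · rw [show x + 2 = v + 1 by omega, heq]
        · exact flat _ (by omega) (by omega)
      have := f.step h spot (x := x) (by omega) (by omega) (by omega) (by omega)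
      have := this.2 s hs hsx
      omega
  have := key (U - t).toNat (by omega)
  rw [show t + ((U - t).toNat : ℤ) = U by omega] at this
  have := f.hi U (by omega) le_rfl
  have := f.lo t (by omega) (by omega)
  omega

lemma Frame.le_add_one (f : Frame φ I L U y₁ y₀ β) (h : Opt a b δ φ I A)
    (spot : ∃ w ∉ A, 2 ≤ nb A w) {s t : ℤ} (hs : L ≤ s) (hs' : s ≤ U)
    (ht : y₀ - y₁ < t - L) (ht' : y₀ - y₁ < U - t) : β t ≤ β s + 1 := by
  have := f.lo s hs hs'
  have := f.hi s hs hs'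
  rcases lt_trichotomy s t with hst | rfl | hst
  · exact f.le_of_left h spot hs hst (by omega) ht'
  · omega
  · have := f.flipX.le_of_left (h.im isIso_flipX) (spot_im isIso_flipX spot) (s := -s) (t := -t)
      (by omega) (by omega) (by omega) (by omega)
    simpa using this

end Frame

/-! ### The bottom side -/

section Bottom

variable {a b δ : ℝ} {φ : Pt → ℤ} {I A I₀ : Finset Pt} {R ℓ D : ℤ}

lemma exists_frame {L U y₁ y₀ : ℤ} (hpos : ∀ x y, L ≤ x → x ≤ U → y₁ ≤ y → y ≤ y₀ → 1 ≤ φ (x, y))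
    (hlow : ∀ p ∈ I, y₁ ≤ p.2) (htop : ∀ x, L ≤ x → x ≤ U → (x, y₀) ∈ I) :
    ∃ β, Frame φ I L U y₁ y₀ β := by
  choose f hf1 hf2 hf3 using fun x => exists_first_gap I x y₀
  refine ⟨fun x => f x + 1, hpos, fun x h1 h2 => ?_, fun x h1 h2 => ?_,
    fun x y h1 h2 h3 h4 => hf3 x y (by omega) h4,
    fun x h1 h2 => by rw [add_sub_cancel_right]; exact hf2 x⟩
  · by_contra hh
    have := hf1 x
    have := htop x h1 h2
    have := hlow _ this
    have := hlow _ (hf3 x (y₁ - 1) (by omega) (by simp only at *; omega))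
    simp only at this
    omega
  · rcases (hf1 x).lt_or_eq with h | h
    · omega
    · exact absurd (h ▸ htop x h1 h2) (hf2 x)

/-- A lower extreme slice `[x₁, x₂] × {y₀}` of `I₀`. -/
structure Bot (I₀ : Finset Pt) (y₀ x₁ x₂ ℓ : ℤ) : Prop where
  le : ∀ p ∈ I₀, y₀ ≤ p.2
  mem : ∀ j, x₁ ≤ j → j ≤ x₂ → (j, y₀) ∈ I₀
  len : ℓ ≤ x₂ - x₁ + 1

variable {y₀ x₁ x₂ : ℤ}

/-- The profile over the lowest slice stays close to it somewhere. -/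
lemma Setup.exists_near_bot (h : Setup a b δ φ I A I₀ R ℓ D) (hb : Bot I₀ y₀ x₁ x₂ ℓ) :
    ∃ j r, x₁ + 2 * R ≤ j ∧ j ≤ x₂ - 2 * R ∧ r ≤ y₀ + 2 * R ∧
      (∀ y, r ≤ y → y ≤ y₀ + 2 * R → (j, y) ∈ I) ∧ δ * ℓ * ((r - y₀ : ℤ) : ℝ) ≤ 16 := by
  have hR := h.R_pos
  have hℓ := h.ℓ_large
  have hlen := hb.len
  have rect : ∀ x y, x₁ ≤ x → x ≤ x₂ → y₀ ≤ y → y ≤ y₀ + ℓ - 1 → (x, y) ∈ I₀ :=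
    fun x y h1 h2 h3 h4 => h.fat hb.le (hb.mem x h1 h2) h3 h4
  obtain ⟨β, f⟩ := exists_frame (φ := φ) (I := I) (L := x₁ + 2 * R) (U := x₂ - 2 * R) (y₁ := y₀)
    (y₀ := y₀ + 2 * R)
    (fun x y h1 h2 h3 h4 => h.sgn.pos (rect x y (by omega) (by omega) h3 (by omega)))
    (h.low hb.le)
    (fun x h1 h2 => h.din _ (h.sgn.le_of_rect rect (by omega) (by omega) (by omega) (by omega)
      (by omega)))
  obtain ⟨P, hP⟩ : ∃ P, P = x₁ + 5 * R := ⟨_, rfl⟩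
  obtain ⟨Q, hQ⟩ : ∃ Q, Q = x₂ - 5 * R := ⟨_, rfl⟩
  obtain ⟨t₀, ht₀, hmin⟩ := Finset.exists_min_image (Finset.Icc P Q) β
    ⟨P, Finset.mem_Icc.2 ⟨le_rfl, by omega⟩⟩
  rw [Finset.mem_Icc] at ht₀
  have hmin : ∀ t, P ≤ t → t ≤ Q → β t₀ ≤ β t ∧ β t ≤ β t₀ + 1 := fun t h1 h2 =>
    ⟨hmin t (Finset.mem_Icc.2 ⟨h1, h2⟩), f.le_add_one h.opt h.spot (by omega) (by omega) (by omega)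
      (by omega)⟩
  obtain ⟨u, ⟨hu1, hu2⟩, hu3⟩ := Int.exists_least_of_bdd (P := fun t => P ≤ t ∧ β t ≤ β t₀)
    ⟨P, fun z hz => hz.1⟩ ⟨t₀, ht₀.1, le_rfl⟩
  obtain ⟨v, ⟨hv1, hv2⟩, hv3⟩ := Int.exists_greatest_of_bdd (P := fun t => t ≤ Q ∧ β t ≤ β t₀)
    ⟨Q, fun z hz => hz.1⟩ ⟨t₀, ht₀.2, le_rfl⟩
  have hut := hu3 t₀ ⟨ht₀.1, le_rfl⟩
  have hvt := hv3 t₀ ⟨ht₀.2, le_rfl⟩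
  obtain ⟨α, α', m, h1, h2, h3, hflat⟩ : ∃ α α' m, P ≤ α ∧ α' ≤ Q ∧ ℓ ≤ 4 * (α' - α + 1) ∧
      ∀ t, α ≤ t → t ≤ α' → β t = m := by
    by_cases c1 : ℓ ≤ 4 * (u - P)
    · refine ⟨P, u - 1, β t₀ + 1, le_rfl, by omega, by omega, fun t h1 h2 => ?_⟩
      have := hmin t h1 (by omega)
      by_contra hne
      have := hu3 t ⟨h1, by omega⟩
      omega
    by_cases c2 : ℓ ≤ 4 * (Q - v)
    · refine ⟨v + 1, Q, β t₀ + 1, by omega, le_rfl, by omega, fun t h1 h2 => ?_⟩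
      have := hmin t (by omega) h2
      by_contra hne
      have := hv3 t ⟨h2, by omega⟩
      omega
    · refine ⟨u, v, β t₀, hu1, hv1, by omega, fun t h1 h2 => ?_⟩
      have := hmin t (by omega) (by omega)
      have := f.quasiconvex h.opt (s := u) (t := t) (u := v) (by omega) h1 h2 (by omega)
      omega
  have hm1 := f.lo α (by omega) (by omega)
  have hm2 := f.hi α (by omega) (by omega)
  rw [hflat α le_rfl (by omega)] at hm1 hm2
  refine ⟨α, m, by omega, by omega, hm2, fun y hy hy' => f.mem α y (by omega) (by omega)
    (by rw [hflat α le_rfl (by omega)]; exact hy) hy', ?_⟩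
  rcases hm1.eq_or_lt with e | hlt
  · rw [e]; simp
  have key := h.opt.push (α := α) (β := α') (r := m - 1) (d := m - y₀) (by omega) fun x hx hx' => by
    have e := hflat x hx hx'
    refine ⟨?_, ?_, ?_⟩
    · rw [sub_add_cancel]
      exact f.mem _ _ (by omega) (by omega) e.le (by omega)
    · rw [← e]; exact f.gap _ (by omega) (by omega)
    · exact h.sgn.le_of_rect rect (by omega) (by omega) (by omega) (by omega) (by omega)
  have k1 : (0 : ℝ) ≤ ((ind I (α - 1, m - 1) + ind I (α' + 1, m - 1) : ℤ) : ℝ) := by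
    exact_mod_cast add_nonneg (ind_nonneg _ _) (ind_nonneg _ _)
  have k2 : (ℓ : ℝ) * ((m - y₀ : ℤ) : ℝ) ≤ 4 * (((α' - α + 1) * (m - y₀) : ℤ) : ℝ) := by
    have : ℓ * (m - y₀) ≤ 4 * ((α' - α + 1) * (m - y₀)) := by
      rw [← mul_assoc]
      exact mul_le_mul_of_nonneg_right h3 (by omega)
    exact_mod_cast this
  have := mul_le_mul_of_nonneg_left k2 h.opt.hδ.le
  linarith

/-- Near the bottom of `I₀`, over a full block, `φ` is nondecreasing in the vertical variable. -/
lemma Setup.φ_le_up (h : Setup a b δ φ I A I₀ R ℓ D) (hy₀ : ∀ p ∈ I₀, y₀ ≤ p.2) {l r m : ℤ}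
    (rect : ∀ x y, l ≤ x → x ≤ r → m ≤ y → y ≤ y₀ + ℓ - 1 → (x, y) ∈ I₀)
    (hm : m ≤ y₀ + R) {x y : ℤ} (hx : l + 3 * R ≤ x) (hx' : x + 3 * R ≤ r) (hy : m ≤ y)
    (hy' : y < m + 2 * R) : φ (x, y) ≤ φ (x, y + 1) := by
  have hR := h.R_pos
  have hℓ := h.ℓ_large
  have p0 := rect x y (by omega) (by omega) hy (by omega)
  have p1 := rect x (y + 1) (by omega) (by omega) (by omega) (by omega)
  obtain ⟨w, hw, e⟩ := h.sgn.in_exists _ p1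
  by_contra! hlt
  have h2 := h.sgn.in_le _ p0 (x, y₀ - 1) fun hh => by have := hy₀ _ hh; simp at this
  have := hy₀ _ p0
  obtain ⟨w1, w2⟩ := w
  simp only [d1] at e h2 this
  have hw2 : w2 < m := by
    by_contra! hh
    exact hw (rect w1 w2 (by omega) (by omega) hh (by omega))
  have h3 := h.sgn.in_le _ p0 (w1, w2 - 1) fun hh =>
    hw (h.stair.vconv w1 (w2 - 1) m w2 hh (rect w1 m (by omega) (by omega) le_rfl (by omega))
      (by omega) (by omega))
  simp only [d1] at h3
  omega

/-- The lower boundary of `I` over the lowest slice of `I₀`, apart from the ends of the slice, lies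
in the two lowest rows of `I`. -/
lemma Setup.bot_le (h : Setup a b δ φ I A I₀ R ℓ D) (hb : Bot I₀ y₀ x₁ x₂ ℓ)
    (hc₁ : 16 ≤ δ * ℓ * R) (hbig : δ * (16 / (δ * ℓ) + 1) * (18 * R / a) < 2 * a)
    {p : Pt} (hp : p ∈ I) (hp' : (p.1, p.2 - 1) ∉ I) (h1 : x₁ + 5 * R ≤ p.1)
    (h2 : p.1 ≤ x₂ - 5 * R) (h3 : p.2 ≤ y₀ + 2 * R) : ∀ q ∈ I, p.2 ≤ q.2 + 1 := by
  have hR := h.R_pos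
  have hℓ := h.ℓ_large
  have hlen := hb.len
  have hδ := h.opt.hδ
  have ha := h.opt.ha
  have hℓ' : (0 : ℝ) < ℓ := by exact_mod_cast (by omega : (0 : ℤ) < ℓ)
  have hR' : (1 : ℝ) ≤ R := by exact_mod_cast hR
  have hδℓ : 0 < δ * ℓ := by positivity
  obtain ⟨c, hc, hlow, hright⟩ := exists_lowest_right ⟨p, hp⟩
  obtain ⟨m, hm⟩ : ∃ m, m = c.2 := ⟨_, rfl⟩
  rw [← hm] at hlow hright
  suffices p.2 ≤ m + 1 from fun q hq => this.trans (by have := hlow q hq; omega)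
  have hm0 : y₀ ≤ m := hm ▸ h.low hb.le c hc
  obtain ⟨j, r, -, -, hj3, hj4, hj5⟩ := h.exists_near_bot hb
  have hmr : m ≤ r := hlow _ (hj4 r le_rfl hj3)
  have hmC : ((m - y₀ : ℤ) : ℝ) ≤ 16 / (δ * ℓ) := by
    rw [le_div_iff₀ hδℓ]
    have : ((m - y₀ : ℤ) : ℝ) ≤ ((r - y₀ : ℤ) : ℝ) := by exact_mod_cast (by omega)
    nlinarith
  have hmR : m ≤ y₀ + R := by
    have : ((m - y₀ : ℤ) : ℝ) ≤ R := hmC.trans (by rw [div_le_iff₀ hδℓ]; linarith)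
    have : m - y₀ ≤ R := by exact_mod_cast this
    omega
  -- the lowest run of `I`
  obtain ⟨t₁, ⟨ht1, ht2⟩, ht3⟩ := Int.exists_greatest_of_bdd (P := fun t => t ≤ c.1 ∧ (t, m) ∉ I)
    ⟨c.1, fun z hz => hz.1⟩ (by
      obtain ⟨B, hB⟩ := (I.image Prod.fst).bddBelow
      refine ⟨min c.1 (B - 1), by omega, fun hh => ?_⟩
      have := hB (Finset.mem_coe.2 (Finset.mem_image_of_mem Prod.fst hh))
      simp only at this
      omega)
  have run : ∀ i, t₁ + 1 ≤ i → i ≤ c.1 → (i, m) ∈ I := fun i hi hi' => by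
    by_contra hh
    have := ht3 i ⟨hi', hh⟩
    omega
  have ht1' : t₁ ≠ c.1 := fun e => ht2 (by rw [e, hm]; exact hc)
  have hpeel := h.opt.peel hlow hright (t := t₁ + 1) (by omega) run (by simpa using ht2)
  set F := (Finset.Icc (t₁ + 1) c.1).filter fun i => (i, m) ∈ I₀ with hF
  have hsum : (∑ q ∈ I.filter (fun q => q.2 = m ∧ t₁ + 1 ≤ q.1), φ q) ≤ F.card * (m - y₀ + 1) := by
    have e : I.filter (fun q => q.2 = m ∧ t₁ + 1 ≤ q.1) =
        (Finset.Icc (t₁ + 1) c.1).image fun i => (i, m) := by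
      ext ⟨u, v⟩
      simp only [Finset.mem_filter, Finset.mem_image, Finset.mem_Icc, Prod.mk.injEq]
      constructor
      · rintro ⟨hI, rfl, ht⟩
        exact ⟨u, ⟨ht, hright _ hI rfl⟩, rfl, rfl⟩
      · rintro ⟨i, ⟨hi, hi'⟩, rfl, rfl⟩
        exact ⟨run i hi hi', rfl, hi⟩
    rw [e, Finset.sum_image (by intro i _ i' _ hii; simpa using hii)]
    calc ∑ i ∈ Finset.Icc (t₁ + 1) c.1, φ (i, m)
        ≤ ∑ i ∈ Finset.Icc (t₁ + 1) c.1, if (i, m) ∈ I₀ then (m - y₀ + 1) else 0 := by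
          refine Finset.sum_le_sum fun i _ => ?_
          split_ifs with hi
          · have := h.sgn.in_le _ hi (i, y₀ - 1) fun hh => by have := hb.le _ hh; simp at this
            simp only [d1] at this
            omega
          · have := h.sgn.neg hi; omega
      _ = F.card * (m - y₀ + 1) := by
          rw [← Finset.sum_filter, Finset.sum_const, nsmul_eq_mul]
  have hN : 18 * R / a < F.card := by
    by_contra! hh
    have e1 : ((∑ q ∈ I.filter (fun q => q.2 = m ∧ t₁ + 1 ≤ q.1), φ q : ℤ) : ℝ) ≤
        F.card * (((m - y₀ : ℤ) : ℝ) + 1) := by exact_mod_cast hsum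
    have e2 : (F.card : ℝ) * (((m - y₀ : ℤ) : ℝ) + 1) ≤ 18 * R / a * (16 / (δ * ℓ) + 1) := by
      have : (0 : ℝ) ≤ ((m - y₀ : ℤ) : ℝ) := by exact_mod_cast (by omega)
      gcongr
    have := mul_le_mul_of_nonneg_left (e1.trans e2) hδ.le
    nlinarith
  have hFne : F.Nonempty := Finset.card_pos.1 (by
    have : (0 : ℝ) < F.card := lt_trans (by positivity) hN
    exact_mod_cast this)
  obtain ⟨a', ha', hamin⟩ := Finset.exists_min_image F id hFne
  obtain ⟨b', hb', hbmax⟩ := Finset.exists_max_image F id hFne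
  simp only [hF, Finset.mem_filter, Finset.mem_Icc, id] at ha' hb' hamin hbmax
  have hcard : (F.card : ℤ) ≤ b' - a' + 1 := by
    have : F ⊆ Finset.Icc a' b' := fun i hi => by
      simp only [hF, Finset.mem_filter, Finset.mem_Icc] at hi
      exact Finset.mem_Icc.2 ⟨hamin i hi, hbmax i hi⟩
    have := Finset.card_le_card this
    rw [Int.card_Icc] at this
    have := hamin b' hb'
    omega
  have ha1 : a ≤ 1 := by have := h.opt.hab; have := h.opt.hb; linarith
  have hlarge : (18 : ℝ) * R ≤ 18 * R / a := by
    rw [le_div_iff₀ ha]; nlinarith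
  have hlen' : 18 * R < b' - a' + 1 := by
    have : (18 : ℝ) * R < ((b' - a' + 1 : ℤ) : ℝ) :=
      lt_of_le_of_lt hlarge (hN.trans_le (by exact_mod_cast hcard))
    exact_mod_cast this
  -- the block of `I₀` above the run and the slice
  obtain ⟨lo, hlo⟩ : ∃ lo, lo = min a' x₁ := ⟨_, rfl⟩
  obtain ⟨hi, hhi⟩ : ∃ hi, hi = max b' x₂ := ⟨_, rfl⟩
  have row : ∀ x, lo ≤ x → x ≤ hi → (x, m) ∈ I₀ := by
    have e1 : (lo, m) ∈ I₀ := by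
      rcases min_choice a' x₁ with e | e
      · rw [hlo, e]; exact ha'.2
      · rw [hlo, e]; exact h.fat hb.le (hb.mem x₁ le_rfl (by omega)) hm0 (by omega)
    have e2 : (hi, m) ∈ I₀ := by
      rcases max_choice b' x₂ with e | e
      · rw [hhi, e]; exact hb'.2
      · rw [hhi, e]; exact h.fat hb.le (hb.mem x₂ (by omega) le_rfl) hm0 (by omega)
    exact fun x hx hx' => h.stair.hconv _ _ _ _ e1 e2 hx hx'
  have rect : ∀ x y, lo ≤ x → x ≤ hi → m ≤ y → y ≤ y₀ + ℓ - 1 → (x, y) ∈ I₀ :=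
    fun x y h1 h2 h3 h4 => h.fat hb.le (row x h1 h2) h3 h4
  have htop : ∀ x, lo + 2 * R ≤ x → x ≤ hi - 2 * R → (x, m + 2 * R) ∈ I := fun x h1 h2 =>
    h.din _ (h.sgn.le_of_rect rect (by omega) (by omega) (by omega) (by omega) (by omega))
  obtain ⟨β, f⟩ := exists_frame (φ := φ) (I := I) (L := lo + 2 * R) (U := hi - 2 * R) (y₁ := m)
    (y₀ := m + 2 * R)
    (fun x y h1 h2 h3 h4 => h.sgn.pos (rect x y (by omega) (by omega) h3 (by omega))) hlow htop
  obtain ⟨s, hs1, hs2, hs3⟩ : ∃ s, a' + 3 * R ≤ s ∧ s ≤ b' - 3 * R ∧ β s = m := by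
    by_contra! hne
    have hrows : ∀ x, a' + 3 * R ≤ x → x ≤ b' - 3 * R → ∀ y, -(m + 2 * R) ≤ y → ∀ y', y ≤ y' →
        y' ≤ -m → φ (x, -y') ≤ φ (x, -y) := by
      intro x hx hx' y hy y' hyy
      induction y', hyy using Int.leInduction with
      | base => exact fun _ => le_rfl
      | succ n hn ih =>
        intro hn'
        refine le_trans ?_ (ih (by omega))
        have := h.φ_le_up hb.le rect hmR (x := x) (y := -(n + 1)) (by omega) (by omega) (by omega)
          (by omega)
        rwa [show -(n + 1) + 1 = -n by ring] at this
    have hgap : ∀ T : Finset Pt, ∀ x, ∀ s' : Finset ℤ,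
        Flank (-(m + 2 * R)) (-m) (col T x) s' (2 * R + 1) := by
      intro T x s'
      refine Or.inr ?_
      have : packc (-(m + 2 * R)) (-m) (col T x) \ col T x ⊆ Finset.Icc (-(m + 2 * R)) (-m) := by
        intro y hy
        have := card_win_le (yb := -(m + 2 * R)) (yT := -m) (s := col T x) (by omega)
        rw [Finset.mem_sdiff, mem_packc] at hy
        rw [Finset.mem_Icc]
        obtain ⟨hy | hy, hy'⟩ := hy
        · exact absurd hy.1 hy'
        · omega
      have := Finset.card_le_card this
      rw [Int.card_Icc] at this
      omega
    have key := (h.opt.im isIso_flipY).grav_le (α := a' + 3 * R) (β := b' - 3 * R)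
      (yb := -(m + 2 * R)) (yT := -m) (eL := 2 * R + 1) (eR := 2 * R + 1) (by omega) (by omega)
      (by omega)
      (fun x hx hx' => by
        rw [mem_im_flipY, neg_neg]
        exact htop x (by omega) (by omega))
      (fun x hx hx' hh => by
        rw [mem_im_flipY] at hh
        have := hlow _ hh
        simp only at this
        omega)
      (fun x hx hx' y1 hy1 _ _ y y' hy hyy hy' => hrows x hx hx' y (by omega) y' hyy hy')
      (fun S T _ _ => hgap S _ _) (fun S T _ _ => hgap S _ _)
    rw [Finset.filter_true_of_mem] at key
    · rw [Int.card_Icc] at key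
      have e1 : (((b' - 3 * R + 1 - (a' + 3 * R)).toNat : ℕ) : ℝ) =
          ((b' - a' + 1 - 6 * R : ℤ) : ℝ) := by
        have : (((b' - 3 * R + 1 - (a' + 3 * R)).toNat : ℕ) : ℤ) = b' - a' + 1 - 6 * R := by omega
        exact_mod_cast this
      rw [e1] at key
      have e2 : (18 * R / a) * a = 18 * (R : ℝ) := by field_simp
      have e3 : (18 : ℝ) * R / a < ((b' - a' + 1 : ℤ) : ℝ) := hN.trans_le (by exact_mod_cast hcard)
      have e4 := mul_lt_mul_of_pos_right e3 ha
      push_cast at key e4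
      rw [e2] at e4
      nlinarith
    · intro x hx
      rw [Finset.mem_Icc] at hx
      refine Or.inl fun hpk => ?_
      have hβ := f.lo x (by omega) (by omega)
      have hβ' := hne x hx.1 hx.2
      have hx1 : (x, β x - 1) ∉ I := f.gap x (by omega) (by omega)
      have hx2 : (x, m) ∈ I := run x (by omega) (by omega)
      have hβu := f.hi x (by omega) (by omega)
      have h4 : -m ∈ packc (-(m + 2 * R)) (-m) (col (im BEG.flipY I) x) := by
        rw [hpk, mem_col, mem_im_flipY, neg_neg]; exact hx2
      have h5 : -(β x - 1) ∉ packc (-(m + 2 * R)) (-m) (col (im BEG.flipY I) x) := by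
        rw [hpk, mem_col, mem_im_flipY, neg_neg]; exact hx1
      rw [mem_packc] at h4 h5
      rcases h4 with h4 | h4
      · exact h4.2 ⟨by omega, le_rfl⟩
      · exact h5 (Or.inr ⟨by omega, by omega⟩)
  have := f.le_add_one h.opt h.spot (s := s) (t := p.1) (by omega) (by omega) (by omega) (by omega)
  by_contra! hlt
  exact hp' (f.mem _ _ (by omega) (by omega) (by omega) (by omega))

end Bottom

/-! ### Isolated zeros -/

section Isolated

variable {a b δ : ℝ} {φ : Pt → ℤ} {I A I₀ : Finset Pt} {R ℓ D : ℤ}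

/-- The topmost point, leftmost in its row, of the part of `T` in the upper left quadrant at `c`. -/
lemma exists_top_left {T : Finset Pt} {c : Pt} (hc : c ∈ T) :
    ∃ q ∈ T, q.1 ≤ c.1 ∧ c.2 ≤ q.2 ∧ (q.1 - 1, q.2) ∉ T ∧ (q.1, q.2 + 1) ∉ T := by
  obtain ⟨u, hu, hu'⟩ := Finset.exists_max_image (T.filter fun q => q.1 ≤ c.1 ∧ c.2 ≤ q.2) Prod.snd
    ⟨c, by simp [hc]⟩
  obtain ⟨q, hq, hq'⟩ := Finset.exists_min_image
    (T.filter fun q => q.1 ≤ c.1 ∧ c.2 ≤ q.2 ∧ q.2 = u.2) Prod.fst ⟨u, by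
      simp only [Finset.mem_filter] at hu ⊢
      exact ⟨hu.1, hu.2.1, hu.2.2, trivial⟩⟩
  simp only [Finset.mem_filter] at hq hq' hu'
  refine ⟨q, hq.1, hq.2.1, hq.2.2.1, fun hh => ?_, fun hh => ?_⟩
  · have := hq' _ ⟨hh, by simp only; omega, hq.2.2⟩
    simp only at this
    omega
  · have := hu' _ ⟨hh, hq.2.1, by simp only; omega⟩
    simp only at this
    omega

lemma nb_le_two {T : Finset Pt} {q : Pt} (h1 : (q.1 - 1, q.2) ∉ T) (h2 : (q.1, q.2 + 1) ∉ T) :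
    nb T q ≤ 2 := by
  rw [nb_eq, ind_of_notMem h1, ind_of_notMem h2]
  have := ind_le_one T (q.1 + 1, q.2)
  have := ind_le_one T (q.1, q.2 - 1)
  omega

/-- If there is no isolated zero with at most two neighbours in `A`, then `I` has points to the
left and above (up to one unit) every point of `A`. -/
lemma exists_control (hno : ∀ z ∈ A, z ∉ I → nb I z = 0 → ¬ nb A z ≤ 2) {z : Pt} (hz : z ∈ A) :
    ∃ o ∈ I, o.1 ≤ z.1 + 1 ∧ z.2 - 1 ≤ o.2 := by
  obtain ⟨q, hq, h1, h2, h3, h4⟩ := exists_top_left hz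
  by_contra! hh
  refine hno q hq (fun hI => ?_) (nb_eq_zero fun r hr hI => ?_) (nb_le_two h3 h4)
  · have := hh q hI (by omega); omega
  · simp only [d1] at hr
    have := hh r hI (by omega); omega

/-- Presence of an isolated zero with at most two neighbours in `A`. -/
def HasIsolated (I A : Finset Pt) : Prop := ∃ z ∈ A, z ∉ I ∧ nb I z = 0 ∧ nb A z ≤ 2

lemma HasIsolated.im {g : Pt ≃ Pt} (hg : IsIso g) (h : HasIsolated I A) :
    HasIsolated (im g I) (im g A) := by
  obtain ⟨z, h1, h2, h3, h4⟩ := h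
  exact ⟨g z, by simpa [mem_im] using h1, by simpa [mem_im] using h2, by rwa [nb_im hg],
    by rwa [nb_im hg]⟩

lemma Opt.false_of_free_quadrant (h : Opt a b δ φ I A) (hz : HasIsolated I A) {c : Pt} (hc : c ∈ I)
    (hφ : ∀ o : Pt, o.1 ≤ c.1 → c.2 ≤ o.2 → φ o < 0) : False := by
  obtain ⟨z, h1, h2, h3, h4⟩ := hz
  obtain ⟨q, hq, k1, k2, k3, k4⟩ := exists_top_left hc
  exact h.false_of_isolated hq (hφ q k1 k2) (nb_le_two k3 k4) h1 h3 h2 h4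

lemma Setup.subset_of_isolated (h : Setup a b δ φ I A I₀ R ℓ D) (hz : HasIsolated I A) :
    I ⊆ I₀ := by
  intro c hc
  by_contra hc0
  rcases h.stair.free_quadrant hc0 with hq | hq | hq | hq
  · refine (h.opt.im isIso_flipX).false_of_free_quadrant (hz.im isIso_flipX) (c := (-c.1, c.2))
      (by simpa using hc) ?_
    rintro ⟨u, v⟩ h1 h2
    simp only [flipX_symm_apply] at h1 h2 ⊢
    have := h.sgn.neg fun hh => hq (-u, v) hh ⟨by simp only; omega, h2⟩
    omega
  · refine h.opt.false_of_free_quadrant hz hc fun o h1 h2 => ?_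
    have := h.sgn.neg fun hh => hq o hh ⟨h1, h2⟩
    omega
  · have h' := h.flipX.flipY
    refine h'.opt.false_of_free_quadrant ((hz.im isIso_flipX).im isIso_flipY) (c := (-c.1, -c.2))
      (by simpa using hc) ?_
    rintro ⟨u, v⟩ h1 h2
    simp only [flipX_symm_apply, flipY_symm_apply] at h1 h2 ⊢
    have := h.sgn.neg fun hh => hq (-u, -v) hh ⟨by simp only; omega, by simp only; omega⟩
    omega
  · refine (h.opt.im isIso_flipY).false_of_free_quadrant (hz.im isIso_flipY) (c := (c.1, -c.2))
      (by simpa using hc) ?_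
    rintro ⟨u, v⟩ h1 h2
    simp only [flipY_symm_apply] at h1 h2 ⊢
    have := h.sgn.neg fun hh => hq (u, -v) hh ⟨h1, by simp only; omega⟩
    omega

lemma Setup.fill_of_right (h : Setup a b δ φ I A I₀ R ℓ D) (hs : I ⊆ I₀) {x s t : ℤ}
    (h1 : (x, s) ∈ I) (h2 : (x, t) ∈ I) (h3 : ∀ y, s ≤ y → y ≤ t → (x + 1, y) ∈ I) :
    ∀ y, s ≤ y → y ≤ t → (x, y) ∈ I := by
  intro y hy hy'
  by_contra hh
  obtain ⟨l, ⟨hl1, hl2⟩, hl3⟩ := Int.exists_greatest_of_bdd (P := fun j => j ≤ y ∧ (x, j) ∈ I)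
    ⟨y, fun z hz => hz.1⟩ ⟨s, hy, h1⟩
  obtain ⟨r, ⟨hr1, hr2⟩, hr3⟩ := Int.exists_least_of_bdd (P := fun j => y ≤ j ∧ (x, j) ∈ I)
    ⟨y, fun z hz => hz.1⟩ ⟨t, hy', h2⟩
  have hly : l ≠ y := fun e => hh (e ▸ hl2)
  have hry : r ≠ y := fun e => hh (e ▸ hr2)
  have hsl := hl3 s ⟨hy, h1⟩
  have hrt := hr3 t ⟨hy', h2⟩
  refine (h.opt.im isIso_swapXY).false_of_capped (α := l + 1) (β := r - 1) (r := x) (by omega)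
    (fun j hj hj' => ?_) (by simpa using hl2) (by simpa using hr2)
  rw [mem_im_swapXY, mem_im_swapXY]
  refine ⟨h3 j (by omega) (by omega), fun hj2 => ?_,
    h.sgn.pos (h.stair.vconv x l r j (hs hl2) (hs hr2) (by omega) (by omega))⟩
  rcases le_total j y with hjy | hjy
  · have := hl3 j ⟨hjy, hj2⟩; omega
  · have := hr3 j ⟨hjy, hj2⟩; omega

lemma Setup.fill_of_side (h : Setup a b δ φ I A I₀ R ℓ D) (hs : I ⊆ I₀) {σ : ℤ}
    (hσ : σ = 1 ∨ σ = -1) {x s t : ℤ} (h1 : (x, s) ∈ I) (h2 : (x, t) ∈ I)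
    (h3 : ∀ y, s ≤ y → y ≤ t → (x + σ, y) ∈ I) : ∀ y, s ≤ y → y ≤ t → (x, y) ∈ I := by
  rcases hσ with rfl | rfl
  · exact h.fill_of_right hs h1 h2 h3
  · intro y hy hy'
    have := h.flipX.fill_of_right (im_mono hs) (x := -x) (s := s) (t := t) (by simpa using h1)
      (by simpa using h2) (fun y hy hy' => by
        rw [mem_im_flipX, show -(-x + 1) = x + -1 by ring]
        exact h3 y hy hy') y hy hy'
    simpa using this

/-- Points joined by a path of length `n` in `I` (the first point is not required to be in `I`). -/
def Reach (I : Finset Pt) : ℕ → Pt → Pt → Prop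
  | 0, p, q => p = q
  | n + 1, p, q => ∃ v ∈ I, d1 p v = 1 ∧ Reach I n v q

lemma exists_reach {p q : Pt} (h : Relation.ReflTransGen (fun a b => b ∈ I ∧ d1 a b = 1) p q) :
    ∃ n, Reach I n p q := by
  induction h using Relation.ReflTransGen.head_induction_on with
  | refl => exact ⟨0, rfl⟩
  | head hstep _ ih =>
    obtain ⟨n, hn⟩ := ih
    exact ⟨n + 1, _, hstep.1, hstep.2, hn⟩

/-- First return to a column. -/
lemma Reach.exists_return {σ x : ℤ} (hσ : σ = 1 ∨ σ = -1) {q : Pt} (hq : q.1 = x) :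
    ∀ {n : ℕ} {v : Pt}, v ∈ I → Reach I n v q → 1 ≤ σ * (v.1 - x) →
      ∃ m k y, m + k + 1 = n ∧ (x + σ, y) ∈ I ∧ (x, y) ∈ I ∧ Reach I m v (x + σ, y) ∧
        Reach I k (x, y) q := by
  intro n
  induction n with
  | zero =>
    intro v _ hvq hv
    obtain rfl : v = q := hvq
    simp [hq] at hv
  | succ n ih =>
    rintro ⟨v1, v2⟩ hvI ⟨⟨u1, u2⟩, hu, hd, hr⟩ hv
    by_cases hc : 1 ≤ σ * (u1 - x)
    · obtain ⟨m, k, y, h1, h2, h3, h4, h5⟩ := ih hu hr hc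
      exact ⟨m + 1, k, y, by omega, h2, h3, ⟨_, hu, hd, h4⟩, h5⟩
    · simp only [d1] at hd hv
      have e1 : v1 = x + σ := by rcases hσ with rfl | rfl <;> omega
      have e2 : u1 = x := by rcases hσ with rfl | rfl <;> omega
      have e3 : u2 = v2 := by rcases hσ with rfl | rfl <;> omega
      subst e2 e3
      exact ⟨0, n, u2, by omega, e1 ▸ hvI, hu, by rw [e1]; rfl, hr⟩

/-- If all sideways pockets of `I` are filled, then the components of `I` are vertically convex. -/
lemma Reach.segment_mem
    (hfill : ∀ σ x s t : ℤ, (σ = 1 ∨ σ = -1) → (x, s) ∈ I → (x, t) ∈ I →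
      (∀ y, s ≤ y → y ≤ t → (x + σ, y) ∈ I) → ∀ y, s ≤ y → y ≤ t → (x, y) ∈ I) :
    ∀ (n : ℕ) {x s t : ℤ}, (x, s) ∈ I → (x, t) ∈ I → Reach I n (x, s) (x, t) →
      ∀ y, (s ≤ y ∧ y ≤ t) ∨ (t ≤ y ∧ y ≤ s) → (x, y) ∈ I := by
  intro n
  induction n using Nat.strong_induction_on with
  | _ n ih =>
    intro x s t hs ht hr y hy
    match n, ih, hr with
    | 0, _, hr =>
      obtain ⟨-, rfl⟩ := Prod.mk.inj (show (x, s) = (x, t) from hr)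
      obtain rfl : y = s := by omega
      exact hs
    | n + 1, ih, ⟨⟨v1, v2⟩, hv, hd, hr'⟩ =>
      by_cases hx : v1 = x
      · subst hx
        simp only [d1] at hd
        by_cases hys : y = s
        · rw [hys]; exact hs
        · exact ih n (by omega) hv ht hr' y (by omega)
      · obtain ⟨σ, hσ, rfl⟩ : ∃ σ : ℤ, (σ = 1 ∨ σ = -1) ∧ v1 = x + σ := by
          simp only [d1] at hd
          exact ⟨v1 - x, by omega, by omega⟩
        obtain rfl : v2 = s := by
          simp only [d1] at hd
          rcases hσ with rfl | rfl <;> omega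
        obtain ⟨m, k, w, h1, h2, h3, h4, h5⟩ :=
          Reach.exists_return (x := x) (q := (x, t)) hσ rfl hv hr'
          (by rcases hσ with rfl | rfl <;> simp)
        have seg := ih m (by omega) hv h2 h4
        have seg' := ih k (by omega) h3 ht h5
        by_cases c1 : (w ≤ y ∧ y ≤ t) ∨ (t ≤ y ∧ y ≤ w)
        · exact seg' y c1
        · rcases le_total v2 w with hw | hw
          · exact hfill σ x v2 w hσ hs h3 (fun y h h' => seg y (Or.inl ⟨h, h'⟩)) y (by omega)
              (by omega)
          · exact hfill σ x w v2 hσ h3 hs (fun y h h' => seg y (Or.inr ⟨h, h'⟩)) y (by omega)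
              (by omega)

lemma Setup.segment_mem_of_isolated (h : Setup a b δ φ I A I₀ R ℓ D) (hz : HasIsolated I A)
    {x s t : ℤ} (hs : (x, s) ∈ I) (ht : (x, t) ∈ I)
    (hc : Relation.ReflTransGen (fun a b => b ∈ I ∧ d1 a b = 1) (x, s) (x, t)) {y : ℤ}
    (h1 : s ≤ y) (h2 : y ≤ t) : (x, y) ∈ I := by
  obtain ⟨n, hn⟩ := exists_reach hc
  exact Reach.segment_mem (fun σ x s t hσ h1 h2 h3 => h.fill_of_side
    (h.subset_of_isolated hz) hσ h1 h2 h3) n hs ht hn y (Or.inl ⟨h1, h2⟩)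

end Isolated

/-! ### No boundary points facing down away from the bottom -/

lemma Stair.exists_row {I₀ : Finset Pt} (h : Stair I₀) {p q : Pt} (hp : p ∈ I₀) (hq : q ∈ I₀)
    {s : ℤ} (h1 : p.2 ≤ s) (h2 : s ≤ q.2) :
    ∃ u, min p.1 q.1 ≤ u ∧ u ≤ max p.1 q.1 ∧ (u, s) ∈ I₀ := by
  obtain ⟨u, hu, hu'⟩ := h.swapXY.no_valley (o := (p.2, p.1)) (o' := (q.2, q.1))
    (m := min p.1 q.1) (by simpa using hp) (by simpa using hq) h1 h2 (min_le_left _ _)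
    (min_le_right _ _)
  obtain ⟨v, hv, hv'⟩ := h.swapXY.no_hill (o := (p.2, p.1)) (o' := (q.2, q.1))
    (m := max p.1 q.1) (by simpa using hp) (by simpa using hq) h1 h2 (le_max_left _ _)
    (le_max_right _ _)
  rw [mem_im_swapXY] at hu' hv'
  by_cases c1 : u ≤ max p.1 q.1
  · exact ⟨u, hu, c1, hu'⟩
  by_cases c2 : min p.1 q.1 ≤ v
  · exact ⟨v, c2, hv, hv'⟩
  exact ⟨p.1, min_le_left _ _, le_max_left _ _, h.hconv _ _ _ _ hv' hu' (by omega) (by omega)⟩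

lemma exists_small_step {f : ℕ → ℤ} {B : ℤ} : ∀ {k : ℕ}, f k < f 0 + k * (B + 1) →
    ∃ i < k, f (i + 1) ≤ f i + B
  | 0, h => by simp at h
  | k + 1, h => by
    by_cases hk : f (k + 1) ≤ f k + B
    · exact ⟨k, by omega, hk⟩
    · obtain ⟨i, hi, hi'⟩ := exists_small_step (f := f) (B := B) (k := k) (by
        push_cast at h
        linarith)
      exact ⟨i, by omega, hi'⟩

lemma exists_flat_of_mono {T : ℤ → ℤ} {l R B D : ℤ} {k : ℕ} (hR : 0 ≤ R)
    (hmono : ∀ s t, l ≤ s → s ≤ t → t ≤ l + 4 * R * k → T s ≤ T t)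
    (hD : T (l + 4 * R * k) ≤ T l + D) (hk : D < k * (B + 1)) :
    ∃ α, l + 2 * R ≤ α ∧ α ≤ l + 4 * R * k - 2 * R ∧
      ∀ s, α - 2 * R ≤ s → s ≤ α + 2 * R → |T s - T α| ≤ B := by
  obtain ⟨i, hi, hi'⟩ := exists_small_step (f := fun i => T (l + 4 * R * i)) (B := B) (k := k) (by
    simp only [Nat.cast_zero, mul_zero, add_zero]; linarith)
  have e : 4 * R * ((i + 1 : ℕ) : ℤ) ≤ 4 * R * k :=
    mul_le_mul_of_nonneg_left (by exact_mod_cast hi) (by linarith)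
  have e2 : (4 * R * ((i + 1 : ℕ) : ℤ)) = 4 * R * i + 4 * R := by push_cast; ring
  have e3 : 0 ≤ 4 * R * (i : ℤ) := by positivity
  simp only [e2] at hi'
  rw [e2] at e
  refine ⟨l + 4 * R * i + 2 * R, by linarith, by linarith, fun s hs hs' => ?_⟩
  have h1 := hmono (l + 4 * R * i) s (by linarith) (by linarith) (by linarith)
  have h2 := hmono s (l + (4 * R * i + 4 * R)) (by linarith) (by linarith) (by linarith)
  have h3 := hmono (l + 4 * R * i) (l + 4 * R * i + 2 * R) (by linarith) (by linarith)
    (by linarith)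
  have h4 := hmono (l + 4 * R * i + 2 * R) (l + (4 * R * i + 4 * R)) (by linarith) (by linarith)
    (by linarith)
  rw [abs_le]
  constructor <;> linarith

/-- A function without valleys and of bounded range is nearly constant on some window. -/
lemma exists_flat {T : ℤ → ℤ} {l n R B D : ℤ} {k : ℕ} (hR : 0 ≤ R) (hn : 8 * R * k ≤ n)
    (hT : ∀ r s t, l ≤ r → r ≤ s → s ≤ t → t ≤ l + n → min (T r) (T t) ≤ T s)
    (hD : ∀ s t, l ≤ s → s ≤ l + n → l ≤ t → t ≤ l + n → T s ≤ T t + D)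
    (hk : D < k * (B + 1)) :
    ∃ α, l + 2 * R ≤ α ∧ α ≤ l + n - 2 * R ∧
      ∀ s, α - 2 * R ≤ s → s ≤ α + 2 * R → |T s - T α| ≤ B := by
  have hn0 : 0 ≤ 4 * R * (k : ℤ) := by positivity
  have hn1 : 8 * R * (k : ℤ) = 2 * (4 * R * k) := by ring
  obtain ⟨t, ht, htm⟩ := Finset.exists_max_image (Finset.Icc l (l + n)) T
    ⟨l, by simp only [Finset.mem_Icc]; omega⟩
  simp only [Finset.mem_Icc] at ht htm
  rcases le_total (l + 4 * R * k) t with hc | hc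
  · obtain ⟨α, h1, h2, h3⟩ := exists_flat_of_mono (T := T) (l := l) hR
      (fun r s h1 h2 h3 => by
        have := hT r s t h1 h2 (by omega) ht.2
        have := htm r ⟨h1, by omega⟩
        omega)
      (hD _ _ (by omega) (by omega) le_rfl (by omega)) hk
    exact ⟨α, h1, by omega, h3⟩
  · obtain ⟨α, h1, h2, h3⟩ := exists_flat_of_mono (T := fun s => T (-s)) (l := -(l + n)) hR
      (fun r s h1 h2 h3 => by
        have := hT t (-s) (-r) ht.1 (by omega) (by omega) (by omega)
        have := htm (-r) ⟨by omega, by omega⟩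
        omega)
      (hD _ _ (by omega) (by omega) (by omega) (by omega)) hk
    refine ⟨-α, by omega, by omega, fun s hs hs' => ?_⟩
    simpa using h3 (-s) (by omega) (by omega)

lemma card_packc_sdiff_self_le {yb yT L U : ℤ} {s : Finset ℤ}
    (hL : ∀ y, yb ≤ y → y ≤ L → y ∈ s) (hU : ∀ y ∈ s, y ≤ U) {e : ℤ} (he : 0 ≤ e)
    (hLU : U - L ≤ e) : ((packc yb yT s \ s).card : ℤ) ≤ e := by
  have hc : ((s ∩ Finset.Icc yb yT).card : ℤ) ≤ (U + 1 - yb).toNat := by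
    rw [← Int.card_Icc]
    exact_mod_cast Finset.card_le_card fun y hy => by
      simp only [Finset.mem_inter, Finset.mem_Icc] at hy ⊢
      exact ⟨hy.2.1, hU y hy.1⟩
  have : packc yb yT s \ s ⊆ Finset.Icc (L + 1) U := by
    intro y hy
    simp only [Finset.mem_sdiff, mem_packc, Finset.mem_Icc] at hy ⊢
    obtain ⟨⟨h, -⟩ | h, h'⟩ := hy
    · exact absurd h h'
    · refine ⟨?_, by omega⟩
      by_contra! hh
      exact h' (hL y h.1 (by omega))
  have := Finset.card_le_card this
  rw [Int.card_Icc] at this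
  omega

section Top

variable {a b δ : ℝ} {φ : Pt → ℤ} {I A I₀ : Finset Pt} {R ℓ D y₀ x₁ x₂ : ℤ}

lemma Setup.mem_block (h : Setup a b δ φ I A I₀ R ℓ D) (hb : Bot I₀ y₀ x₁ x₂ ℓ) {x y : ℤ}
    (h1 : x₁ ≤ x) (h2 : x ≤ x₂) (h3 : y₀ ≤ y) (h4 : y ≤ y₀ + ℓ - 1) : (x, y) ∈ I₀ :=
  h.fat hb.le (hb.mem x h1 h2) h3 h4

lemma Setup.le_block (h : Setup a b δ φ I A I₀ R ℓ D) (hb : Bot I₀ y₀ x₁ x₂ ℓ) {x y n : ℤ}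
    (hn : 1 ≤ n) (h1 : x₁ + n ≤ x + 1) (h2 : x + n ≤ x₂ + 1) (h3 : y₀ + n ≤ y + 1)
    (h4 : y + n ≤ y₀ + ℓ) : n ≤ φ (x, y) :=
  h.sgn.le_of_rect (l := x₁) (r := x₂) (d := y₀) (u := y₀ + ℓ - 1)
    (fun _ _ k1 k2 k3 k4 => h.mem_block hb k1 k2 k3 k4) hn h1 h2 h3 (by omega)

/-- Above the bottom, the signed distance decreases upwards near the boundary of `I₀`. -/
lemma Setup.φ_succ_le (h : Setup a b δ φ I A I₀ R ℓ D) (hb : Bot I₀ y₀ x₁ x₂ ℓ) {x y : ℤ}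
    (h1 : x₁ + 2 * R ≤ x) (h2 : x ≤ x₂ - 2 * R) (h3 : y₀ + 2 * R < y) (h4 : φ (x, y) < 2 * R) :
    φ (x, y + 1) ≤ φ (x, y) := by
  have hR := h.R_pos
  by_cases c1 : (x, y) ∈ I₀
  · by_cases c2 : (x, y + 1) ∈ I₀
    · obtain ⟨⟨u, v⟩, hw, e⟩ := h.sgn.in_exists _ c1
      have e' := e
      simp only [d1] at e
      have hv : (u, v + 1) ∉ I₀ := fun hh => hw
        (h.stair.vconv u y₀ (v + 1) v (hb.mem u (by omega) (by omega)) hh (by omega) (by omega))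
      have := h.sgn.in_le _ c2 _ hv
      simp only [d1] at this
      omega
    · have := h.sgn.pos c1
      have := h.sgn.neg c2
      omega
  · have c2 : (x, y + 1) ∉ I₀ := fun hh => c1
      (h.stair.vconv x y₀ (y + 1) y (hb.mem x (by omega) (by omega)) hh (by omega) (by omega))
    obtain ⟨⟨u, v⟩, ho, e⟩ := h.sgn.out_exists _ c2
    simp only [d1] at e
    rcases le_or_gt v y with hv | hv
    · have := h.sgn.out_le _ c1 _ ho
      simp only [d1] at this
      omega
    · obtain ⟨w, hw1, hw2, hw⟩ := h.stair.exists_row (hb.mem x (by omega) (by omega)) ho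
        (s := v - 1) (by simp only; omega) (by simp only; omega)
      have := h.sgn.out_le _ c1 _ hw
      simp only [d1] at this hw1 hw2
      omega

lemma Setup.exists_near_right (h : Setup a b δ φ I A I₀ R ℓ D) {y x : ℤ} {o : Pt} (ho : o ∈ I)
    (h1 : o.1 ≤ x + 1) (h2 : y - 1 ≤ o.2) : ∃ q ∈ I₀, q.1 ≤ x + 2 * R ∧ y - 2 * R ≤ q.2 := by
  have hR := h.R_pos
  by_cases c : o ∈ I₀
  · exact ⟨o, c, by omega, by omega⟩
  · obtain ⟨q, hq, e⟩ := h.sgn.out_exists _ c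
    have := h.dout o ho
    simp only [d1] at e
    exact ⟨q, hq, by omega, by omega⟩

/-- Without isolated zeros, `A` is at most `2 * R` higher than `I₀`. -/
lemma Setup.exists_of_mem_A (h : Setup a b δ φ I A I₀ R ℓ D) (hno : ¬ HasIsolated I A) {x y : ℤ}
    (hz : (x, y) ∈ A) : ∃ s v, x - 2 * R ≤ s ∧ s ≤ x + 2 * R ∧ y - 2 * R ≤ v ∧ (s, v) ∈ I₀ := by
  have hno' : ∀ z ∈ A, z ∉ I → nb I z = 0 → ¬ nb A z ≤ 2 := fun z h1 h2 h3 h4 =>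
    hno ⟨z, h1, h2, h3, h4⟩
  obtain ⟨o, ho, ho1, ho2⟩ := exists_control hno' hz
  obtain ⟨o', ho', ho1', ho2'⟩ := exists_control (I := im BEG.flipX I) (A := im BEG.flipX A)
    (z := (-x, y))
    (fun z h1 h2 h3 h4 => hno <| by
      have : HasIsolated (im BEG.flipX I) (im BEG.flipX A) := ⟨z, h1, h2, h3, h4⟩
      have := this.im isIso_flipX
      rwa [show im BEG.flipX (im BEG.flipX I) = I by ext ⟨u, v⟩; simp,
        show im BEG.flipX (im BEG.flipX A) = A by ext ⟨u, v⟩; simp] at this) (by simpa using hz)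
  obtain ⟨q, hq, hq1, hq2⟩ := h.exists_near_right ho ho1 ho2
  obtain ⟨⟨r1, r2⟩, hr, hr1, hr2⟩ := h.flipX.exists_near_right ho' ho1' ho2'
  rw [mem_im_flipX] at hr
  simp only at hr1 hr2 hq1
  have hR := h.R_pos
  by_cases c1 : x - 2 * R ≤ q.1
  · exact ⟨q.1, q.2, c1, hq1, hq2, hq⟩
  by_cases c2 : -r1 ≤ x + 2 * R
  · exact ⟨-r1, r2, by omega, c2, hr2, hr⟩
  obtain ⟨v, hv, hv'⟩ := h.stair.no_valley hq hr (s := x) (by omega) (by simp only; omega) hq2 hr2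
  exact ⟨x, v, by omega, by omega, hv, hv'⟩

lemma Setup.exists_height (h : Setup a b δ φ I A I₀ R ℓ D) (hb : Bot I₀ y₀ x₁ x₂ ℓ) :
    ∃ T : ℤ → ℤ, ∀ x, x₁ ≤ x → x ≤ x₂ → (∀ y, y₀ ≤ y → ((x, y) ∈ I₀ ↔ y ≤ T x)) := by
  have : ∀ x, ∃ t, x₁ ≤ x → x ≤ x₂ → (∀ y, y₀ ≤ y → ((x, y) ∈ I₀ ↔ y ≤ t)) := by
    intro x
    by_cases hx : x₁ ≤ x ∧ x ≤ x₂
    · obtain ⟨t, ht, htm⟩ := Finset.exists_max_image (col I₀ x) id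
        ⟨y₀, mem_col.2 (hb.mem x hx.1 hx.2)⟩
      refine ⟨t, fun _ _ y hy => ⟨fun hh => htm y (mem_col.2 hh), fun hh => ?_⟩⟩
      exact h.stair.vconv x y₀ t y (hb.mem x hx.1 hx.2) (mem_col.1 ht) hy hh
    · exact ⟨0, fun h1 h2 => absurd ⟨h1, h2⟩ hx⟩
  choose T hT using this
  exact ⟨T, hT⟩

/-- The columns of `I` and `A` at `g` have no gaps above `yb`. -/
def Full (I A : Finset Pt) (yb yT g : ℤ) : Prop :=
  packc yb yT (col I g) = col I g ∧ packc yb yT (col A g) = col A g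

/-- Applying gravity between `α` and `β`. -/
lemma Setup.card_not_full_le (h : Setup a b δ φ I A I₀ R ℓ D)
    (hb : Bot I₀ y₀ x₁ x₂ ℓ) {yT e α β : ℤ}
    (hw : y₀ + 2 * R ≤ yT) (hA : ∀ p ∈ A, p.2 ≤ yT) (he : 0 ≤ e) (hα : x₁ + 2 * R ≤ α)
    (hβ : β ≤ x₂ - 2 * R)
    (hL : ∀ S T : Finset Pt, (S = I ∨ S = A) → (T = I ∨ T = A) →
      Flank (y₀ + 2 * R) yT (col S α) (col T (α - 1)) e)
    (hR : ∀ S T : Finset Pt, (S = I ∨ S = A) → (T = I ∨ T = A) →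
      Flank (y₀ + 2 * R) yT (col S β) (col T (β + 1)) e) :
    a * (((Finset.Icc α β).filter fun x => ¬ Full I A (y₀ + 2 * R) yT x).card : ℝ) ≤
      4 * (e : ℝ) := by
  have hR1 := h.R_pos
  have hℓ := h.ℓ_large
  have hTA : ∀ x, (x, yT + 1) ∉ A := fun x hx => by have := hA _ hx; simp only at this; omega
  have key := h.opt.grav_le hw he he
    (fun x h1 h2 => h.din _ (h.le_block hb (by omega) (by omega) (by omega) (by omega)
      (by omega)))
    (fun x _ _ hx => hTA x (h.opt.sub hx)) (fun x h1 h2 y1 hy1 hx1 _ => by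
      have hφ1 : φ (x, y1) < 2 * R := by
        by_contra! hh
        exact hx1 (h.din _ hh)
      have up : ∀ y, y1 ≤ y → φ (x, y) < 2 * R := by
        intro y hy
        induction y, hy using Int.leInduction with
        | base => exact hφ1
        | succ y hy ih =>
          exact (h.φ_succ_le hb (by omega) (by omega) (by omega) ih).trans_lt ih
      intro y y' hy hy' _
      induction y', hy' using Int.leInduction with
      | base => exact le_rfl
      | succ z hz ih =>
        exact (h.φ_succ_le hb (by omega) (by omega) (by omega) (up z (by omega))).trans
          (ih (by omega)))
    hL hR
  have e1 : ((Finset.Icc α β).filter fun x => ¬ Full I A (y₀ + 2 * R) yT x) =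
      (Finset.Icc α β).filter fun x => packc (y₀ + 2 * R) yT (col I x) ≠ col I x ∨
        ((x, yT + 1) ∉ A ∧ packc (y₀ + 2 * R) yT (col A x) ≠ col A x) := by
    refine Finset.filter_congr fun x _ => ?_
    simp only [Full, hTA, not_false_eq_true, true_and, not_and_or, ne_eq]
  rw [e1]
  push_cast at key
  linarith

lemma Setup.exists_full (h : Setup a b δ φ I A I₀ R ℓ D) (hb : Bot I₀ y₀ x₁ x₂ ℓ)
    (hno : ¬ HasIsolated I A) {yT n B L : ℤ} {k : ℕ} (hw : y₀ + 2 * R ≤ yT)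
    (hA : ∀ p ∈ A, p.2 ≤ yT) (hB : 0 ≤ B) (hk : D < k * (B + 1)) (hn : 8 * R * k ≤ n)
    (hbig : 8 * ((B : ℝ) + 2 * R) < a * n) (hL : x₁ ≤ L) (hL' : L + 3 * n ≤ x₂) :
    ∃ g, L + 2 * R ≤ g ∧ g ≤ L + 3 * n - 2 * R ∧ Full I A (y₀ + 2 * R) yT g := by
  have hR := h.R_pos
  have hn0 : 0 ≤ 8 * R * (k : ℤ) := by positivity
  obtain ⟨T, hT⟩ := h.exists_height hb
  have hTy : ∀ x, x₁ ≤ x → x ≤ x₂ → y₀ ≤ T x ∧ (x, T x) ∈ I₀ := fun x k1 k2 => by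
    have := (hT x k1 k2 y₀ le_rfl).1 (hb.mem x k1 k2)
    exact ⟨this, (hT x k1 k2 _ this).2 le_rfl⟩
  have flat : ∀ l, x₁ ≤ l → l + n ≤ x₂ → ∃ α, l + 2 * R ≤ α ∧ α ≤ l + n - 2 * R ∧
      ∀ s, α - 2 * R ≤ s → s ≤ α + 2 * R → |T s - T α| ≤ B := fun l k1 k2 =>
    exists_flat (by omega) hn
      (fun r s t j1 j2 j3 j4 => by
        obtain ⟨y, hy, hy'⟩ := h.stair.no_valley (hTy r (by omega) (by omega)).2
          (hTy t (by omega) (by omega)).2 j2 j3 (m := min (T r) (T t)) (min_le_left _ _)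
          (min_le_right _ _)
        have := hb.le _ hy'
        exact hy.trans ((hT s (by omega) (by omega) y this).1 hy'))
      (fun s t j1 j2 j3 j4 => by
        have := (h.diam _ (hTy s (by omega) (by omega)).2 _ (hTy t (by omega) (by omega)).2).2
        rw [abs_le] at this
        simp only at this
        omega) hk
  have small : ∀ α, x₁ + 2 * R ≤ α → α ≤ x₂ - 2 * R →
      (∀ s, α - 2 * R ≤ s → s ≤ α + 2 * R → |T s - T α| ≤ B) →
      ∀ S : Finset Pt, (S = I ∨ S = A) →
        ((packc (y₀ + 2 * R) yT (col S α) \ col S α).card : ℤ) ≤ 2 * B + 4 * R := by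
    intro α k1 k2 k3 S hS
    have hIS : I ⊆ S := by
      rcases hS with rfl | rfl
      exacts [subset_rfl, h.opt.sub]
    have hSA : S ⊆ A := by
      rcases hS with rfl | rfl
      exacts [h.opt.sub, subset_rfl]
    refine card_packc_sdiff_self_le (L := T α - B - 2 * R) (U := T α + B + 2 * R)
      (fun y hy hy' => mem_col.2 (hIS (h.din _ ?_))) (fun y hy => ?_) (by omega) (by omega)
    · refine h.sgn.le_of_rect (l := α - 2 * R) (r := α + 2 * R) (d := y₀) (u := T α - B)
        (fun u v j1 j2 j3 j4 => ?_) (by omega) (by omega) (by omega) (by omega) (by omega)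
      have := k3 u j1 j2
      rw [abs_le] at this
      exact (hT u (by omega) (by omega) v j3).2 (by omega)
    · obtain ⟨s, v, j1, j2, j3, j4⟩ := h.exists_of_mem_A hno (hSA (mem_col.1 hy))
      have := k3 s j1 j2
      rw [abs_le] at this
      have hv := hb.le _ j4
      have := (hT s (by omega) (by omega) v hv).1 j4
      omega
  obtain ⟨α, h1, h2, h3⟩ := flat L hL (by omega)
  obtain ⟨β, h4, h5, h6⟩ := flat (L + 2 * n) (by omega) (by omega)
  by_contra! hh
  have key := h.card_not_full_le hb hw hA (e := 2 * B + 4 * R) (α := α) (β := β) (by omega)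
    (by omega) (by omega)
    (fun S _ hS _ => Or.inr (small α (by omega) (by omega) h3 S hS))
    (fun S _ hS _ => Or.inr (small β (by omega) (by omega) h6 S hS))
  rw [Finset.filter_true_of_mem fun x hx => by
    rw [Finset.mem_Icc] at hx
    exact hh x (by omega) (by omega), Int.card_Icc] at key
  have hc : (n : ℝ) ≤ ((β + 1 - α).toNat : ℝ) := by
    have : n ≤ ((β + 1 - α).toNat : ℤ) := by omega
    exact_mod_cast this
  have := mul_le_mul_of_nonneg_left hc h.opt.ha.le
  push_cast at key
  linarith

lemma Setup.false_of_above (h : Setup a b δ φ I A I₀ R ℓ D) (hb : Bot I₀ y₀ x₁ x₂ ℓ)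
    {n B : ℤ} {k : ℕ} (hB : 0 ≤ B) (hk : D < k * (B + 1)) (hn : 8 * R * k ≤ n)
    (hbig : 8 * ((B : ℝ) + 2 * R) < a * n) {p : Pt} (hp : p ∈ I) (hp' : (p.1, p.2 - 1) ∉ I)
    (h1 : x₁ + 3 * n + 1 ≤ p.1) (h2 : p.1 ≤ x₂ - 3 * n - 1) (h3 : y₀ + 2 * R < p.2)
    (hc : Relation.ReflTransGen (fun a b => b ∈ I ∧ d1 a b = 1) (p.1, y₀ + 2 * R) p) : False := by
  have hR := h.R_pos
  have hℓ := h.ℓ_large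
  have hn0 : 0 ≤ 8 * R * (k : ℤ) := by positivity
  by_cases hno : HasIsolated I A
  · have hk0 : k ≠ 0 := by
      rintro rfl
      have := (h.diam _ (hb.mem p.1 (by omega) (by omega)) _
        (hb.mem p.1 (by omega) (by omega))).1
      simp at hk this
      omega
    have : 8 * R * 1 ≤ 8 * R * (k : ℤ) := by
      refine mul_le_mul_of_nonneg_left ?_ (by omega)
      exact_mod_cast Nat.one_le_iff_ne_zero.2 hk0
    exact hp' (h.segment_mem_of_isolated hno (x := p.1) (s := y₀ + 2 * R) (t := p.2)
      (h.din _ (h.le_block hb (by omega) (by omega) (by omega) (by omega) (by omega))) hp hc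
      (by omega) (by omega))
  obtain ⟨M, hM⟩ := (A.image Prod.snd).bddAbove
  obtain ⟨yT, hw, hA⟩ : ∃ yT, y₀ + 2 * R ≤ yT ∧ ∀ p ∈ A, p.2 ≤ yT :=
    ⟨max M (y₀ + 2 * R), le_max_right _ _, fun p hp =>
      (hM (by simpa using ⟨p.1, hp⟩)).trans (le_max_left _ _)⟩
  obtain ⟨g, hg1, hg2, hg3⟩ := h.exists_full hb hno hw hA hB hk hn hbig (L := p.1 - 1 - 3 * n)
    (by omega) (by omega)
  obtain ⟨g', hg1', hg2', hg3'⟩ := h.exists_full hb hno hw hA hB hk hn hbig (L := p.1 + 1)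
    (by omega) (by omega)
  have key := h.card_not_full_le hb hw hA le_rfl (α := g + 1) (β := g' - 1) (by omega) (by omega)
    (fun _ T _ hT => Or.inl (by
      rw [add_sub_cancel_right]
      rcases hT with rfl | rfl
      exacts [hg3.1, hg3.2]))
    (fun _ T _ hT => Or.inl (by
      rw [sub_add_cancel]
      rcases hT with rfl | rfl
      exacts [hg3'.1, hg3'.2]))
  rw [Int.cast_zero, mul_zero] at key
  have h0 : (((Finset.Icc (g + 1) (g' - 1)).filter
      fun x => ¬ Full I A (y₀ + 2 * R) yT x).card : ℝ) ≤ 0 := by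
    by_contra! hh
    have := mul_pos h.opt.ha hh
    linarith
  have h0' := Finset.card_eq_zero.1 (Nat.le_zero.1 (by exact_mod_cast h0))
  have hfull : Full I A (y₀ + 2 * R) yT p.1 := by
    by_contra hh
    have : p.1 ∈ (∅ : Finset ℤ) := h0' ▸ Finset.mem_filter.2
      ⟨Finset.mem_Icc.2 ⟨by omega, by omega⟩, hh⟩
    simp at this
  have m1 : p.2 ∈ packc (y₀ + 2 * R) yT (col I p.1) := hfull.1.symm ▸ mem_col.2 hp
  have m2 : p.2 - 1 ∈ packc (y₀ + 2 * R) yT (col I p.1) := by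
    have := hA p (h.opt.sub hp)
    rw [mem_packc] at m1 ⊢
    right
    rcases m1 with m1 | m1 <;> omega
  rw [hfull.1] at m2
  exact hp' (mem_col.1 m2)

end Top

/-! ### The functional in terms of finite sets -/

lemma exists_distTo_eq (p : Pt) {S : Set Pt} (hS : S.Nonempty) :
    ∃ w ∈ S, (∀ q ∈ S, d1 p w ≤ d1 p q) ∧ distTo p S = d1 p w := by
  obtain ⟨w, hw, hmin⟩ : ∃ w ∈ S, ∀ q ∈ S, d1 p w ≤ d1 p q := by
    have hne : (d1 p '' S).Nonempty := hS.image _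
    obtain ⟨w, hw, e⟩ := Nat.sInf_mem hne
    exact ⟨w, hw, fun q hq => e ▸ Nat.sInf_le ⟨q, hq, rfl⟩⟩
  refine ⟨w, hw, hmin, le_antisymm (iInf₂_le w hw) (le_iInf₂ fun q hq => ?_)⟩
  exact_mod_cast hmin q hq

lemma exists_sgn {I₀ : Finset Pt} (hI₀ : I₀.Nonempty) :
    ∃ φ : Pt → ℤ, Sgn I₀ φ ∧ ∀ p, dB p (I₀ : Set Pt) = ((φ p).natAbs : ℝ≥0∞) := by
  have hc : ((I₀ : Set Pt)ᶜ).Nonempty := (I₀.finite_toSet.infinite_compl).nonempty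
  choose win h1 h2 h3 using fun p => exists_distTo_eq p hc
  choose wout k1 k2 k3 using fun p => exists_distTo_eq p (S := (I₀ : Set Pt)) (by simpa using hI₀)
  refine ⟨fun p => if p ∈ I₀ then (d1 p (win p) : ℤ) else -(d1 p (wout p)), ?_, fun p => ?_⟩
  · refine ⟨fun p hp => ⟨win p, by simpa using h1 p, by simp [hp]⟩, fun p hp w hw => ?_,
      fun p hp => ⟨wout p, by simpa using k1 p, by simp [hp]⟩, fun p hp w hw => ?_⟩
    · simpa [hp] using h2 p w (by simpa using hw)
    · simpa [hp] using k2 p w (by simpa using hw)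
  · by_cases hp : p ∈ I₀
    · simp [dB, hp, h3]
    · simp [dB, hp, k3]

section Energy

variable {ε k ζ γ : ℝ}

/-- The share of the point `p` in the energy of the bond `{p, q}`, divided by `ε`. -/
def halfBond (a b : ℝ) (I A : Finset Pt) (p q : Pt) : ℝ :=
  a * (ind A p * (1 - ind A q) + ind I p * (1 - ind I q)) + b * (ind I p * (1 - ind A q)) +
    a * (ind A p - ind I p)

lemma halfBond_nonneg {a b : ℝ} {I A : Finset Pt} (ha : 0 ≤ a) (hb : 0 ≤ b) (h : I ⊆ A) (p q : Pt) :
    0 ≤ halfBond a b I A p q := by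
  have h1 : (0 : ℝ) ≤ ind I p := by exact_mod_cast ind_nonneg I p
  have h2 : (ind I p : ℝ) ≤ ind A p := by exact_mod_cast ind_mono h p
  have h3 : (ind I q : ℝ) ≤ ind A q := by exact_mod_cast ind_mono h q
  have h4 : (ind A q : ℝ) ≤ 1 := by exact_mod_cast ind_le_one A q
  have h5 : 0 ≤ 1 - (ind A q : ℝ) := by linarith
  have h6 : 0 ≤ 1 - (ind I q : ℝ) := by linarith
  have h7 : 0 ≤ (ind A p : ℝ) := by linarith
  have h8 : 0 ≤ (ind A p : ℝ) - ind I p := by linarith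
  unfold halfBond
  positivity

/-- The finite sets `I ⊆ A` are `{u = 1}` and `{u ≥ 0}`. -/
structure Represents (u : Config) (I A : Finset Pt) : Prop where
  I_eq : (I : Set Pt) = Iset u
  A_eq : (A : Set Pt) = Iset u ∪ Zset u

variable {u : Config} {I A : Finset Pt}

lemma Represents.sub (h : Represents u I A) : I ⊆ A := by
  rw [← Finset.coe_subset, h.I_eq, h.A_eq]
  exact Set.subset_union_left

lemma Represents.val_eq (h : Represents u I A) (p : Pt) : u.val p = ind I p + ind A p - 1 := by
  have h1 : p ∈ I ↔ u.val p = 1 := by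
    rw [← Finset.mem_coe, h.I_eq]; rfl
  have h2 : p ∈ A ↔ u.val p = 1 ∨ u.val p = 0 := by
    rw [← Finset.mem_coe, h.A_eq]; rfl
  unfold ind
  rcases u.val_mem p with hp | hp | hp <;> rw [hp] at h1 h2 ⊢ <;> simp [h1, h2]

lemma Represents.bond_eq (h : Represents u I A) (hε : 0 ≤ ε) (hk₁ : -1 ≤ k) (hk₂ : k ≤ 1)
    (p q : Pt) :
    bond ε k (u.val p) (u.val q) =
      ENNReal.ofReal (ε * halfBond ((1 - k) / 2) (1 + k) I A p q) +
        ENNReal.ofReal (ε * halfBond ((1 - k) / 2) (1 + k) I A q p) := by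
  have ha : 0 ≤ (1 - k) / 2 := by linarith
  have hb : 0 ≤ 1 + k := by linarith
  rw [← ENNReal.ofReal_add (mul_nonneg hε (halfBond_nonneg ha hb h.sub _ _))
    (mul_nonneg hε (halfBond_nonneg ha hb h.sub _ _)), bond, h.val_eq, h.val_eq]
  congr 1
  have key : ∀ p, (ind I p = 0 ∧ ind A p = 0) ∨ (ind I p = 0 ∧ ind A p = 1) ∨
      (ind I p = 1 ∧ ind A p = 1) := fun p => by
    have := ind_mono h.sub p
    have := ind_nonneg I p
    have := ind_le_one A p
    omega
  unfold halfBond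
  rcases key p with ⟨e1, e2⟩ | ⟨e1, e2⟩ | ⟨e1, e2⟩ <;>
    rcases key q with ⟨e3, e4⟩ | ⟨e3, e4⟩ | ⟨e3, e4⟩ <;> rw [e1, e2, e3, e4] <;> push_cast <;> ring

lemma Represents.energy_eq (h : Represents u I A) (hε : 0 ≤ ε) (hk₁ : -1 ≤ k) (hk₂ : k ≤ 1) :
    energy ε k u = ENNReal.ofReal (ε * (2 * (1 - k) * (A.card - I.card) +
      phaseEnergy ((1 - k) / 2) (1 + k) I A)) := by
  have ha : 0 ≤ (1 - k) / 2 := by linarith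
  have hb : 0 ≤ 1 + k := by linarith
  set f : Pt → Pt → ℝ := halfBond ((1 - k) / 2) (1 + k) I A with hf
  have hf0 : ∀ p q, 0 ≤ ε * f p q := fun p q =>
    mul_nonneg hε (halfBond_nonneg ha hb h.sub p q)
  have shift : ∀ e : Pt, ∑' p, ENNReal.ofReal (ε * f (p + e) p) =
      ∑' p, ENNReal.ofReal (ε * f p (p - e)) := fun e => by
    rw [← (Equiv.addRight e).tsum_eq fun p => ENNReal.ofReal (ε * f p (p - e))]
    simp
  have e1 : energy ε k u = ∑' p, ENNReal.ofReal (ε * (f p (p.1 + 1, p.2) + f p (p.1 - 1, p.2) +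
      f p (p.1, p.2 + 1) + f p (p.1, p.2 - 1))) := by
    unfold energy
    simp only [h.bond_eq hε hk₁ hk₂]
    rw [ENNReal.tsum_add, ENNReal.tsum_add, ENNReal.tsum_add, shift, shift, ← ENNReal.tsum_add,
      ← ENNReal.tsum_add, ← ENNReal.tsum_add]
    refine tsum_congr fun p => ?_
    have g1 : p + (1, 0) = (p.1 + 1, p.2) := by ext <;> simp
    have g2 : p - (1, 0) = (p.1 - 1, p.2) := by ext <;> simp
    have g3 : p + (0, 1) = (p.1, p.2 + 1) := by ext <;> simp
    have g4 : p - (0, 1) = (p.1, p.2 - 1) := by ext <;> simp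
    rw [g1, g2, g3, g4, mul_add, mul_add, mul_add,
      ENNReal.ofReal_add (by have := hf0 p; simp only [add_nonneg, this]) (hf0 _ _),
      ENNReal.ofReal_add (by have := hf0 p; simp only [add_nonneg, this]) (hf0 _ _),
      ENNReal.ofReal_add (hf0 _ _) (hf0 _ _), ← add_assoc]
  have e2 : ∀ p, f p (p.1 + 1, p.2) + f p (p.1 - 1, p.2) + f p (p.1, p.2 + 1) +
      f p (p.1, p.2 - 1) = (1 - k) / 2 * (ind A p * (4 - nb A p) + ind I p * (4 - nb I p)) +
        (1 + k) * (ind I p * (4 - nb A p)) + 2 * (1 - k) * (ind A p - ind I p) := fun p => by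
    rw [hf, nb_eq, nb_eq]
    unfold halfBond
    push_cast
    ring
  have e3 : ∀ S ⊆ A, ∀ g : Pt → ℤ, ∑ p ∈ A, ind S p * g p = ∑ p ∈ S, g p := fun S hS g => by
    simp only [ind, ite_mul, one_mul, zero_mul]
    rw [← Finset.sum_filter, Finset.filter_mem_eq_inter, Finset.inter_eq_right.2 hS]
  have e4 : ∀ S ⊆ A, ∑ p ∈ A, ind S p = S.card := fun S hS => by
    have := e3 S hS fun _ => 1
    simpa using this
  have e5 : ∀ p ∉ A, ENNReal.ofReal (ε * (f p (p.1 + 1, p.2) + f p (p.1 - 1, p.2) +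
      f p (p.1, p.2 + 1) + f p (p.1, p.2 - 1))) = 0 := fun p hp => by
    rw [e2, ind_of_notMem hp, ind_of_notMem fun hh => hp (h.sub hh)]
    simp
  have e6 : ∀ p ∈ A, 0 ≤ ε * (f p (p.1 + 1, p.2) + f p (p.1 - 1, p.2) +
      f p (p.1, p.2 + 1) + f p (p.1, p.2 - 1)) := fun p _ => by
    simp only [mul_add]
    exact add_nonneg (add_nonneg (add_nonneg (hf0 _ _) (hf0 _ _)) (hf0 _ _)) (hf0 _ _)
  rw [e1, tsum_eq_sum e5, ← ENNReal.ofReal_sum_of_nonneg e6]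
  · simp only [e2]
    congr 1
    have h1 := e3 A subset_rfl fun p => 4 - nb A p
    have h2 := e3 I h.sub fun p => 4 - nb I p
    have h3 := e3 I h.sub fun p => 4 - nb A p
    have h4 := e4 A subset_rfl
    have h5 := e4 I h.sub
    rw [← bd] at h1 h2 h3
    unfold phaseEnergy
    rw [← h1, ← h2, ← h3, ← Int.cast_natCast A.card, ← Int.cast_natCast I.card, ← h4, ← h5,
      ← Finset.mul_sum]
    push_cast
    simp only [Finset.sum_add_distrib, ← Finset.mul_sum, Finset.sum_sub_distrib]
    ring

lemma Sgn.sum_symmDiff {I₀ : Finset Pt} {φ : Pt → ℤ} (hs : Sgn I₀ φ) (I : Finset Pt) :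
    ∑ p ∈ I ∆ I₀, ((φ p).natAbs : ℤ) = ∑ p ∈ I₀, φ p - ∑ p ∈ I, φ p := by
  have h1 := Finset.sum_sdiff (f := φ) (Finset.inter_subset_left : I ∩ I₀ ⊆ I)
  have h2 := Finset.sum_sdiff (f := φ) (Finset.inter_subset_right : I ∩ I₀ ⊆ I₀)
  rw [Finset.sdiff_inter_self_left] at h1
  rw [Finset.sdiff_inter_self_right] at h2
  have h3 : ∑ p ∈ I \ I₀, ((φ p).natAbs : ℤ) = ∑ p ∈ I \ I₀, -φ p :=
    Finset.sum_congr rfl fun p hp => by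
      have := hs.neg (Finset.mem_sdiff.1 hp).2
      omega
  have h4 : ∑ p ∈ I₀ \ I, ((φ p).natAbs : ℤ) = ∑ p ∈ I₀ \ I, φ p :=
    Finset.sum_congr rfl fun p hp => by
      have := hs.pos (Finset.mem_sdiff.1 hp).1
      omega
  have h5 : Disjoint (I \ I₀) (I₀ \ I) := disjoint_sdiff_sdiff
  rw [symmDiff_def, Finset.sup_eq_union, Finset.sum_union h5, h3, h4, Finset.sum_neg_distrib]
  linarith

lemma Sgn.diss1_eq {I₀ : Finset Pt} {φ : Pt → ℤ} (hs : Sgn I₀ φ)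
    (hφ : ∀ p, dB p (I₀ : Set Pt) = ((φ p).natAbs : ℝ≥0∞)) (hε : 0 ≤ ε) (I : Finset Pt) :
    diss1 ε I I₀ = ENNReal.ofReal (ε ^ 3 * ((∑ p ∈ I₀, φ p - ∑ p ∈ I, φ p : ℤ) : ℝ)) := by
  have hε3 : 0 ≤ ε ^ 3 := by positivity
  unfold diss1
  rw [tsum_eq_sum (s := I ∆ I₀) fun p hp => if_neg (by simpa [Finset.mem_symmDiff, Set.mem_symmDiff]
    using hp), ← hs.sum_symmDiff]
  push_cast
  rw [Finset.mul_sum, ENNReal.ofReal_sum_of_nonneg fun p _ => by positivity]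
  refine Finset.sum_congr rfl fun p hp => ?_
  rw [if_pos (by simpa [Finset.mem_symmDiff, Set.mem_symmDiff] using hp), hφ,
    ENNReal.ofReal_mul hε3]
  rw [← Int.cast_abs, Int.abs_eq_natAbs, Int.cast_natCast, ENNReal.ofReal_natCast]

lemma Represents.ncard_Zset (h : Represents u I A) : (Zset u).ncard + I.card = A.card := by
  have e : Zset u = ((A \ I : Finset Pt) : Set Pt) := by
    rw [Finset.coe_sdiff, h.I_eq, h.A_eq]
    ext p
    simp only [Zset, Iset, Set.mem_sdiff, Set.mem_union, Set.mem_ofPred_eq]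
    omega
  rw [e, Set.ncard_coe_finset]
  exact Finset.card_sdiff_add_card_eq_card h.sub

lemma exists_represents {I A : Finset Pt} (h : I ⊆ A) : ∃ u, Represents u I A := by
  refine ⟨⟨fun p => if p ∈ I then 1 else if p ∈ A then 0 else -1, fun p => ?_, ?_⟩, ?_, ?_⟩
  · split_ifs <;> simp
  · refine A.finite_toSet.subset fun p hp => ?_
    simp only [Set.mem_ofPred_eq] at hp
    by_contra hh
    rw [Finset.mem_coe] at hh
    simp [hh, show p ∉ I from fun h' => hh (h h')] at hp
  · ext p
    by_cases h1 : p ∈ I <;> by_cases h2 : p ∈ A <;> simp [Iset, h1, h2]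
  · ext p
    by_cases h1 : p ∈ I <;> by_cases h2 : p ∈ A <;> simp [Iset, Zset, h1, h2]
    exact h2 (h h1)

lemma Represents.totalF_eq (h : Represents u I A) {w : Config} {I₀ : Finset Pt} {φ : Pt → ℤ}
    (hI₀ : (I₀ : Set Pt) = Iset w) (hs : Sgn I₀ φ)
    (hφ : ∀ p, dB p (I₀ : Set Pt) = ((φ p).natAbs : ℝ≥0∞)) (hε : 0 < ε) (hk₁ : -1 ≤ k)
    (hk₂ : k ≤ 1) (hζ : 0 < ζ) :
    totalF ε k ζ γ u w = ENNReal.ofReal (ε * (2 * (1 - k) * (A.card - I.card) +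
      phaseEnergy ((1 - k) / 2) (1 + k) I A) + (ζ * ε)⁻¹ *
        (ε ^ 3 * ((∑ p ∈ I₀, φ p - ∑ p ∈ I, φ p : ℤ) : ℝ) +
          ε ^ γ * (Nat.dist (Zset u).ncard (Zset w).ncard : ℕ))) ∧
    0 ≤ ε * (2 * (1 - k) * (A.card - I.card) +
      phaseEnergy ((1 - k) / 2) (1 + k) I A) + (ζ * ε)⁻¹ *
        (ε ^ 3 * ((∑ p ∈ I₀, φ p - ∑ p ∈ I, φ p : ℤ) : ℝ) +
          ε ^ γ * (Nat.dist (Zset u).ncard (Zset w).ncard : ℕ)) := by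
  have hsum : (0 : ℝ) ≤ ((∑ p ∈ I₀, φ p - ∑ p ∈ I, φ p : ℤ) : ℝ) := by
    rw [← hs.sum_symmDiff]
    exact_mod_cast Finset.sum_nonneg fun p _ => by positivity
  have hg : 0 ≤ ε ^ γ := Real.rpow_nonneg hε.le γ
  have h1 : 0 ≤ 2 * (1 - k) * ((A.card : ℝ) - I.card) + phaseEnergy ((1 - k) / 2) (1 + k) I A := by
    have c1 : (I.card : ℝ) ≤ A.card := by exact_mod_cast Finset.card_le_card h.sub
    have c2 : (0 : ℝ) ≤ bd I I := by exact_mod_cast bd_nonneg I I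
    have c3 : (0 : ℝ) ≤ bd A A := by exact_mod_cast bd_nonneg A A
    have c4 : (0 : ℝ) ≤ bd I A := by exact_mod_cast bd_nonneg I A
    have c5 : 0 ≤ 1 - k := by linarith
    have c6 : 0 ≤ 1 + k := by linarith
    have c7 : 0 ≤ (A.card : ℝ) - I.card := by linarith
    exact add_nonneg (mul_nonneg (mul_nonneg two_pos.le c5) c7)
      (add_nonneg (mul_nonneg (div_nonneg c5 two_pos.le) (by push_cast; exact add_nonneg c2 c3))
        (mul_nonneg c6 c4))
  have h2 : 0 ≤ ε ^ 3 * ((∑ p ∈ I₀, φ p - ∑ p ∈ I, φ p : ℤ) : ℝ) := by positivity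
  have h3 : 0 ≤ ε ^ γ * ((Nat.dist (Zset u).ncard (Zset w).ncard : ℕ) : ℝ) := by positivity
  have hζε : 0 < ζ * ε := by positivity
  have h4 := mul_nonneg (inv_nonneg.2 hζε.le) (add_nonneg h2 h3)
  refine ⟨?_, add_nonneg (mul_nonneg hε.le h1) h4⟩
  rw [totalF, h.energy_eq hε.le hk₁ hk₂, ← h.I_eq, ← hI₀, hs.diss1_eq hφ hε.le, diss0,
    ENNReal.ofReal_add (mul_nonneg hε.le h1) h4,
    ENNReal.ofReal_mul (p := (ζ * ε)⁻¹) (inv_nonneg.2 hζε.le),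
    ENNReal.ofReal_inv_of_pos hζε, ENNReal.ofReal_add h2 h3, ENNReal.ofReal_mul hg,
    ENNReal.ofReal_natCast]

lemma Minimizes.finite_Iset {u₀ u₁ : Config} (h : Minimizes ε k ζ γ u₁ u₀) (hε : 0 < ε)
    (hk₁ : -1 ≤ k) (hk₂ : k ≤ 1) (hζ : 0 < ζ) {I₀ : Finset Pt} {φ : Pt → ℤ}
    (hI₀ : (I₀ : Set Pt) = Iset u₀) (hs : Sgn I₀ φ)
    (hφ : ∀ p, dB p (I₀ : Set Pt) = ((φ p).natAbs : ℝ≥0∞)) : (Iset u₁).Finite := by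
  obtain ⟨v, hv⟩ := exists_represents (subset_refl I₀)
  have htop : totalF ε k ζ γ u₁ u₀ ≠ ⊤ := by
    refine ((h v).trans_lt ?_).ne
    rw [(hv.totalF_eq hI₀ hs hφ hε hk₁ hk₂ hζ).1]
    exact ENNReal.ofReal_lt_top
  have h1 : diss1 ε (Iset u₁) (Iset u₀) ≠ ⊤ := by
    intro hh
    apply htop
    rw [totalF, hh, top_add, ENNReal.mul_top (by simp), add_top]
  have hε3 : 0 < ENNReal.ofReal (ε ^ 3) := by
    rw [ENNReal.ofReal_pos]; positivity
  have h2 := ENNReal.finite_const_le_of_tsum_ne_top h1 hε3.ne'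
  refine ((h2.union I₀.finite_toSet)).subset fun p hp => ?_
  by_cases hp0 : p ∈ I₀
  · exact Or.inr hp0
  · left
    rw [Set.mem_ofPred_eq, if_pos (Set.mem_symmDiff.2 (Or.inl ⟨hp, by rwa [← hI₀]⟩)), ← hI₀, hφ]
    have := hs.neg hp0
    have : 1 ≤ (φ p).natAbs := by omega
    exact le_mul_of_one_le_right' (by exact_mod_cast this)

lemma Minimizes.exists_opt {u₀ u₁ : Config} (h : Minimizes ε k ζ γ u₁ u₀) (hε : 0 < ε)
    (hk₁ : -1 < k) (hk₂ : k < 1) (hζ : 0 < ζ) (hfin : (Iset u₀).Finite)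
    (hne : (Iset u₀).Nonempty) :
    ∃ (I A I₀ : Finset Pt) (φ : Pt → ℤ), Represents u₁ I A ∧ (I₀ : Set Pt) = Iset u₀ ∧ Sgn I₀ φ ∧
      (∀ p, dB p (Iset u₀) = ((φ p).natAbs : ℝ≥0∞)) ∧
      Opt ((1 - k) / 2) (1 + k) (ε / ζ) φ I A := by
  obtain ⟨I₀, hI₀⟩ := hfin.exists_finset_coe
  obtain ⟨φ, hs, hφ⟩ := exists_sgn (I₀ := I₀) (by rwa [← Finset.coe_nonempty, hI₀])
  have hfin1 := h.finite_Iset hε hk₁.le hk₂.le hζ hI₀ hs hφ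
  have hr : Represents u₁ hfin1.toFinset (hfin1.union u₁.finiteZero).toFinset :=
    ⟨by simp, by simp [Zset]⟩
  refine ⟨_, _, I₀, φ, hr, hI₀, hs, fun p => by rw [← hI₀, hφ], by linarith, by linarith, by ring,
    by positivity, hr.sub, fun I' A' hsub hcard => ?_⟩
  generalize hfin1.toFinset = I at *
  generalize (hfin1.union u₁.finiteZero).toFinset = A at *
  obtain ⟨v, hv⟩ := exists_represents hsub
  have hle := h v
  obtain ⟨e1, n1⟩ := hr.totalF_eq (γ := γ) hI₀ hs hφ hε hk₁.le hk₂.le hζ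
  obtain ⟨e2, n2⟩ := hv.totalF_eq (γ := γ) hI₀ hs hφ hε hk₁.le hk₂.le hζ
  rw [e1, e2, ENNReal.ofReal_le_ofReal_iff n2] at hle
  have z1 := hr.ncard_Zset
  have z2 := hv.ncard_Zset
  rw [show (Zset v).ncard = (Zset u₁).ncard by omega] at hle
  have hc : (A.card : ℝ) - I.card = A'.card - I'.card := by
    have : (A.card : ℤ) - I.card = A'.card - I'.card := by omega
    exact_mod_cast this
  rw [hc] at hle
  have e3 : (ζ * ε)⁻¹ * ε ^ 3 = ε * (ε / ζ) := by field_simp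
  push_cast at hle ⊢
  simp only [mul_add, ← mul_assoc, e3] at hle
  have : ε * (phaseEnergy ((1 - k) / 2) (1 + k) I A - ε / ζ * ∑ p ∈ I, (φ p : ℝ)) ≤
      ε * (phaseEnergy ((1 - k) / 2) (1 + k) I' A' - ε / ζ * ∑ p ∈ I', (φ p : ℝ)) := by linarith
  exact le_of_mul_le_mul_left this hε

end Energy

/-! ### Sets without vacancies touched twice are unions of rectangles -/

/-- Sets closed under nearest-neighbour steps inside `T`. -/
def StepClosed (T C : Set Pt) : Prop := ∀ p ∈ C, ∀ r ∈ T, d1 p r = 1 → r ∈ C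

lemma StepClosed.column {T C : Set Pt} (h : StepClosed T C) {x y y' : ℤ} (h0 : (x, y) ∈ C)
    (hT : ∀ s, min y y' ≤ s → s ≤ max y y' → (x, s) ∈ T) : (x, y') ∈ C := by
  rcases le_total y y' with hy | hy
  · rw [min_eq_left hy, max_eq_right hy] at hT
    induction y', hy using Int.leInduction with
    | base => exact h0
    | succ n hn ih =>
      exact h _ (ih fun s h1 h2 => hT s h1 (by omega)) _ (hT _ (by omega) le_rfl) (by simp [d1])
  · rw [min_eq_right hy, max_eq_left hy] at hT
    induction y', hy using Int.leInductionDown with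
    | base => exact h0
    | pred n hn ih =>
      exact h _ (ih fun s h1 h2 => hT s (by omega) h2) _ (hT _ le_rfl (by omega)) (by simp [d1])

lemma StepClosed.row {T C : Set Pt} (h : StepClosed T C) {x x' y : ℤ} (h0 : (x, y) ∈ C)
    (hT : ∀ s, min x x' ≤ s → s ≤ max x x' → (s, y) ∈ T) : (x', y) ∈ C := by
  have h' : StepClosed (Prod.swap ⁻¹' T) (Prod.swap ⁻¹' C) := fun p hp r hr hpr =>
    h p.swap hp r.swap hr (by rw [← hpr]; simp only [d1, Prod.fst_swap, Prod.snd_swap]; omega)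
  exact h'.column h0 hT

/-- Vacancies with two occupied neighbours are excluded. -/
def CornerFilled (T : Set Pt) : Prop :=
  ∀ p ∈ T, ∀ q ∈ T, ∀ w, p ≠ q → d1 p w = 1 → d1 q w = 1 → w ∈ T

lemma CornerFilled.column {T : Set Pt} (h : CornerFilled T) {s s' y₀ c d : ℤ}
    (hs : (s - s').natAbs = 1) (hcol : ∀ y, c ≤ y → y ≤ d → (s, y) ∈ T) (h0 : (s', y₀) ∈ T)
    (hc : c ≤ y₀) (hd : y₀ ≤ d) : ∀ y, c ≤ y → y ≤ d → (s', y) ∈ T := by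
  have up : ∀ y, y₀ ≤ y → y ≤ d → (s', y) ∈ T := by
    intro y hy
    induction y, hy using Int.leInduction with
    | base => exact fun _ => h0
    | succ y hy ih =>
      intro hyd
      refine h _ (ih (by omega)) _ (hcol (y + 1) (by omega) hyd) _ ?_ ?_ ?_
      · simp
      · simp [d1]
      · simpa [d1] using hs
  have down : ∀ y, y ≤ y₀ → c ≤ y → (s', y) ∈ T := by
    intro y hy
    induction y, hy using Int.leInductionDown with
    | base => exact fun _ => h0
    | pred y hy ih =>
      intro hyd
      refine h _ (ih (by omega)) _ (hcol (y - 1) hyd (by omega)) _ ?_ ?_ ?_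
      · rw [Ne, Prod.mk.injEq]; omega
      · simp [d1]
      · simpa [d1] using hs
  intro y h1 h2
  rcases le_total y₀ y with h3 | h3
  · exact up y h3 h2
  · exact down y h3 h1

lemma CornerFilled.row {T : Set Pt} (h : CornerFilled T) {s s' x₀ c d : ℤ}
    (hs : (s - s').natAbs = 1) (hrow : ∀ x, c ≤ x → x ≤ d → (x, s) ∈ T) (h0 : (x₀, s') ∈ T)
    (hc : c ≤ x₀) (hd : x₀ ≤ d) : ∀ x, c ≤ x → x ≤ d → (x, s') ∈ T := by
  have h' : CornerFilled (Prod.swap ⁻¹' T) := fun p hp q hq w hpq hpw hqw =>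
    h p.swap hp q.swap hq w.swap (fun e => hpq (Prod.swap_injective e))
      (by rw [← hpw]; simp only [d1, Prod.fst_swap, Prod.snd_swap]; omega)
      (by rw [← hqw]; simp only [d1, Prod.fst_swap, Prod.snd_swap]; omega)
  exact h'.column hs hrow h0 hc hd

lemma mem_Icc_pt {a b c d : ℤ} {p : Pt} :
    p ∈ Finset.Icc ((a, c) : Pt) (b, d) ↔ (a ≤ p.1 ∧ c ≤ p.2) ∧ p.1 ≤ b ∧ p.2 ≤ d := by
  rw [Finset.mem_Icc, Prod.le_def, Prod.le_def]

lemma CornerFilled.isDiscreteRectangle {A : Finset Pt} (h : CornerFilled (A : Set Pt)) {q : Pt}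
    (hq : q ∈ A) : IsDiscreteRectangle (wkComp A q) := by
  obtain ⟨T, hT, hmax⟩ := (A.powerset.filter fun T => q ∈ T ∧ ∃ a b c d : ℤ,
    T = Finset.Icc ((a, c) : Pt) (b, d)).exists_max_image Finset.card
    ⟨{q}, by simpa [hq] using ⟨q.1, q.1, q.2, q.2, by simp⟩⟩
  rw [Finset.mem_filter, Finset.mem_powerset] at hT
  obtain ⟨hTA, hqT, a, b, c, d, rfl⟩ := hT
  have hq' := mem_Icc_pt.1 hqT
  have hmem : ∀ x y, a ≤ x → x ≤ b → c ≤ y → y ≤ d → (x, y) ∈ (A : Set Pt) :=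
    fun x y h1 h2 h3 h4 => hTA (mem_Icc_pt.2 ⟨⟨h1, h3⟩, h2, h4⟩)
  have hext : ∀ a' b' c' d' : ℤ, a' ≤ a → b ≤ b' → c' ≤ c → d ≤ d' →
      (∀ x y, a' ≤ x → x ≤ b' → c' ≤ y → y ≤ d' → (x, y) ∈ (A : Set Pt)) →
      a' = a ∧ b' = b ∧ c' = c ∧ d' = d := by
    intro a' b' c' d' h1 h2 h3 h4 h5
    have hsub : Finset.Icc ((a, c) : Pt) (b, d) ⊆ Finset.Icc ((a', c') : Pt) (b', d') :=
      fun p hp => by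
        rw [mem_Icc_pt] at hp ⊢
        omega
    have hle := hmax (Finset.Icc ((a', c') : Pt) (b', d')) (by
      rw [Finset.mem_filter, Finset.mem_powerset]
      refine ⟨fun p hp => ?_, hsub hqT, a', b', c', d', rfl⟩
      rw [mem_Icc_pt] at hp
      exact h5 p.1 p.2 hp.1.1 hp.2.1 hp.1.2 hp.2.2)
    have heq := Finset.eq_of_subset_of_card_le hsub hle
    have m1 : ((a', c') : Pt) ∈ Finset.Icc ((a, c) : Pt) (b, d) := by
      rw [heq, mem_Icc_pt]; simp only; omega
    have m2 : ((b', d') : Pt) ∈ Finset.Icc ((a, c) : Pt) (b, d) := by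
      rw [heq, mem_Icc_pt]; simp only; omega
    rw [mem_Icc_pt] at m1 m2
    simp only at m1 m2
    omega
  have right : ∀ y, c ≤ y → y ≤ d → (b + 1, y) ∉ A := fun y h1 h2 hy => by
    have hc := h.column (s := b) (s' := b + 1) (by omega)
      (fun y h1 h2 => hmem b y (by omega) le_rfl h1 h2) hy h1 h2
    have := (hext a (b + 1) c d le_rfl (by omega) le_rfl le_rfl fun x y h1 h2 h3 h4 => by
      rcases eq_or_lt_of_le h2 with rfl | h2
      · exact hc y h3 h4
      · exact hmem x y h1 (by omega) h3 h4).2.1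
    omega
  have left : ∀ y, c ≤ y → y ≤ d → (a - 1, y) ∉ A := fun y h1 h2 hy => by
    have hc := h.column (s := a) (s' := a - 1) (by omega)
      (fun y h1 h2 => hmem a y le_rfl (by omega) h1 h2) hy h1 h2
    have := (hext (a - 1) b c d (by omega) le_rfl le_rfl le_rfl fun x y h1 h2 h3 h4 => by
      rcases eq_or_lt_of_le h1 with rfl | h1
      · exact hc y h3 h4
      · exact hmem x y (by omega) h2 h3 h4).1
    omega
  have top : ∀ x, a ≤ x → x ≤ b → (x, d + 1) ∉ A := fun x h1 h2 hx => by
    have hc := h.row (s := d) (s' := d + 1) (by omega)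
      (fun x h1 h2 => hmem x d h1 h2 (by omega) le_rfl) hx h1 h2
    have := (hext a b c (d + 1) le_rfl le_rfl le_rfl (by omega) fun x y h1 h2 h3 h4 => by
      rcases eq_or_lt_of_le h4 with rfl | h4
      · exact hc x h1 h2
      · exact hmem x y h1 h2 h3 (by omega)).2.2.2
    omega
  have bot : ∀ x, a ≤ x → x ≤ b → (x, c - 1) ∉ A := fun x h1 h2 hx => by
    have hc := h.row (s := c) (s' := c - 1) (by omega)
      (fun x h1 h2 => hmem x c h1 h2 le_rfl (by omega)) hx h1 h2
    have := (hext a b (c - 1) d le_rfl le_rfl (by omega) le_rfl fun x y h1 h2 h3 h4 => by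
      rcases eq_or_lt_of_le h3 with rfl | h3
      · exact hc x h1 h2
      · exact hmem x y h1 h2 (by omega) h4).2.2.1
    omega
  have corner : ∀ s t s' t', a ≤ s → s ≤ b → c ≤ t → t ≤ d → (s - s').natAbs = 1 →
      (t - t').natAbs = 1 → (s', t') ∈ A → (s', t) ∈ A :=
    fun s t s' t' h1 h2 h3 h4 h5 h6 h7 => h _ h7 _ (hmem s t h1 h2 h3 h4) _
      (by rw [Ne, Prod.mk.injEq]; omega) (by simp only [d1]; omega) (by simp only [d1]; omega)
  refine ⟨a, b, c, d, by omega, by omega, Set.ext fun p => ⟨fun hp => ?_, fun hp => ?_⟩⟩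
  · induction hp with
    | refl => exact ⟨hq'.1.1, hq'.2.1, hq'.1.2, hq'.2.2⟩
    | tail _ hstep ih =>
      rename_i u v _
      obtain ⟨-, hv, hd⟩ := hstep
      obtain ⟨u1, u2⟩ := u
      obtain ⟨v1, v2⟩ := v
      obtain ⟨i1, i2, i3, i4⟩ := ih
      simp only [dinf] at hd i1 i2 i3 i4
      have hv' : (v1, v2) ∈ A := hv
      have hx : a ≤ v1 ∧ v1 ≤ b := by
        by_contra hh
        have hv'' : (v1, u2) ∈ A := by
          rcases eq_or_ne u2 v2 with rfl | hne
          · exact hv'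
          · exact corner u1 u2 v1 v2 i1 i2 i3 i4 (by omega) (by omega) hv'
        rcases (show v1 = b + 1 ∨ v1 = a - 1 by omega) with rfl | rfl
        · exact right u2 i3 i4 hv''
        · exact left u2 i3 i4 hv''
      have hy : c ≤ v2 ∧ v2 ≤ d := by
        by_contra hh
        rcases (show v2 = d + 1 ∨ v2 = c - 1 by omega) with rfl | rfl
        · exact top v1 hx.1 hx.2 hv'
        · exact bot v1 hx.1 hx.2 hv'
      exact ⟨hx.1, hx.2, hy.1, hy.2⟩
  · have hcl : StepClosed (A : Set Pt) (wkComp A q) := fun u hu v hv huv => by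
      rcases Relation.ReflTransGen.cases_tail_iff _ _ _ |>.1 hu with rfl | ⟨w, -, hw⟩
      · exact .single ⟨hq, hv, by unfold d1 at huv; unfold dinf; omega⟩
      · exact .tail hu ⟨hw.2.1, hv, by unfold d1 at huv; unfold dinf; omega⟩
    have h1 : (p.1, q.2) ∈ wkComp (A : Set Pt) q :=
      hcl.row (x := q.1) .refl fun s _ _ => hmem s q.2 (by grind) (by grind) (by grind) (by grind)
    exact hcl.column h1 fun s _ _ => hmem p.1 s hp.1 hp.2.1 (by grind) (by grind)

lemma exists_two_le_nb {A : Finset Pt} {T : Set Pt} (hA : (A : Set Pt) = T)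
    (h : ¬ ∀ q ∈ T, IsDiscreteRectangle (wkComp T q)) : ∃ w ∉ A, 2 ≤ nb A w := by
  subst hA
  by_contra! hno
  refine h fun q hq => CornerFilled.isDiscreteRectangle (fun p hp q hq w hpq hpw hqw => ?_) hq
  by_contra hw
  exact absurd (two_le_nb hp hq (by rwa [d1_comm]) (by rwa [d1_comm]) hpq) (hno w hw).not_ge

/-! ### Minimizers from staircase sets with long extreme slices -/

section Build

variable {a b δ : ℝ} {φ : Pt → ℤ} {I A I₀ : Finset Pt}

lemma Stair.exists_slice (h : Stair I₀) {y ℓ : ℤ} (hℓ : 1 ≤ ℓ)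
    (hc : ℓ ≤ ({p ∈ (I₀ : Set Pt) | p.2 = y}.ncard : ℤ)) :
    ∃ x₁ x₂, (∀ j, (j, y) ∈ I₀ ↔ x₁ ≤ j ∧ j ≤ x₂) ∧ ℓ ≤ x₂ - x₁ + 1 := by
  set F := I₀.filter fun p => p.2 = y with hF
  have e : {p ∈ (I₀ : Set Pt) | p.2 = y} = F := by simp [hF]
  rw [e, Set.ncard_coe_finset] at hc
  have hne : F.Nonempty := Finset.card_pos.1 (by omega)
  obtain ⟨l, hl, hl'⟩ := F.exists_min_image Prod.fst hne
  obtain ⟨r, hr, hr'⟩ := F.exists_max_image Prod.fst hne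
  have hmem : ∀ p : Pt, p ∈ F ↔ p ∈ I₀ ∧ p.2 = y := fun p => Finset.mem_filter
  refine ⟨l.1, r.1, fun j => ⟨fun hj => ?_, fun hj => ?_⟩, ?_⟩
  · exact ⟨hl' _ ((hmem _).2 ⟨hj, rfl⟩), hr' _ ((hmem _).2 ⟨hj, rfl⟩)⟩
  · obtain ⟨hl1, hl2⟩ := (hmem _).1 hl
    obtain ⟨hr1, hr2⟩ := (hmem _).1 hr
    refine h.hconv l.1 r.1 j y ?_ ?_ hj.1 hj.2
    · rwa [← hl2]
    · rwa [← hr2]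
  · have hsub : F ⊆ (Finset.Icc l.1 r.1).image fun j => (j, y) := fun p hp => by
      rw [Finset.mem_image]
      exact ⟨p.1, Finset.mem_Icc.2 ⟨hl' _ hp, hr' _ hp⟩, Prod.ext rfl ((hmem _).1 hp).2.symm⟩
    have := (Finset.card_le_card hsub).trans Finset.card_image_le
    rw [Int.card_Icc] at this
    omega

lemma Opt.exists_le (h : Opt a b δ φ I A) (hs : Sgn I₀ φ) {p : Pt} (hp : p ∈ I) :
    ∃ q ∈ I₀, q.2 ≤ p.2 := by
  obtain ⟨c, hc, hlow, hright⟩ := exists_lowest_right ⟨p, hp⟩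
  have h1 := h.lowest_nonneg hc hlow hright
  refine ⟨c, ?_, hlow p hp⟩
  by_contra hh
  have := hs.neg hh
  omega

lemma Opt.exists_le_im (h : Opt a b δ φ I A) (hs : Sgn I₀ φ) {g : Pt ≃ Pt} (hg : IsIso g) {p : Pt}
    (hp : p ∈ I) : ∃ q ∈ I₀, (g q).2 ≤ (g p).2 := by
  obtain ⟨q, hq, hle⟩ := (h.im hg).exists_le (hs.im hg) (p := g p) (by simpa [mem_im] using hp)
  exact ⟨g.symm q, mem_im.1 hq, by simpa using hle⟩

lemma Opt.subset_box (h : Opt a b δ φ I A) (hs : Sgn I₀ φ) {x₁ x₂ y₁ y₂ : ℤ}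
    (hbox : ∀ p ∈ I₀, y₁ ≤ p.2 ∧ p.2 ≤ y₂ ∧ x₁ ≤ p.1 ∧ p.1 ≤ x₂) :
    ∀ p ∈ I, y₁ ≤ p.2 ∧ p.2 ≤ y₂ ∧ x₁ ≤ p.1 ∧ p.1 ≤ x₂ := by
  intro p hp
  obtain ⟨q, hq, e1⟩ := h.exists_le hs hp
  obtain ⟨q', hq', e2⟩ := h.exists_le_im hs isIso_flipY hp
  obtain ⟨q'', hq'', e3⟩ := h.exists_le_im hs isIso_swapXY hp
  obtain ⟨q''', hq''', e4⟩ := h.exists_le_im hs (isIso_flipX.trans isIso_swapXY) hp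
  have := hbox q hq
  have := hbox q' hq'
  have := hbox q'' hq''
  have := hbox q''' hq'''
  simp only [flipY, flipX, swapXY, Equiv.coe_fn_mk, Equiv.trans_apply] at e2 e3 e4
  omega

lemma card_le_of_box {T : Finset Pt} {x₁ x₂ y₁ y₂ D : ℤ}
    (hbox : ∀ p ∈ T, y₁ ≤ p.2 ∧ p.2 ≤ y₂ ∧ x₁ ≤ p.1 ∧ p.1 ≤ x₂) (hD : 0 ≤ D) (hx : x₂ - x₁ ≤ D)
    (hy : y₂ - y₁ ≤ D) : (T.card : ℝ) ≤ ((D : ℝ) + 1) ^ 2 := by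
  have hsub : T ⊆ Finset.Icc x₁ x₂ ×ˢ Finset.Icc y₁ y₂ := fun p hp => by
    have := hbox p hp
    simp only [Finset.mem_product, Finset.mem_Icc]
    omega
  have h1 := Finset.card_le_card hsub
  rw [Finset.card_product, Int.card_Icc, Int.card_Icc] at h1
  have h2 : T.card ≤ (D + 1).toNat * (D + 1).toNat :=
    h1.trans (Nat.mul_le_mul (by omega) (by omega))
  have h3 : ((D + 1).toNat : ℝ) = (D : ℝ) + 1 := by
    have : ((D + 1).toNat : ℤ) = D + 1 := Int.toNat_of_nonneg (by omega)
    exact_mod_cast this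
  calc (T.card : ℝ) ≤ ((D + 1).toNat : ℝ) * (D + 1).toNat := by exact_mod_cast h2
    _ = ((D : ℝ) + 1) ^ 2 := by rw [h3]; ring

lemma Opt.setup (h : Opt a b δ φ I A) (hs : Sgn I₀ φ) (hst : Stair I₀) (hspot : ∃ w ∉ A, 2 ≤ nb A w)
    {R : ℕ} {ℓ D y₁ y₂ x₁ x₂ : ℤ} (hbox : ∀ p ∈ I₀, y₁ ≤ p.2 ∧ p.2 ≤ y₂ ∧ x₁ ≤ p.1 ∧ p.1 ≤ x₂)
    (hy₁ : ℓ ≤ ({p ∈ (I₀ : Set Pt) | p.2 = y₁}.ncard : ℤ))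
    (hy₂ : ℓ ≤ ({p ∈ (I₀ : Set Pt) | p.2 = y₂}.ncard : ℤ))
    (hx₁ : ℓ ≤ ({p ∈ (I₀ : Set Pt) | p.1 = x₁}.ncard : ℤ))
    (hx₂ : ℓ ≤ ({p ∈ (I₀ : Set Pt) | p.1 = x₂}.ncard : ℤ))
    (hdiam : ∀ p ∈ I₀, ∀ q ∈ I₀, |p.1 - q.1| ≤ D ∧ |p.2 - q.2| ≤ D) (hR : 1 ≤ R)
    (hsmall : Real.exp (-(δ * R ^ 2 / 12)) * ((D : ℝ) + 1) ^ 2 < 1) (hℓ : 100 * (R : ℤ) ≤ ℓ) :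
    Setup a b δ φ I A I₀ R ℓ D := by
  have hcol : ∀ x, ℓ ≤ ({p ∈ (I₀ : Set Pt) | p.1 = x}.ncard : ℤ) →
      ∃ y₁ y₂, (∀ j, (x, j) ∈ I₀ ↔ y₁ ≤ j ∧ j ≤ y₂) ∧ ℓ ≤ y₂ - y₁ + 1 := fun x hx => by
    have := hst.swapXY.exists_slice (y := x) (ℓ := ℓ) (by omega) (hx.trans_eq ?_)
    · simpa using this
    · rw [← Set.ncard_image_of_injective _ swapXY.injective]
      congr 2
      ext ⟨u, v⟩
      constructor
      · rintro ⟨p, ⟨h1, h2⟩, h3⟩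
        obtain ⟨rfl, rfl⟩ := Prod.mk.inj h3
        exact ⟨mem_im.2 h1, h2⟩
      · exact fun hh => ⟨(v, u), ⟨mem_im.1 hh.1, hh.2⟩, rfl⟩
  obtain ⟨b₁, b₂, hb, hbℓ⟩ := hst.exists_slice (by omega) hy₁
  obtain ⟨t₁, t₂, ht, htℓ⟩ := hst.exists_slice (by omega) hy₂
  obtain ⟨l₁, l₂, hl, hlℓ⟩ := hcol _ hx₁
  obtain ⟨r₁, r₂, hr, hrℓ⟩ := hcol _ hx₂
  have mb : (b₁, y₁) ∈ I₀ := (hb _).2 (by omega)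
  have mt : (t₁, y₂) ∈ I₀ := (ht _).2 (by omega)
  have ml : (x₁, l₁) ∈ I₀ := (hl _).2 (by omega)
  have mr : (x₂, r₁) ∈ I₀ := (hr _).2 (by omega)
  have dx := (hdiam _ mr _ ml).1
  have dy := (hdiam _ mt _ mb).2
  have hD : 0 ≤ D := (abs_nonneg _).trans dx
  have hK₀ := card_le_of_box hbox hD ((le_abs_self _).trans dx) ((le_abs_self _).trans dy)
  have hK := card_le_of_box (h.subset_box hs hbox) hD ((le_abs_self _).trans dx)
    ((le_abs_self _).trans dy)
  exact
    { opt := h, sgn := hs, stair := hst, spot := hspot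
      din := fun p hp => h.decay_inside hs hK₀ hR hsmall hp
      dout := fun p hp => h.decay_outside hs hK hR hsmall hp
      bot := ⟨y₁, b₁, b₂, fun p hp => (hbox p hp).1, hb, hbℓ⟩
      top := ⟨y₂, t₁, t₂, fun p hp => (hbox p hp).2.1, ht, htℓ⟩
      left := ⟨x₁, l₁, l₂, fun p hp => (hbox p hp).2.2.1, hl, hlℓ⟩
      right := ⟨x₂, r₁, r₂, fun p hp => (hbox p hp).2.2.2, hr, hrℓ⟩
      diam := hdiam
      R_pos := by exact_mod_cast hR
      ℓ_large := hℓ }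

end Build

section Component

variable {a b δ : ℝ} {φ : Pt → ℤ} {I A I₀ : Finset Pt} {R ℓ D y₀ x₁ x₂ M : ℤ} {C : Set Pt}

/-- A step-closed set containing the deep points contains the block above the lowest slice. -/
lemma Setup.mem_of_stepClosed (h : Setup a b δ φ I A I₀ R ℓ D) (hb : Bot I₀ y₀ x₁ x₂ ℓ)
    (hC : StepClosed I C) (hdeep : ∀ p, M ≤ φ p → p ∈ C) (hM₁ : 1 ≤ M) (hM : 2 * M ≤ ℓ) {x : ℤ}
    (h1 : x₁ + 2 * R ≤ x) (h2 : x ≤ x₂ - 2 * R) : (x, y₀ + 2 * R) ∈ C := by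
  have hR := h.R_pos
  have hℓ := h.ℓ_large
  have hlen := hb.len
  have hmid : ((x₁ + x₂) / 2, y₀ + ℓ / 2) ∈ C :=
    hdeep _ (h.le_block hb hM₁ (by omega) (by omega) (by omega) (by omega))
  have hmem : ∀ s t, x₁ + 2 * R ≤ s → s ≤ x₂ - 2 * R → y₀ + 2 * R ≤ t → t ≤ y₀ + ℓ / 2 →
      (s, t) ∈ I := fun s t k1 k2 k3 k4 =>
    h.din _ (h.le_block hb (by omega) (by omega) (by omega) (by omega) (by omega))
  have h3 : (x, y₀ + ℓ / 2) ∈ C :=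
    hC.row hmid fun s k1 k2 => hmem _ _ (by omega) (by omega) (by omega) (by omega)
  exact hC.column h3 fun s k1 k2 => hmem _ _ (by omega) (by omega) (by omega) (by omega)

lemma Setup.exists_low_of_stepClosed (h : Setup a b δ φ I A I₀ R ℓ D) (hb : Bot I₀ y₀ x₁ x₂ ℓ)
    (hC : StepClosed I C) (hdeep : ∀ p, M ≤ φ p → p ∈ C) (hM₁ : 1 ≤ M) (hM : 2 * M ≤ ℓ) :
    ∃ q ∈ C, q ∈ I ∧ δ * ℓ * ((q.2 - y₀ : ℤ) : ℝ) ≤ 16 := by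
  obtain ⟨j, r, h1, h2, h3, h4, h5⟩ := h.exists_near_bot hb
  refine ⟨(j, r), ?_, h4 r le_rfl h3, h5⟩
  exact hC.column (h.mem_of_stepClosed hb hC hdeep hM₁ hM h1 h2) fun s k1 k2 =>
    h4 s (by omega) (by omega)

/-- Points of `I₀` below a large component are close to the boundary of `I₀`. -/
lemma Setup.depth_le_of_below (h : Setup a b δ φ I A I₀ R ℓ D)
    (hC : StepClosed I C) (hdeep : ∀ p, M ≤ φ p → p ∈ C) (hM₁ : 1 ≤ M) (hM : 2 * M ≤ ℓ)
    {p : Pt} (hp : p ∈ I₀) (hlow : ∀ q ∈ C, p.2 < q.2) : δ * ℓ * (φ p : ℝ) ≤ 16 := by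
  obtain ⟨y₀, x₁, x₂, k1, k2, k3⟩ := h.bot
  have hR := h.R_pos
  have hℓ := h.ℓ_large
  obtain ⟨q, hq, -, hle⟩ := h.exists_low_of_stepClosed ⟨k1, fun j l1 l2 => (k2 j).2 ⟨l1, l2⟩, k3⟩ hC
    hdeep hM₁ hM
  have h1 : φ p ≤ d1 p (p.1, y₀ - 1) := h.sgn.in_le p hp _ fun hh => by
    have := k1 _ hh
    simp only at this
    omega
  have h2 := k1 p hp
  have h3 := hlow q hq
  have h4 : φ p ≤ q.2 - y₀ := by
    simp only [d1] at h1
    omega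
  have h5 : (φ p : ℝ) ≤ ((q.2 - y₀ : ℤ) : ℝ) := by exact_mod_cast h4
  have h6 : 0 ≤ δ * ℓ := mul_nonneg h.opt.hδ.le (by exact_mod_cast (by omega : (0 : ℤ) ≤ ℓ))
  exact (mul_le_mul_of_nonneg_left h5 h6).trans hle

lemma StepClosed.im (hC : StepClosed I C) {g : Pt ≃ Pt} (hg : IsIso g) :
    StepClosed (im g I) (g.symm ⁻¹' C) := fun p hp r hr hpr =>
  hC _ hp _ (mem_im.1 hr) (by rw [hg.symm, hpr])

/-- Points of `I₀` outside the bounding box of a large component are close to the boundary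
of `I₀`. -/
lemma Setup.depth_le_of_notMem_Rbox (h : Setup a b δ φ I A I₀ R ℓ D)
    (hC : StepClosed I C) (hdeep : ∀ p, M ≤ φ p → p ∈ C) (hM₁ : 1 ≤ M) (hM : 2 * M ≤ ℓ)
    {p : Pt} (hp : p ∈ I₀) (hbox : p ∉ Rbox C) : δ * ℓ * (φ p : ℝ) ≤ 16 := by
  by_contra hcon
  refine hbox ⟨?_, ?_, ?_, ?_⟩ <;> by_contra! hno <;> refine hcon ?_
  · have := h.swapXY.depth_le_of_below (hC.im isIso_swapXY) (fun q hq => hdeep _ hq) hM₁ hM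
      (p := BEG.swapXY p) (by simpa [mem_im] using hp) fun q hq => hno _ hq
    simpa using this
  · have := h.flipX.swapXY.depth_le_of_below ((hC.im isIso_flipX).im isIso_swapXY)
      (fun q hq => hdeep _ hq) hM₁ hM (p := BEG.swapXY (BEG.flipX p)) (by simpa [mem_im] using hp)
      fun q hq => by
        have := hno _ hq
        simp only [BEG.swapXY, BEG.flipX, Equiv.coe_fn_mk, Equiv.coe_fn_symm_mk] at this ⊢
        omega
    simpa using this
  · exact h.depth_le_of_below hC hdeep hM₁ hM hp hno
  · have := h.flipY.depth_le_of_below (hC.im isIso_flipY) (fun q hq => hdeep _ hq) hM₁ hM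
      (p := BEG.flipY p) (by simpa [mem_im] using hp) fun q hq => by
        have := hno _ hq
        simp only [BEG.flipY, Equiv.coe_fn_mk, Equiv.coe_fn_symm_mk] at this ⊢
        omega
    simpa using this

end Component

section LowSides

variable {a b δ : ℝ} {φ : Pt → ℤ} {I A I₀ : Finset Pt} {R ℓ D y₀ x₁ x₂ M : ℤ} {C : Set Pt}

/-- Lower sides of a large component away from the ends of the lowest slice are close to it. -/
lemma Setup.low_side (h : Setup a b δ φ I A I₀ R ℓ D) (hb : Bot I₀ y₀ x₁ x₂ ℓ)
    (hC : StepClosed I C) (hCI : C ⊆ I)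
    (hconn : ∀ p ∈ C, ∀ q ∈ C, Relation.ReflTransGen (fun a b => b ∈ I ∧ d1 a b = 1) p q)
    (hdeep : ∀ p, M ≤ φ p → p ∈ C) (hM₁ : 1 ≤ M) (hM : 2 * M ≤ ℓ)
    (hc₁ : 16 ≤ δ * ℓ * R) (hsmall : δ * (16 / (δ * ℓ) + 1) * (18 * R / a) < 2 * a)
    {n B : ℤ} {k : ℕ} (hB : 0 ≤ B) (hk : D < k * (B + 1)) (hn : 8 * R * k ≤ n)
    (hbig : 8 * ((B : ℝ) + 2 * R) < a * n) (hRM : 5 * R ≤ 2 * (M - 1))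
    (hnM : 3 * n + 1 ≤ 2 * (M - 1)) {p : Pt} (hp : p ∈ C) (hp' : (p.1, p.2 - 1) ∉ C)
    (h1 : x₁ + 2 * (M - 1) ≤ p.1) (h2 : p.1 ≤ x₂ - 2 * (M - 1)) :
    (∀ q ∈ C, p.2 ≤ q.2 + 1) ∧ y₀ ≤ p.2 ∧ δ * ℓ * ((p.2 - y₀ - 1 : ℤ) : ℝ) ≤ 16 := by
  have hR := h.R_pos
  have hℓ := h.ℓ_large
  have hpI' : (p.1, p.2 - 1) ∉ I := fun hh => hp' (hC p hp _ hh (by simp [d1]))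
  have hp2 : p.2 ≤ y₀ + 2 * R := by
    by_contra! hh
    exact h.false_of_above hb hB hk hn hbig (hCI hp) hpI' (by omega) (by omega) hh
      (hconn _ (h.mem_of_stepClosed hb hC hdeep hM₁ hM (by omega) (by omega)) _ hp)
  have hle := h.bot_le hb hc₁ hsmall (hCI hp) hpI' (by omega) (by omega) hp2
  refine ⟨fun q hq => hle q (hCI hq), h.low hb.le p (hCI hp), ?_⟩
  obtain ⟨q, -, hqI, hq⟩ := h.exists_low_of_stepClosed hb hC hdeep hM₁ hM
  have h5 : ((p.2 - y₀ - 1 : ℤ) : ℝ) ≤ ((q.2 - y₀ : ℤ) : ℝ) := by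
    have := hle q hqI
    exact_mod_cast (by omega : p.2 - y₀ - 1 ≤ q.2 - y₀)
  have h6 : 0 ≤ δ * ℓ := mul_nonneg h.opt.hδ.le (by exact_mod_cast (by omega : (0 : ℤ) ≤ ℓ))
  exact (mul_le_mul_of_nonneg_left h5 h6).trans hq

end LowSides

/-! ### Strongly connected components -/

lemma stStep_comm {T : Set Pt} {p q : Pt} (h : stStep T p q) : stStep T q p :=
  ⟨h.2.1, h.1, by rw [d1_comm, h.2.2]⟩

lemma stComp_subset {T : Set Pt} {p : Pt} (hp : p ∈ T) : stComp T p ⊆ T := fun q hq => by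
  rcases Relation.ReflTransGen.cases_tail_iff _ _ _ |>.1 hq with rfl | ⟨w, -, hw⟩
  · exact hp
  · exact hw.2.1

lemma stepClosed_stComp {T : Set Pt} {p : Pt} (hp : p ∈ T) : StepClosed T (stComp T p) :=
  fun _ hq _ hr hqr => hq.tail ⟨stComp_subset hp hq, hr, hqr⟩

lemma conn_stComp {T : Set Pt} {p q r : Pt} (hq : q ∈ stComp T p) (hr : r ∈ stComp T p) :
    Relation.ReflTransGen (fun a b => b ∈ T ∧ d1 a b = 1) q r := by
  have : Std.Symm (stStep T) := ⟨fun _ _ => stStep_comm⟩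
  have h1 : Relation.ReflTransGen (stStep T) q p := Std.Symm.symm p q hq
  exact (h1.trans hr).lift id fun _ _ hab => ⟨hab.2.1, hab.2.2⟩

/-! ### Choice of the parameters -/

open Filter Real in
lemma eventually_mul_rpow_le (C : ℝ) {α β : ℝ} (h : α < β) :
    ∀ᶠ t : ℝ in atTop, C * t ^ α ≤ t ^ β := by
  filter_upwards [(tendsto_rpow_atTop (sub_pos.2 h)).eventually_ge_atTop C,
    eventually_gt_atTop 0] with t ht ht0
  calc C * t ^ α ≤ t ^ (β - α) * t ^ α := by gcongr
    _ = t ^ β := by rw [← rpow_add ht0]; ring_nf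

open Filter Real in
lemma eventually_exp_mul_sq_lt {c d η : ℝ} (hc : 0 < c) (hd : 0 < d) (hη : 0 < η) :
    ∀ᶠ t : ℝ in atTop, exp (-(c * t ^ η)) * (d * t) ^ 2 < 1 := by
  have h1 := (isLittleO_log_rpow_atTop hη).bound (c := c / 4) (by positivity)
  filter_upwards [h1, eventually_gt_atTop 0, eventually_mul_rpow_le (4 * |log d| / c + 1) hη,
    eventually_ge_atTop 1] with t h1 ht0 h2 ht1
  rw [rpow_zero, mul_one] at h2
  rw [norm_of_nonneg (rpow_nonneg ht0.le η), norm_of_nonneg (log_nonneg ht1)] at h1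
  have h3 : 4 * |log d| + c ≤ c * t ^ η := by
    calc 4 * |log d| + c = c * (4 * |log d| / c + 1) := by field_simp
      _ ≤ _ := by gcongr
  have h4 := le_abs_self (log d)
  have h5 : (d * t) ^ 2 = exp (2 * (log d + log t)) := by
    rw [← log_mul hd.ne' ht0.ne', two_mul, exp_add, exp_log (by positivity)]
    ring
  rw [h5, ← exp_add, exp_lt_one_iff]
  linarith

/-- The number of vacancy chains and the height of a step of the profile. -/
lemma exists_chain_parameters {a r m D : ℝ} {R : ℕ} {M D' : ℤ} (ha : 0 < a) (hR : 1 ≤ R)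
    (hRr : (R : ℝ) ≤ 2 * r) (hm : 4 ≤ m) (hM : m - 1 < M) (hD0 : 0 ≤ D') (hD : (D' : ℝ) ≤ D)
    (h1 : 128 * r ≤ m) (h2 : 256 * r < a * m) (h3 : 8192 * (r * D) < a * m ^ 2) :
    ∃ (n B : ℤ) (j : ℕ), 0 ≤ B ∧ D' < j * (B + 1) ∧ 8 * (R : ℤ) * j ≤ n ∧
      8 * ((B : ℝ) + 2 * (R : ℤ)) < a * n ∧ 3 * n + 1 ≤ 2 * M := by
  have hRz : (1 : ℤ) ≤ R := by exact_mod_cast hR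
  have hR0 : (1 : ℝ) ≤ R := by exact_mod_cast hR
  have hM3 : 2 < M := by
    have : (2 : ℝ) < M := by linarith
    exact_mod_cast this
  set n : ℤ := M / 2 with hn
  have hn1 : m / 4 ≤ n := by
    have : M ≤ 2 * n + 1 := by omega
    have : (M : ℝ) ≤ 2 * n + 1 := by exact_mod_cast this
    linarith
  have hn16 : 16 * (R : ℤ) ≤ n := by
    have : 16 * (R : ℝ) ≤ n := by linarith
    exact_mod_cast this
  set i : ℤ := n / (8 * R) with hi
  have hi1 : 8 * (R : ℤ) * i ≤ n := Int.mul_ediv_self_le (by omega)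
  have hi2 : n < (i + 1) * (8 * R) := Int.lt_ediv_add_one_mul_self _ (by omega)
  have hi0 : 1 ≤ i := by
    by_contra! hh
    have : (i + 1) * (8 * R) ≤ 1 * (8 * (R : ℤ)) := by gcongr; omega
    omega
  have hi3 : n ≤ 16 * R * i := by nlinarith
  set B : ℤ := D' / i with hB
  have hB0 : 0 ≤ B := Int.ediv_nonneg hD0 (by omega)
  have hBi : i * B ≤ D' := Int.mul_ediv_self_le (by omega)
  have hji : ((i.toNat : ℕ) : ℤ) = i := Int.toNat_of_nonneg (by omega)
  refine ⟨n, B, i.toNat, hB0, ?_, ?_, ?_, by omega⟩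
  · rw [hji, mul_comm]
    exact Int.lt_ediv_add_one_mul_self _ (by omega)
  · rwa [hji]
  · have hn0 : (0 : ℝ) < n := by linarith
    have e1 : (B : ℝ) * n ≤ 16 * R * D := by
      have : B * n ≤ 16 * R * D' := by
        calc B * n ≤ B * (16 * R * i) := by gcongr
          _ = 16 * R * (i * B) := by ring
          _ ≤ 16 * R * D' := by gcongr
      have : (B : ℝ) * n ≤ 16 * R * D' := by exact_mod_cast this
      exact this.trans (by gcongr)
    have hD'' : (0 : ℝ) ≤ D := le_trans (by exact_mod_cast hD0) hD
    have e2 : (R : ℝ) * D ≤ 2 * (r * D) := by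
      calc (R : ℝ) * D ≤ 2 * r * D := by gcongr
        _ = _ := by ring
    have e3 : a * m ^ 2 ≤ a * (16 * (n : ℝ) ^ 2) := by
      have : m ^ 2 ≤ (4 * (n : ℝ)) ^ 2 := by gcongr; linarith
      gcongr
      linarith
    have e4 : 32 * (R : ℝ) < a * n := by
      have : a * m ≤ a * (4 * n) := by gcongr; linarith
      linarith
    have e5 : 32 * (R : ℝ) * n < a * n * n := by gcongr
    have e6 : 8 * ((B : ℝ) + 2 * R) * n < a * n * n := by nlinarith
    have := lt_of_mul_lt_mul_right e6 hn0.le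
    simpa using this

open Filter Real in
lemma eventually_exists_parameters {a ζ cbar ρ μ : ℝ} (ha : 0 < a) (hζ : 0 < ζ) (hc : 0 < cbar)
    (hρ : 0 ≤ ρ) (hμ : 0 < μ) (hμ' : μ < 1 / 4) :
    ∀ᶠ t : ℝ in atTop, ∃ (R : ℕ) (n B : ℤ) (j : ℕ), 1 ≤ R ∧ 100 * (R : ℤ) ≤ ⌈cbar * t⌉ ∧
      2 * (⌊t ^ (1 - μ)⌋ + 1) ≤ ⌈cbar * t⌉ ∧ 16 ≤ t⁻¹ / ζ * ⌈cbar * t⌉ * (R : ℤ) ∧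
      t⁻¹ / ζ * (16 / (t⁻¹ / ζ * ⌈cbar * t⌉) + 1) * (18 * (R : ℤ) / a) < 2 * a ∧
      exp (-(t⁻¹ / ζ * (R : ℝ) ^ 2 / 12)) * ((⌈ρ * t⌉ : ℝ) + 1) ^ 2 < 1 ∧
      0 ≤ B ∧ ⌈ρ * t⌉ < j * (B + 1) ∧ 8 * (R : ℤ) * j ≤ n ∧ 8 * ((B : ℝ) + 2 * (R : ℤ)) < a * n ∧
      5 * (R : ℤ) ≤ 2 * ⌊t ^ (1 - μ)⌋ ∧ 3 * n + 1 ≤ 2 * ⌊t ^ (1 - μ)⌋ ∧ 0 ≤ ⌊t ^ (1 - μ)⌋ := by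
  set θ : ℝ := 3 / 4 - μ with hθ
  set q : ℝ := 16 * ζ / cbar + 1 with hq
  have hq0 : 0 < q := by positivity
  filter_upwards [eventually_gt_atTop 0, eventually_ge_atTop 1,
    eventually_mul_rpow_le q (show (0 : ℝ) < θ by linarith),
    eventually_mul_rpow_le (200 / cbar) (show θ < 1 by linarith),
    eventually_mul_rpow_le (18 * q / (a ^ 2 * ζ) + 1) (show θ < 1 by linarith),
    eventually_exp_mul_sq_lt (c := 1 / (12 * ζ)) (d := ρ + 2) (η := 2 * θ - 1) (by positivity)
      (by positivity) (by linarith),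
    eventually_mul_rpow_le 4 (show (0 : ℝ) < 1 - μ by linarith),
    eventually_mul_rpow_le 128 (show θ < 1 - μ by linarith),
    eventually_mul_rpow_le (256 / a + 1) (show θ < 1 - μ by linarith),
    eventually_mul_rpow_le (4 / cbar) (show 1 - μ < 1 by linarith),
    eventually_mul_rpow_le (8192 * (ρ + 1) / a + 1) (show θ + 1 < (1 - μ) * 2 by linarith)]
    with t ht ht1 h1 h2 h3 h4 h5 h6 h7 h8 h9
  rw [rpow_zero, mul_one] at h1 h5
  rw [rpow_one] at h2 h3 h8
  rw [rpow_add ht, rpow_one, rpow_mul ht.le, rpow_two] at h9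
  set r := t ^ θ with hr
  set m := t ^ (1 - μ) with hm
  have hr1 : 1 ≤ r := by
    refine le_trans ?_ h1
    rw [hq]
    linarith [show 0 < 16 * ζ / cbar by positivity]
  have hr0 : 0 < r := by linarith
  have hm0 : 0 < m := by linarith
  set R : ℕ := ⌈r⌉₊ with hR
  have hRr : r ≤ R := Nat.le_ceil r
  have hRr' : (R : ℝ) ≤ 2 * r := by
    have := Nat.ceil_lt_add_one hr0.le
    linarith
  have hRR : 1 ≤ R := by exact_mod_cast hr1.trans hRr
  have hL := Int.le_ceil (cbar * t)
  have hM := Int.floor_le m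
  have hM' := Int.sub_one_lt_floor m
  have hD := (Int.ceil_lt_add_one (ρ * t)).le
  have hD0 : 0 ≤ ⌈ρ * t⌉ := Int.ceil_nonneg (by positivity)
  have hD1 : ρ * t + 1 ≤ (ρ + 1) * t := by linarith
  obtain ⟨n, B, j, g1, g2, g3, g4, g5⟩ := exists_chain_parameters (D := (ρ + 1) * t) ha hRR hRr' h5
    hM' hD0 (hD.trans hD1) h6 (by
      have e : (256 / a + 1) * r * a ≤ m * a := by gcongr
      have e' : (256 / a + 1) * r * a = 256 * r + r * a := by field_simp
      have : 0 < r * a := by positivity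
      linarith) (by
      have e : (8192 * (ρ + 1) / a + 1) * (r * t) * a ≤ m ^ 2 * a := by gcongr
      have e' : (8192 * (ρ + 1) / a + 1) * (r * t) * a =
        8192 * (r * ((ρ + 1) * t)) + r * t * a := by field_simp
      have : 0 < r * t * a := by positivity
      linarith)
  have hcL : cbar / ζ ≤ t⁻¹ / ζ * ⌈cbar * t⌉ := by
    calc cbar / ζ = t⁻¹ / ζ * (cbar * t) := by field_simp
      _ ≤ _ := by gcongr
  have hcζ : 0 < cbar / ζ := by positivity
  refine ⟨R, n, B, j, hRR, ?_, ?_, ?_, ?_, ?_, g1, g2, g3, g4, ?_, g5, Int.floor_nonneg.2 hm0.le⟩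
  · have e : 200 * r ≤ cbar * t := by
      calc 200 * r = cbar * (200 / cbar * r) := by field_simp
        _ ≤ _ := by gcongr
    have : 100 * (R : ℝ) ≤ ⌈cbar * t⌉ := by linarith
    exact_mod_cast this
  · have e : 4 * m ≤ cbar * t := by
      calc 4 * m = cbar * (4 / cbar * m) := by field_simp
        _ ≤ _ := by gcongr
    have : 2 * ((⌊m⌋ : ℝ) + 1) ≤ ⌈cbar * t⌉ := by linarith
    exact_mod_cast this
  · calc (16 : ℝ) = cbar / ζ * (16 * ζ / cbar) := by field_simp
      _ ≤ cbar / ζ * r := by gcongr; linarith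
      _ ≤ t⁻¹ / ζ * ⌈cbar * t⌉ * (R : ℤ) := by
        rw [Int.cast_natCast]
        gcongr
  · have e1 : 16 / (t⁻¹ / ζ * ⌈cbar * t⌉) + 1 ≤ q := by
      have e0 : 16 / (t⁻¹ / ζ * ⌈cbar * t⌉) ≤ 16 * ζ / cbar := by
        calc 16 / (t⁻¹ / ζ * ⌈cbar * t⌉) ≤ 16 / (cbar / ζ) := by gcongr
          _ = 16 * ζ / cbar := by field_simp
      rw [hq]
      linarith
    have e2 : 18 * q * r < a ^ 2 * ζ * t := by
      have e : a ^ 2 * ζ * ((18 * q / (a ^ 2 * ζ) + 1) * r) ≤ a ^ 2 * ζ * t := by gcongr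
      have e' : a ^ 2 * ζ * ((18 * q / (a ^ 2 * ζ) + 1) * r) = 18 * q * r + a ^ 2 * ζ * r := by
        field_simp
      have : 0 < a ^ 2 * ζ * r := by positivity
      linarith
    calc t⁻¹ / ζ * (16 / (t⁻¹ / ζ * ⌈cbar * t⌉) + 1) * (18 * (R : ℤ) / a)
        ≤ t⁻¹ / ζ * q * (18 * (2 * r) / a) := by
          rw [Int.cast_natCast]
          gcongr
      _ = 2 * (18 * q * r) / (t * ζ * a) := by field_simp
      _ < 2 * (a ^ 2 * ζ * t) / (t * ζ * a) := by gcongr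
      _ = 2 * a := by field_simp
  · refine lt_of_le_of_lt ?_ h4
    have e : 1 / (12 * ζ) * t ^ (2 * θ - 1) ≤ t⁻¹ / ζ * (R : ℝ) ^ 2 / 12 := by
      rw [rpow_sub ht, rpow_one, mul_comm 2 θ, rpow_mul ht.le, rpow_two, ← hr]
      calc 1 / (12 * ζ) * (r ^ 2 / t) = t⁻¹ / ζ * r ^ 2 / 12 := by field_simp
        _ ≤ _ := by gcongr
    have e' : (0 : ℝ) ≤ ⌈ρ * t⌉ := by exact_mod_cast hD0
    gcongr
    linarith
  · have : 5 * (R : ℝ) ≤ 2 * ⌊m⌋ := by linarith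
    exact_mod_cast this

/-! ### The main result -/

lemma IsStaircase.stair {I₀ : Finset Pt} (h : IsStaircase (I₀ : Set Pt)) : Stair I₀ :=
  ⟨fun p hp q hq =>
      Relation.ReflTransGen.mono (fun _ _ hab => ⟨hab.2.1, hab.2.2⟩) _ _ (h.1 p hp q hq),
    fun x x' s y h1 h2 h3 h4 => h.2.1 (x, y) h1 (x', y) h2 rfl (s, y) rfl h3 h4,
    fun x y y' s h1 h2 h3 h4 => h.2.2 (x, y) h1 (x, y') h2 rfl (x, s) rfl h3 h4⟩

/-- Two lattice coordinates in a ball of radius `Rbar` differ by at most `2 |Rbar| / ε`. -/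
lemma abs_sub_le_ceil {ε Rbar z : ℝ} {m n : ℤ} (hε : 0 < ε) (hm : (ε * m - z) ^ 2 ≤ Rbar ^ 2)
    (hn : (ε * n - z) ^ 2 ≤ Rbar ^ 2) : |m - n| ≤ ⌈2 * |Rbar| * ε⁻¹⌉ := by
  have h1 := abs_le.1 (sq_le_sq.1 hm)
  have h2 := abs_le.1 (sq_le_sq.1 hn)
  have key : |(m : ℝ) - n| ≤ 2 * |Rbar| * ε⁻¹ := by
    rw [← div_eq_mul_inv, le_div_iff₀ hε, ← abs_of_pos hε, ← abs_mul, abs_le]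
    constructor <;> linarith [h1.1, h1.2, h2.1, h2.2]
  have := key.trans (Int.le_ceil _)
  exact_mod_cast this

lemma rpow_eq_mul_inv_rpow {ε : ℝ} (hε : 0 < ε) (μ : ℝ) : ε ^ μ = ε * (ε⁻¹) ^ (1 - μ) := by
  rw [Real.inv_rpow hε.le, ← Real.rpow_neg hε.le]
  nth_rewrite 2 [← Real.rpow_one ε]
  rw [← Real.rpow_add hε]
  congr 1
  ring

lemma natAbs_cast_eq_ofReal {m : ℤ} (hm : 0 ≤ m) : (m.natAbs : ℝ≥0∞) = ENNReal.ofReal m := by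
  rw [← ENNReal.ofReal_natCast, Nat.cast_natAbs, abs_of_nonneg hm]

/-- Sites deeper than the width of the close layer avoid it. -/
lemma notMem_closeLayer {ε μ : ℝ} (hε : 0 < ε) {S : Set Pt} {p : Pt} {m : ℤ}
    (hm : dB p S = (m.natAbs : ℝ≥0∞)) (h : ⌊(ε⁻¹) ^ (1 - μ)⌋ + 1 ≤ m) :
    p ∉ closeLayer ε μ S := by
  rintro ⟨-, hle⟩
  have h0 : 0 ≤ ⌊(ε⁻¹) ^ (1 - μ)⌋ := Int.floor_nonneg.2 (by positivity)
  rw [hm, natAbs_cast_eq_ofReal (by omega), ← ENNReal.ofReal_mul hε.le,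
    ENNReal.ofReal_le_ofReal_iff (by positivity), rpow_eq_mul_inv_rpow hε,
    mul_le_mul_iff_right₀ hε] at hle
  have := Int.lt_floor_add_one ((ε⁻¹) ^ (1 - μ))
  have h' : ((⌊(ε⁻¹) ^ (1 - μ)⌋ : ℝ)) + 1 ≤ m := by exact_mod_cast h
  linarith

/-- Lemma 3.11: distance of the low horizontal sides of the large component `I`
of `I₁` from the lowest slice `H^{0,1} = [p', q']` of `I₀`. -/
theorem statement8 (k ζ γ cbar : ℝ) (hk₁ : 1 / 3 < k) (hk₂ : k < 1) (hζ : 0 < ζ)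
    (hγ : 0 < γ) (hc : 0 < cbar) :
    ∃ c > 0, ∀ Rbar μ : ℝ, 0 < μ → μ < 1 / 4 →
      ∃ εbar > 0, ∀ ε : ℝ, 0 < ε → ε ≤ εbar →
        ∀ u₀ u₁ : Config, AssumpH cbar Rbar ε (Iset u₀) →
          Minimizes ε k ζ γ u₁ u₀ →
          ∀ I : Set Pt, (∃ p₀ ∈ Iset u₁, I = stComp (Iset u₁) p₀) →
            (Iset u₀ \ closeLayer ε μ (Iset u₀)) ⊆ I →
            (¬ ∀ q ∈ Iset u₁ ∪ Zset u₁,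
                IsDiscreteRectangle (wkComp (Iset u₁ ∪ Zset u₁) q)) →
            ∀ p' q' : Pt, p' ∈ Iset u₀ → q' ∈ Iset u₀ → p'.2 = q'.2 →
              (∀ p ∈ Iset u₀, p'.2 ≤ p.2) →
              (∀ p ∈ Iset u₀, p.2 = p'.2 → p'.1 ≤ p.1 ∧ p.1 ≤ q'.1) →
              cbar ≤ ε * (((q'.1 - p'.1 + 1 : ℤ)) : ℝ) →
              ∀ S : Set Pt,
                S = {p : Pt | p ∈ bdryIn I ∧ (p.1, p.2 - 1) ∈ bdryOut I ∧
                      ε * (p'.1 : ℝ) + 2 * ε ^ μ ≤ ε * (p.1 : ℝ) ∧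
                      ε * (p.1 : ℝ) ≤ ε * (q'.1 : ℝ) - 2 * ε ^ μ} →
                ((∀ p ∈ S, ∀ q ∈ I, p.2 ≤ q.2 + 1) ∧
                 (∀ p ∈ S, ε * |((p.2 - p'.2 : ℤ) : ℝ)| ≤ c * ε) ∧
                 (∀ p ∈ Iset u₀, p ∉ Rbox I →
                    ENNReal.ofReal ε * dB p (Iset u₀) ≤ ENNReal.ofReal (c * ε))) := by
  have hk : (0 : ℝ) < (1 - k) / 2 := by linarith
  refine ⟨16 * ζ / cbar + 1, by positivity, fun Rbar μ hμ hμ' => ?_⟩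
  obtain ⟨T, hT⟩ := Filter.eventually_atTop.1 <| eventually_exists_parameters (ρ := 2 * |Rbar|)
    hk hζ hc (by positivity) hμ hμ'
  refine ⟨(max T 1)⁻¹, by positivity, ?_⟩
  rintro ε hε hεT u₀ u₁ ⟨hst, hfin, ⟨z, hz⟩, y₁, y₂, x₁, x₂, hbox, hy₁, hy₂, hx₁, hx₂⟩ hmin _
    ⟨p₀, hp₀, rfl⟩ hsub hrect p' q' hp' hq' hpq hlow - hlen _ rfl
  obtain ⟨R, n, B, j, hR, hRℓ, hMℓ, hc₁, hsm, hexp, hB, hj, hn, hbig, hRM, hnM, hM0⟩ :=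
    hT ε⁻¹ ((le_max_left T 1).trans ((le_inv_comm₀ hε (by positivity)).1 hεT))
  rw [inv_inv] at hc₁ hsm hexp
  obtain ⟨I, A, I₀, φ, hr, hI₀, hs, hdB, hopt⟩ :=
    hmin.exists_opt hε (by linarith) hk₂ hζ hfin ⟨p', hp'⟩
  rw [← hr.A_eq] at hrect
  rw [← hI₀] at hst hz hbox hy₁ hy₂ hx₁ hx₂ hp' hq' hlow
  rw [← hr.I_eq] at hp₀ hsub ⊢
  set M : ℤ := ⌊(ε⁻¹) ^ (1 - μ)⌋ + 1 with hMdef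
  have hceil : ∀ {m : ℕ}, cbar / ε ≤ (m : ℝ) → ⌈cbar * ε⁻¹⌉ ≤ (m : ℤ) := fun h =>
    Int.ceil_le.2 (by rw [← div_eq_mul_inv]; exact_mod_cast h)
  have hset := hopt.setup hs hst.stair (exists_two_le_nb rfl hrect) hbox (hceil hy₁) (hceil hy₂)
    (hceil hx₁) (hceil hx₂) (fun p hp q hq =>
      ⟨abs_sub_le_ceil hε ((le_add_of_nonneg_right (sq_nonneg _)).trans (hz p hp))
        ((le_add_of_nonneg_right (sq_nonneg _)).trans (hz q hq)),
      abs_sub_le_ceil hε ((le_add_of_nonneg_left (sq_nonneg _)).trans (hz p hp))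
        ((le_add_of_nonneg_left (sq_nonneg _)).trans (hz q hq))⟩) hR hexp hRℓ
  have hb : Bot I₀ p'.2 p'.1 q'.1 ⌈cbar * ε⁻¹⌉ := by
    refine ⟨hlow, fun i h1 h2 => hst.2.1 p' hp' q' hq' hpq (i, p'.2) rfl h1 h2, Int.ceil_le.2 ?_⟩
    rw [← div_eq_mul_inv, div_le_iff₀ hε, mul_comm]
    exact hlen
  have hC := stepClosed_stComp hp₀
  have hdeep : ∀ p, M ≤ φ p → p ∈ stComp (I : Set Pt) p₀ := fun p hp => by
    refine hsub ⟨?_, notMem_closeLayer hε (hdB p) hp⟩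
    rw [← hI₀]
    by_contra hpI
    have := hs.neg hpI
    omega
  have hbound : ∀ {m : ℝ}, ε / ζ * ⌈cbar * ε⁻¹⌉ * m ≤ 16 → m ≤ 16 * ζ / cbar := fun {m} hm => by
    rcases le_or_gt m 0 with h0 | h0
    · exact h0.trans (by positivity)
    · rw [le_div_iff₀ hc]
      have h1 : cbar / ζ * m ≤ 16 := by
        refine le_trans ?_ hm
        gcongr
        calc cbar / ζ = ε / ζ * (cbar * ε⁻¹) := by field_simp
          _ ≤ _ := by gcongr; exact Int.le_ceil _
      calc m * cbar = cbar / ζ * m * ζ := by field_simp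
        _ ≤ 16 * ζ := by gcongr
  have hpow : ε ^ μ = ε * (ε⁻¹) ^ (1 - μ) := rpow_eq_mul_inv_rpow hε μ
  have hfl : ((M - 1 : ℤ) : ℝ) ≤ (ε⁻¹) ^ (1 - μ) := by
    rw [hMdef, add_sub_cancel_right]
    exact Int.floor_le _
  have hside : ∀ p : Pt, p ∈ bdryIn (stComp (I : Set Pt) p₀) ∧
      (p.1, p.2 - 1) ∈ bdryOut (stComp (I : Set Pt) p₀) ∧
      ε * (p'.1 : ℝ) + 2 * ε ^ μ ≤ ε * (p.1 : ℝ) ∧ ε * (p.1 : ℝ) ≤ ε * (q'.1 : ℝ) - 2 * ε ^ μ →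
      (∀ q ∈ stComp (I : Set Pt) p₀, p.2 ≤ q.2 + 1) ∧ p'.2 ≤ p.2 ∧
        ε / ζ * ⌈cbar * ε⁻¹⌉ * ((p.2 - p'.2 - 1 : ℤ) : ℝ) ≤ 16 := by
    rintro p ⟨h1, h2, h3, h4⟩
    rw [hpow] at h3 h4
    refine hset.low_side hb hC (stComp_subset hp₀) (fun q hq r hr => conn_stComp hq hr) hdeep
      (by omega) hMℓ hc₁ hsm hB hj hn hbig (by omega) (by omega) h1.1 h2.1 ?_ ?_
    · have : (p'.1 : ℝ) + 2 * ((M - 1 : ℤ) : ℝ) ≤ p.1 := by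
        refine le_of_mul_le_mul_left ?_ hε
        nlinarith
      exact_mod_cast this
    · have : (p.1 : ℝ) ≤ q'.1 - 2 * ((M - 1 : ℤ) : ℝ) := by
        refine le_of_mul_le_mul_left ?_ hε
        nlinarith
      exact_mod_cast this
  refine ⟨fun p hp => (hside p hp).1, fun p hp => ?_, fun p hp hpC => ?_⟩
  · obtain ⟨-, h1, h2⟩ := hside p hp
    have h3 := hbound h2
    have h1' : (0 : ℝ) ≤ ((p.2 - p'.2 : ℤ) : ℝ) := by exact_mod_cast sub_nonneg.2 h1
    rw [abs_of_nonneg h1', mul_comm]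
    gcongr
    push_cast at h3 ⊢
    linarith
  · rw [← hI₀] at hp
    have h1 := hbound (hset.depth_le_of_notMem_Rbox hC hdeep (by omega) hMℓ hp hpC)
    rw [hdB, natAbs_cast_eq_ofReal (by linarith [hs.pos hp]), ← ENNReal.ofReal_mul hε.le, mul_comm]
    exact ENNReal.ofReal_le_ofReal (by gcongr; linarith)

end BEG
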